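/- There exist γ₀ ∈ (0,1), λ₀ ≥ 8 and a constant C, depending only on the cutoffs, such that for all 0 < h ≤ 1, all 0 < γ ≤ γ₀ with λ_γ = γ^{3/2}/h ≥ λ₀, all a with 0 < a < γ/4, all X ≥ 0, Y ∈ ℝ and all T with 1 ≤ |T| ≤ 9, writing t := √γ T: Σ_{N∈ℤ, |N| ≤ 2} |W_{N,γ}(T,X,Y)| ≤ C (√γ/h²) min(1, (h/(γ|t|))^{1/3}). -/

import Mathlib

open Real Complex Filter MeasureTheory

/-- `A₊(z) = e^{-iπ/3} Ai(e^{-iπ/3} z)`. -/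
noncomputable def Aplus (Ai : ℂ → ℂ) (z : ℂ) : ℂ :=
  Complex.exp (-(Real.pi / 3 : ℂ) * Complex.I) * Ai (Complex.exp (-(Real.pi / 3 : ℂ) * Complex.I) * z)

/-- `A₋(z) = e^{iπ/3} Ai(e^{iπ/3} z)`. -/
noncomputable def Aminus (Ai : ℂ → ℂ) (z : ℂ) : ℂ :=
  Complex.exp ((Real.pi / 3 : ℂ) * Complex.I) * Ai (Complex.exp ((Real.pi / 3 : ℂ) * Complex.I) * z)

/-- `B(u) = (4/3)u + π/2 − L(u^{2/3})`. -/
noncomputable def Bfun (L : ℝ → ℝ) (u : ℝ) : ℝ :=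
  (4/3) * u + Real.pi / 2 - L (u ^ ((2 : ℝ)/3))

/-- The phase `Ψ_{N,a,γ}(T,X,Y,Υ,S,A,η)` of the transverse reflected waves,
with `λ_γ = γ^{3/2}/h`. -/
noncomputable def PsiTrans (L : ℝ → ℝ) (h γ a : ℝ) (N : ℤ) (T X Y Υ S A η : ℝ) : ℝ :=
  η * (Y + Υ ^ 3 / 3 + Υ * (X - A) + S ^ 3 / 3 + S * (a / γ - A)
      + T * (A - 1) / (Real.sqrt (1 + γ * A) + Real.sqrt (1 + γ))
      - (4/3) * (N : ℝ) * A ^ ((3:ℝ)/2))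
    + ((N : ℝ) / (γ ^ ((3:ℝ)/2) / h)) * Bfun L (η * (γ ^ ((3:ℝ)/2) / h) * A ^ ((3:ℝ)/2))

/-- The `N`-th transverse reflected wave `W_{N,γ}(T,X,Y)`; the integration variables are
`S = v.1`, `Υ = v.2.1`, `A = v.2.2.1`, `η = v.2.2.2`. -/
noncomputable def Wtrans (L : ℝ → ℝ) (ψ χ₂ ψ₂ : ℝ → ℝ)
    (h γ a : ℝ) (N : ℤ) (T X Y : ℝ) : ℂ :=
  ((γ ^ 2 / (2 * Real.pi * h) ^ 3 : ℝ) : ℂ) * ∫ v : ℝ × ℝ × ℝ × ℝ,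
    Complex.exp (Complex.I *
      (((γ ^ ((3:ℝ)/2) / h) * PsiTrans L h γ a N T X Y v.2.1 v.1 v.2.2.1 v.2.2.2 : ℝ) : ℂ)) *
    ((v.2.2.2 ^ 2 * ψ v.2.2.2 * χ₂ v.1 * χ₂ v.2.1 * ψ₂ v.2.2.1 : ℝ) : ℂ)

/-- `G^♭(T,X,Y) = Σ_{|N| ≤ 2γ^{−1/2}} W_{N,γ}(T,X,Y)`. -/
noncomputable def Gflat (L : ℝ → ℝ) (ψ χ₂ ψ₂ : ℝ → ℝ)
    (h γ a : ℝ) (T X Y : ℝ) : ℂ :=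
  ∑' N : ℤ, Set.indicator {N : ℤ | |(N : ℝ)| ≤ 2 / Real.sqrt γ}
    (fun N => Wtrans L ψ χ₂ ψ₂ h γ a N T X Y) N

/-- The Lorentzian kernel `δ² / (x² + δ²)`. -/
noncomputable def lorentz (δ x : ℝ) : ℝ := δ ^ 2 / (x ^ 2 + δ ^ 2)

theorem lorentz_nonneg (δ x : ℝ) : 0 ≤ lorentz δ x := by
  unfold lorentz; positivity

theorem lorentz_le_one (δ x : ℝ) : lorentz δ x ≤ 1 := by
  unfold lorentz
  exact div_le_one_of_le₀ (by nlinarith [sq_nonneg x]) (by positivity)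

theorem continuous_lorentz {δ : ℝ} (hδ : 0 < δ) : Continuous (lorentz δ) := by
  unfold lorentz
  exact continuous_const.div (by fun_prop) (fun x => by positivity)

theorem lorentz_le_of_le {δ ρ x : ℝ} (hρ : 0 < ρ) (hx : ρ ≤ |x|) :
    lorentz δ x ≤ δ ^ 2 / ρ ^ 2 := by
  unfold lorentz
  have : ρ ^ 2 ≤ x ^ 2 := by
    rw [← sq_abs x]; exact pow_le_pow_left₀ hρ.le hx 2
  gcongr
  nlinarith [sq_nonneg δ]

theorem ContinuousOn.sign_of_le_abs {g : ℝ → ℝ} {l r c : ℝ} (hg : ContinuousOn g (Set.Icc l r))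
    (hc : 0 < c) (h : ∀ x ∈ Set.Icc l r, c ≤ |g x|) :
    (∀ x ∈ Set.Icc l r, c ≤ g x) ∨ (∀ x ∈ Set.Icc l r, g x ≤ -c) := by
  by_contra! hcon
  obtain ⟨⟨x, hx, hx1⟩, y, hy, hy1⟩ := hcon
  have hx2 : g x ≤ -c := by
    rcases le_abs.1 (h x hx) with h' | h' <;> linarith
  have hy2 : c ≤ g y := by
    rcases le_abs.1 (h y hy) with h' | h' <;> linarith
  have := (isPreconnected_Icc.image g hg).ordConnected.out
    (Set.mem_image_of_mem g hx) (Set.mem_image_of_mem g hy)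
  obtain ⟨z, hz, hz0⟩ := this (show (0 : ℝ) ∈ Set.Icc (g x) (g y) from ⟨by linarith, by linarith⟩)
  have := h z hz
  rw [hz0, abs_zero] at this
  linarith

theorem integral_abs_deriv_mul_lorentz_le {q q' : ℝ → ℝ} {l r δ : ℝ} (hlr : l ≤ r) (hδ : 0 < δ)
    (hq : ∀ x ∈ Set.Icc l r, HasDerivAt q (q' x) x) (hc : ContinuousOn q' (Set.Icc l r))
    (hs : (∀ x ∈ Set.Icc l r, 0 ≤ q' x) ∨ ∀ x ∈ Set.Icc l r, q' x ≤ 0) :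
    ∫ x in l..r, |q' x| * lorentz δ (q x) ≤ Real.pi * δ := by
  have hqc : ContinuousOn q (Set.Icc l r) := fun x hx => (hq x hx).continuousAt.continuousWithinAt
  have hI : IntervalIntegrable (fun x => q' x * lorentz δ (q x)) volume l r := by
    apply ContinuousOn.intervalIntegrable
    rw [Set.uIcc_of_le hlr]
    exact hc.mul ((continuous_lorentz hδ).comp_continuousOn hqc)
  have hder : ∀ x ∈ Set.uIcc l r,
      HasDerivAt (fun x => δ * Real.arctan (q x / δ)) (q' x * lorentz δ (q x)) x := by
    intro x hx
    rw [Set.uIcc_of_le hlr] at hx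
    have := (((hq x hx).div_const δ).arctan).const_mul δ
    refine this.congr_deriv ?_
    unfold lorentz
    field_simp
    ring
  have key := intervalIntegral.integral_eq_sub_of_hasDerivAt hder hI
  have hb : |δ * Real.arctan (q r / δ) - δ * Real.arctan (q l / δ)| ≤ Real.pi * δ := by
    rw [← mul_sub, abs_mul, abs_of_pos hδ, mul_comm]
    gcongr
    rw [abs_le]
    constructor <;> linarith [Real.arctan_lt_pi_div_two (q r / δ),
      Real.arctan_lt_pi_div_two (q l / δ), Real.neg_pi_div_two_lt_arctan (q r / δ),
      Real.neg_pi_div_two_lt_arctan (q l / δ)]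
  rcases hs with hs | hs
  · have : ∫ x in l..r, |q' x| * lorentz δ (q x) = ∫ x in l..r, q' x * lorentz δ (q x) := by
      apply intervalIntegral.integral_congr
      intro x hx
      rw [Set.uIcc_of_le hlr] at hx
      simp only [abs_of_nonneg (hs x hx)]
    rw [this, key]
    exact (abs_le.1 hb).2
  · have : ∫ x in l..r, |q' x| * lorentz δ (q x) = - ∫ x in l..r, q' x * lorentz δ (q x) := by
      rw [← intervalIntegral.integral_neg]
      apply intervalIntegral.integral_congr
      intro x hx
      rw [Set.uIcc_of_le hlr] at hx
      simp only [abs_of_nonpos (hs x hx)]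
      ring
    rw [this, key]
    linarith [(abs_le.1 hb).1]

theorem integral_lorentz_le {δ : ℝ} (hδ : 0 < δ) {l r : ℝ} (hlr : l ≤ r) :
    ∫ x in l..r, lorentz δ x ≤ Real.pi * δ := by
  have := integral_abs_deriv_mul_lorentz_le (q := id) (q' := fun _ => 1) hlr hδ
    (fun x _ => hasDerivAt_id x) continuousOn_const (Or.inl fun _ _ => zero_le_one)
  simpa using this

/-- If `|q'| ≥ c`, the Lorentzian of `q` has integral `O(δ)`. -/
theorem integral_lorentz_comp_le {q q' : ℝ → ℝ} {l r δ c : ℝ} (hlr : l ≤ r) (hδ : 0 < δ)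
    (hc0 : 0 < c)
    (hq : ∀ x ∈ Set.Icc l r, HasDerivAt q (q' x) x) (hc : ContinuousOn q' (Set.Icc l r))
    (hs : ∀ x ∈ Set.Icc l r, c ≤ |q' x|) :
    ∫ x in l..r, lorentz δ (q x) ≤ Real.pi * δ / c := by
  have hqc : ContinuousOn q (Set.Icc l r) := fun x hx => (hq x hx).continuousAt.continuousWithinAt
  have h1 := integral_abs_deriv_mul_lorentz_le hlr hδ hq hc (by
    rcases hc.sign_of_le_abs hc0 hs with h | h
    · exact Or.inl fun x hx => hc0.le.trans (h x hx)
    · exact Or.inr fun x hx => (h x hx).trans (by linarith))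
  have hl := (continuous_lorentz hδ).comp_continuousOn hqc
  have h2 : ∫ x in l..r, c * lorentz δ (q x) ≤ ∫ x in l..r, |q' x| * lorentz δ (q x) := by
    apply intervalIntegral.integral_mono_on hlr
    · apply ContinuousOn.intervalIntegrable
      rw [Set.uIcc_of_le hlr]
      exact continuousOn_const.mul hl
    · apply ContinuousOn.intervalIntegrable
      rw [Set.uIcc_of_le hlr]
      exact hc.abs.mul hl
    · intro x hx
      exact mul_le_mul_of_nonneg_right (hs x hx) (lorentz_nonneg _ _)
  rw [intervalIntegral.integral_const_mul] at h2
  rw [le_div_iff₀ hc0]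
  linarith

theorem exists_sign_change {p p' : ℝ → ℝ} {l r c : ℝ} (hlr : l ≤ r) (hc0 : 0 < c)
    (hp : ∀ x ∈ Set.Icc l r, HasDerivAt p (p' x) x) (hc : ContinuousOn p' (Set.Icc l r))
    (hs : ∀ x ∈ Set.Icc l r, c ≤ |p' x|) :
    ∃ m ∈ Set.Icc l r, ((∀ x ∈ Set.Icc l m, 0 ≤ p x) ∨ ∀ x ∈ Set.Icc l m, p x ≤ 0) ∧
      ((∀ x ∈ Set.Icc m r, 0 ≤ p x) ∨ ∀ x ∈ Set.Icc m r, p x ≤ 0) := by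
  have hpc : ContinuousOn p (Set.Icc l r) := fun x hx => (hp x hx).continuousAt.continuousWithinAt
  have hmono : MonotoneOn p (Set.Icc l r) ∨ AntitoneOn p (Set.Icc l r) := by
    rcases hc.sign_of_le_abs hc0 hs with h | h
    · left
      apply monotoneOn_of_deriv_nonneg (convex_Icc l r) hpc
      · intro x hx
        exact (hp x (interior_subset hx)).differentiableAt.differentiableWithinAt
      · intro x hx
        rw [(hp x (interior_subset hx)).deriv]
        exact hc0.le.trans (h x (interior_subset hx))
    · right
      apply antitoneOn_of_deriv_nonpos (convex_Icc l r) hpc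
      · intro x hx
        exact (hp x (interior_subset hx)).differentiableAt.differentiableWithinAt
      · intro x hx
        rw [(hp x (interior_subset hx)).deriv]
        exact (h x (interior_subset hx)).trans (by linarith)
  have hl : l ∈ Set.Icc l r := ⟨le_rfl, hlr⟩
  have hr : r ∈ Set.Icc l r := ⟨hlr, le_rfl⟩
  by_cases hz : ∃ m ∈ Set.Icc l r, p m = 0
  · obtain ⟨m, hm, hm0⟩ := hz
    refine ⟨m, hm, ?_⟩
    have hsub1 : ∀ x ∈ Set.Icc l m, x ∈ Set.Icc l r := fun x hx => ⟨hx.1, hx.2.trans hm.2⟩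
    have hsub2 : ∀ x ∈ Set.Icc m r, x ∈ Set.Icc l r := fun x hx => ⟨hm.1.trans hx.1, hx.2⟩
    rcases hmono with h | h
    · exact ⟨Or.inr fun x hx => hm0 ▸ h (hsub1 x hx) hm hx.2,
        Or.inl fun x hx => hm0 ▸ h hm (hsub2 x hx) hx.1⟩
    · exact ⟨Or.inl fun x hx => hm0 ▸ h (hsub1 x hx) hm hx.2,
        Or.inr fun x hx => hm0 ▸ h hm (hsub2 x hx) hx.1⟩
  · push Not at hz
    refine ⟨l, hl, ?_, ?_⟩
    · rcases le_total 0 (p l) with h | h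
      · left; intro x hx; rw [Set.Icc_self] at hx; rwa [Set.mem_singleton_iff.1 hx]
      · right; intro x hx; rw [Set.Icc_self] at hx; rwa [Set.mem_singleton_iff.1 hx]
    · by_contra! hcon
      obtain ⟨⟨x, hx, hx1⟩, y, hy, hy1⟩ := hcon
      have := (isPreconnected_Icc.image p hpc).ordConnected.out
        (Set.mem_image_of_mem p hx) (Set.mem_image_of_mem p hy)
      obtain ⟨z, hz1, hz0⟩ := this (show (0 : ℝ) ∈ Set.Icc (p x) (p y) from ⟨hx1.le, hy1.le⟩)
      exact hz z hz1 hz0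

/-- If `q' = f p` with `f` of constant sign and `|p'| ≥ c`, then `q` changes monotonicity at
most once. -/
theorem integral_abs_deriv_mul_lorentz_le_two {q q' f p p' : ℝ → ℝ} {l r δ c c₀ : ℝ}
    (hlr : l ≤ r) (hδ : 0 < δ) (hc0 : 0 < c) (hc1 : 0 < c₀)
    (hq : ∀ x ∈ Set.Icc l r, HasDerivAt q (q' x) x) (hcq : ContinuousOn q' (Set.Icc l r))
    (hqp : ∀ x ∈ Set.Icc l r, q' x = f x * p x)
    (hf : ContinuousOn f (Set.Icc l r)) (hf0 : ∀ x ∈ Set.Icc l r, c₀ ≤ |f x|)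
    (hp : ∀ x ∈ Set.Icc l r, HasDerivAt p (p' x) x) (hc : ContinuousOn p' (Set.Icc l r))
    (hs : ∀ x ∈ Set.Icc l r, c ≤ |p' x|) :
    ∫ x in l..r, |q' x| * lorentz δ (q x) ≤ 2 * (Real.pi * δ) := by
  obtain ⟨m, hm, h1, h2⟩ := exists_sign_change hlr hc0 hp hc hs
  have hsub1 : Set.Icc l m ⊆ Set.Icc l r := fun x hx => ⟨hx.1, hx.2.trans hm.2⟩
  have hsub2 : Set.Icc m r ⊆ Set.Icc l r := fun x hx => ⟨hm.1.trans hx.1, hx.2⟩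
  have hqc : ContinuousOn q (Set.Icc l r) := fun x hx => (hq x hx).continuousAt.continuousWithinAt
  have hcont : ContinuousOn (fun x => |q' x| * lorentz δ (q x)) (Set.Icc l r) :=
    hcq.abs.mul ((continuous_lorentz hδ).comp_continuousOn hqc)
  have sgn : ∀ s ⊆ Set.Icc l r, ((∀ x ∈ s, 0 ≤ p x) ∨ ∀ x ∈ s, p x ≤ 0) →
      ((∀ x ∈ s, 0 ≤ q' x) ∨ ∀ x ∈ s, q' x ≤ 0) := by
    intro s hss h
    rcases hf.sign_of_le_abs hc1 hf0 with hf' | hf' <;> rcases h with h | h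
    · exact Or.inl fun x hx => by
        rw [hqp x (hss hx)]; exact mul_nonneg (hc1.le.trans (hf' x (hss hx))) (h x hx)
    · exact Or.inr fun x hx => by
        rw [hqp x (hss hx)]
        exact mul_nonpos_of_nonneg_of_nonpos (hc1.le.trans (hf' x (hss hx))) (h x hx)
    · exact Or.inr fun x hx => by
        rw [hqp x (hss hx)]
        exact mul_nonpos_of_nonpos_of_nonneg ((hf' x (hss hx)).trans (by linarith)) (h x hx)
    · exact Or.inl fun x hx => by
        rw [hqp x (hss hx)]
        exact mul_nonneg_of_nonpos_of_nonpos ((hf' x (hss hx)).trans (by linarith)) (h x hx)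
  have e1 := integral_abs_deriv_mul_lorentz_le hm.1 hδ (fun x hx => hq x (hsub1 hx))
    (hcq.mono hsub1) (sgn _ hsub1 h1)
  have e2 := integral_abs_deriv_mul_lorentz_le hm.2 hδ (fun x hx => hq x (hsub2 hx))
    (hcq.mono hsub2) (sgn _ hsub2 h2)
  rw [← intervalIntegral.integral_add_adjacent_intervals (b := m)]
  · linarith
  · apply ContinuousOn.intervalIntegrable
    rw [Set.uIcc_of_le hm.1]; exact hcont.mono hsub1
  · apply ContinuousOn.intervalIntegrable
    rw [Set.uIcc_of_le hm.2]; exact hcont.mono hsub2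

/-- Third-derivative type estimate: the Lorentzian of `q` at scale `ν²` has integral `O(ν)`. -/
theorem integral_lorentz_comp_le_of_second {q q' f p p' : ℝ → ℝ} {l r ν c c₀ : ℝ}
    (hlr : l ≤ r) (hν : 0 < ν) (hc0 : 0 < c) (hc1 : 0 < c₀)
    (hq : ∀ x ∈ Set.Icc l r, HasDerivAt q (q' x) x) (hcq : ContinuousOn q' (Set.Icc l r))
    (hqp : ∀ x ∈ Set.Icc l r, q' x = f x * p x)
    (hf : ContinuousOn f (Set.Icc l r)) (hf0 : ∀ x ∈ Set.Icc l r, c₀ ≤ |f x|)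
    (hp : ∀ x ∈ Set.Icc l r, HasDerivAt p (p' x) x) (hc : ContinuousOn p' (Set.Icc l r))
    (hs : ∀ x ∈ Set.Icc l r, c ≤ |p' x|) :
    ∫ x in l..r, lorentz (ν ^ 2) (q x) ≤ (Real.pi / c + Real.pi / c₀) * ν := by
  have hδ : 0 < ν ^ 2 := by positivity
  have h1 := integral_abs_deriv_mul_lorentz_le_two hlr hδ hc0 hc1 hq hcq hqp hf hf0 hp hc hs
  have h2 := integral_lorentz_comp_le hlr hν hc0 hp hc hs
  have hqc : ContinuousOn q (Set.Icc l r) := fun x hx => (hq x hx).continuousAt.continuousWithinAt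
  have hpc : ContinuousOn p (Set.Icc l r) := fun x hx => (hp x hx).continuousAt.continuousWithinAt
  have k1 := (continuous_lorentz hδ).comp_continuousOn hqc
  have k2 := (continuous_lorentz hν).comp_continuousOn hpc
  have i1 : IntervalIntegrable (fun x => lorentz (ν ^ 2) (q x)) volume l r := by
    apply ContinuousOn.intervalIntegrable; rwa [Set.uIcc_of_le hlr]
  have i2 : IntervalIntegrable (fun x => lorentz ν (p x)) volume l r := by
    apply ContinuousOn.intervalIntegrable; rwa [Set.uIcc_of_le hlr]
  have i3 : IntervalIntegrable (fun x => (1 / (2 * ν * c₀)) * (|q' x| * lorentz (ν ^ 2) (q x)))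
      volume l r := by
    apply ContinuousOn.intervalIntegrable; rw [Set.uIcc_of_le hlr]
    exact continuousOn_const.mul (hcq.abs.mul k1)
  have h3 : ∫ x in l..r, lorentz (ν ^ 2) (q x) ≤ ∫ x in l..r,
      (lorentz ν (p x) + (1 / (2 * ν * c₀)) * (|q' x| * lorentz (ν ^ 2) (q x))) := by
    apply intervalIntegral.integral_mono_on hlr i1 (i2.add i3)
    intro x hx
    have hL0 := lorentz_nonneg (ν ^ 2) (q x)
    have hL1 := lorentz_le_one (ν ^ 2) (q x)
    have hp0 : 1 ≤ lorentz ν (p x) + |p x| / (2 * ν) := by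
      unfold lorentz
      rw [← sq_abs (p x), div_add_div _ _ (by positivity) (by positivity),
        le_div_iff₀ (by positivity)]
      nlinarith [mul_nonneg (abs_nonneg (p x)) (sq_nonneg (|p x| - ν))]
    have hp1 : |p x| / (2 * ν) ≤ 1 / (2 * ν * c₀) * |q' x| := by
      rw [hqp x hx, abs_mul]
      calc |p x| / (2 * ν) = 1 / (2 * ν * c₀) * (c₀ * |p x|) := by field_simp
        _ ≤ _ := by gcongr; exact hf0 x hx
    have hν0 := lorentz_nonneg ν (p x)
    calc lorentz (ν ^ 2) (q x) = lorentz (ν ^ 2) (q x) * 1 := by ring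
      _ ≤ lorentz (ν ^ 2) (q x) * (lorentz ν (p x) + 1 / (2 * ν * c₀) * |q' x|) := by
          gcongr; linarith
      _ ≤ _ := by nlinarith
  rw [intervalIntegral.integral_add i2 i3, intervalIntegral.integral_const_mul] at h3
  calc _ ≤ _ := h3
    _ ≤ Real.pi * ν / c + 1 / (2 * ν * c₀) * (2 * (Real.pi * ν ^ 2)) := by gcongr
    _ = _ := by field_simp

/-- The unimodular exponential `e^{ix}`. -/
noncomputable def osc (x : ℝ) : ℂ := Complex.exp (Complex.I * (x : ℂ))

theorem norm_osc (x : ℝ) : ‖osc x‖ = 1 := by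
  unfold osc; rw [mul_comm]; exact Complex.norm_exp_ofReal_mul_I x

theorem osc_add (x y : ℝ) : osc (x + y) = osc x * osc y := by
  unfold osc; rw [← Complex.exp_add]; push_cast; ring_nf

theorem continuous_osc : Continuous osc := by
  unfold osc; fun_prop

theorem HasDerivAt.osc {Φ : ℝ → ℝ} {Φ' x : ℝ} (h : HasDerivAt Φ Φ' x) :
    HasDerivAt (fun x => osc (Φ x)) (Complex.I * (Φ' : ℂ) * osc (Φ x)) x := by
  unfold _root_.osc
  exact ((h.ofReal_comp.const_mul Complex.I).cexp).congr_deriv (by ring)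

/-- The regularized inverse `x / (x² + δ²)`. -/
noncomputable def regInv (δ x : ℝ) : ℝ := x / (x ^ 2 + δ ^ 2)

/-- The derivative of `regInv`. -/
noncomputable def regInvDeriv (δ x : ℝ) : ℝ := (δ ^ 2 - x ^ 2) / (x ^ 2 + δ ^ 2) ^ 2

theorem continuous_regInv {δ : ℝ} (hδ : 0 < δ) : Continuous (regInv δ) := by
  unfold regInv
  exact continuous_id.div (by fun_prop) (fun x => by positivity)

theorem continuous_regInvDeriv {δ : ℝ} (hδ : 0 < δ) : Continuous (regInvDeriv δ) := by
  unfold regInvDeriv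
  exact Continuous.div (by fun_prop) (by fun_prop) (fun x => by positivity)

theorem hasDerivAt_regInv {δ : ℝ} (hδ : 0 < δ) (x : ℝ) :
    HasDerivAt (regInv δ) (regInvDeriv δ x) x := by
  have h : HasDerivAt (fun x : ℝ => x ^ 2 + δ ^ 2) (2 * x) x := by
    simpa using (hasDerivAt_pow 2 x).add_const (δ ^ 2)
  refine ((hasDerivAt_id x).div h (by positivity)).congr_deriv ?_
  unfold regInvDeriv
  simp only [id]
  congr 1
  ring

theorem mul_regInv {δ : ℝ} (hδ : 0 < δ) (x : ℝ) : x * regInv δ x = 1 - lorentz δ x := by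
  unfold regInv lorentz
  field_simp
  ring

theorem sq_mul_abs_regInv {δ : ℝ} (x : ℝ) : δ ^ 2 * |regInv δ x| = |x| * lorentz δ x := by
  unfold regInv lorentz
  rw [abs_div, abs_of_nonneg (by positivity : 0 ≤ x ^ 2 + δ ^ 2)]
  ring

theorem sq_mul_abs_regInvDeriv {δ : ℝ} (hδ : 0 < δ) (x : ℝ) :
    δ ^ 2 * |regInvDeriv δ x| ≤ lorentz δ x := by
  unfold regInvDeriv lorentz
  rw [abs_div, abs_of_nonneg (by positivity : 0 ≤ (x ^ 2 + δ ^ 2) ^ 2), mul_div_assoc',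
    div_le_div_iff₀ (by positivity) (by positivity)]
  have : |δ ^ 2 - x ^ 2| ≤ x ^ 2 + δ ^ 2 := by
    rw [abs_le]; constructor <;> nlinarith [sq_nonneg x, sq_nonneg δ]
  calc δ ^ 2 * |δ ^ 2 - x ^ 2| * (x ^ 2 + δ ^ 2)
      ≤ δ ^ 2 * (x ^ 2 + δ ^ 2) * (x ^ 2 + δ ^ 2) := by gcongr
    _ = _ := by ring

theorem abs_regInv_le {δ : ℝ} (hδ : 0 < δ) (x : ℝ) : |regInv δ x| ≤ 1 / (2 * δ) := by
  unfold regInv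
  rw [abs_div, abs_of_nonneg (by positivity : 0 ≤ x ^ 2 + δ ^ 2), div_le_div_iff₀ (by positivity)
    (by positivity), ← sq_abs x]
  nlinarith [sq_nonneg (|x| - δ)]

/-- Regularized integration by parts against an oscillating factor of phase `Φ`, `Φ' = f q`. -/
theorem integral_osc_eq {f q q' Φ : ℝ → ℝ} {g g' : ℝ → ℂ} {l r δ μ : ℝ} (hlr : l ≤ r)
    (hδ : 0 < δ) (hμ : 0 < μ)
    (hg : ∀ x ∈ Set.Icc l r, HasDerivAt g (g' x) x) (hg' : ContinuousOn g' (Set.Icc l r))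
    (hq : ∀ x ∈ Set.Icc l r, HasDerivAt q (q' x) x) (hq' : ContinuousOn q' (Set.Icc l r))
    (hΦ : ∀ x ∈ Set.Icc l r, HasDerivAt Φ (f x * q x) x) (hf : ContinuousOn f (Set.Icc l r)) :
    ∫ x in l..r, f x * g x * osc (μ * Φ x) =
      (∫ x in l..r, f x * g x * lorentz δ (q x) * osc (μ * Φ x)) +
      (1 / (Complex.I * μ)) * (g r * regInv δ (q r) * osc (μ * Φ r)
        - g l * regInv δ (q l) * osc (μ * Φ l)
        - ∫ x in l..r, (g' x * regInv δ (q x) + g x * (regInvDeriv δ (q x) * q' x))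
          * osc (μ * Φ x)) := by
  have hgc : ContinuousOn g (Set.Icc l r) := fun x hx => (hg x hx).continuousAt.continuousWithinAt
  have hqc : ContinuousOn q (Set.Icc l r) := fun x hx => (hq x hx).continuousAt.continuousWithinAt
  have hΦc : ContinuousOn Φ (Set.Icc l r) := fun x hx => (hΦ x hx).continuousAt.continuousWithinAt
  have hoc : ContinuousOn (fun x => osc (μ * Φ x)) (Set.Icc l r) :=
    continuous_osc.comp_continuousOn (continuousOn_const.mul hΦc)
  have hfc : ContinuousOn (fun x => (f x : ℂ)) (Set.Icc l r) :=
    Complex.continuous_ofReal.comp_continuousOn hf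
  have hkc : ContinuousOn (fun x => (regInv δ (q x) : ℂ)) (Set.Icc l r) :=
    Complex.continuous_ofReal.comp_continuousOn ((continuous_regInv hδ).comp_continuousOn hqc)
  have hkc' : ContinuousOn (fun x => (regInvDeriv δ (q x) : ℂ)) (Set.Icc l r) :=
    Complex.continuous_ofReal.comp_continuousOn ((continuous_regInvDeriv hδ).comp_continuousOn hqc)
  have hlc : ContinuousOn (fun x => (lorentz δ (q x) : ℂ)) (Set.Icc l r) :=
    Complex.continuous_ofReal.comp_continuousOn ((continuous_lorentz hδ).comp_continuousOn hqc)
  have hqc' : ContinuousOn (fun x => (q' x : ℂ)) (Set.Icc l r) :=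
    Complex.continuous_ofReal.comp_continuousOn hq'
  have ii : ∀ {u : ℝ → ℂ}, ContinuousOn u (Set.Icc l r) → IntervalIntegrable u volume l r := by
    intro u hu
    apply ContinuousOn.intervalIntegrable
    rwa [Set.uIcc_of_le hlr]
  have i1 : IntervalIntegrable (fun x => f x * g x * osc (μ * Φ x)) volume l r :=
    ii ((hfc.mul hgc).mul hoc)
  have i2 : IntervalIntegrable (fun x => f x * g x * lorentz δ (q x) * osc (μ * Φ x)) volume l r :=
    ii (((hfc.mul hgc).mul hlc).mul hoc)
  have i3 : IntervalIntegrable (fun x => (g' x * regInv δ (q x)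
      + g x * (regInvDeriv δ (q x) * q' x)) * osc (μ * Φ x)) volume l r :=
    ii (((hg'.mul hkc).add (hgc.mul (hkc'.mul hqc'))).mul hoc)
  have i4 : IntervalIntegrable (fun x => (Complex.I * μ) * (f x * g x * osc (μ * Φ x)
      - f x * g x * lorentz δ (q x) * osc (μ * Φ x))) volume l r := (i1.sub i2).const_mul _
  have hder : ∀ x ∈ Set.uIcc l r, HasDerivAt (fun x => g x * regInv δ (q x) * osc (μ * Φ x))
      ((g' x * regInv δ (q x) + g x * (regInvDeriv δ (q x) * q' x)) * osc (μ * Φ x)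
        + (Complex.I * μ) * (f x * g x * osc (μ * Φ x)
          - f x * g x * lorentz δ (q x) * osc (μ * Φ x))) x := by
    intro x hx
    rw [Set.uIcc_of_le hlr] at hx
    have h1 := ((hasDerivAt_regInv hδ (q x)).comp x (hq x hx)).ofReal_comp
    have h2 := ((hΦ x hx).const_mul μ).osc
    have h3 := ((hg x hx).mul h1).mul h2
    refine h3.congr_deriv ?_
    have := mul_regInv hδ (q x)
    have hc : (q x : ℂ) * regInv δ (q x) = 1 - lorentz δ (q x) := by exact_mod_cast this
    simp only [Function.comp_apply, Pi.mul_apply]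
    push_cast
    linear_combination (Complex.I * μ * f x * g x * osc (μ * Φ x)) * hc
  have key := intervalIntegral.integral_eq_sub_of_hasDerivAt hder
    (i3.add i4)
  rw [intervalIntegral.integral_add i3 i4,
    intervalIntegral.integral_const_mul, intervalIntegral.integral_sub i1 i2] at key
  have hI : Complex.I * (μ : ℂ) ≠ 0 := mul_ne_zero Complex.I_ne_zero (by exact_mod_cast hμ.ne')
  rw [← key, add_sub_cancel_left, one_div, inv_mul_cancel_left₀ hI]
  ring

/-- Van der Corput type bound in terms of the sublevel quantities of `q`, where `Φ' = f q`. -/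
theorem norm_integral_osc_le {f f' q q' Φ : ℝ → ℝ} {b b' : ℝ → ℂ} {l r δ μ c₀ D M E : ℝ}
    (hlr : l ≤ r) (hδ : 0 < δ) (hμ : 0 < μ) (hc1 : 0 < c₀) (hM : 0 ≤ M) (hD : 0 ≤ D)
    (hb : ∀ x ∈ Set.Icc l r, HasDerivAt b (b' x) x) (hb' : ContinuousOn b' (Set.Icc l r))
    (hbM : ∀ x ∈ Set.Icc l r, ‖b x‖ ≤ M) (hbM' : ∀ x ∈ Set.Icc l r, ‖b' x‖ ≤ M)
    (hq : ∀ x ∈ Set.Icc l r, HasDerivAt q (q' x) x) (hq' : ContinuousOn q' (Set.Icc l r))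
    (hΦ : ∀ x ∈ Set.Icc l r, HasDerivAt Φ (f x * q x) x)
    (hf : ∀ x ∈ Set.Icc l r, HasDerivAt f (f' x) x) (hf' : ContinuousOn f' (Set.Icc l r))
    (hf0 : ∀ x ∈ Set.Icc l r, c₀ ≤ |f x|) (hfD : ∀ x ∈ Set.Icc l r, |f' x| ≤ D)
    (hE : ∫ x in l..r, lorentz δ (q x) ≤ E)
    (hE' : ∫ x in l..r, |q' x| * lorentz δ (q x) ≤ 2 * (Real.pi * δ)) :
    ‖∫ x in l..r, b x * osc (μ * Φ x)‖ ≤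
      M * E + (1 / (μ * δ)) * (M / c₀ + (r - l) * (M / c₀ + M * D / c₀ ^ 2)
        + 2 * Real.pi * M / c₀) := by
  have hbc : ContinuousOn b (Set.Icc l r) := fun x hx => (hb x hx).continuousAt.continuousWithinAt
  have hfc : ContinuousOn f (Set.Icc l r) := fun x hx => (hf x hx).continuousAt.continuousWithinAt
  have hqc : ContinuousOn q (Set.Icc l r) := fun x hx => (hq x hx).continuousAt.continuousWithinAt
  have hfne : ∀ x ∈ Set.Icc l r, f x ≠ 0 := fun x hx h => by
    have := hf0 x hx; rw [h, abs_zero] at this; linarith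
  have hfneC : ∀ x ∈ Set.Icc l r, (f x : ℂ) ≠ 0 := fun x hx => by exact_mod_cast hfne x hx
  have hfcC : ContinuousOn (fun x => (f x : ℂ)) (Set.Icc l r) :=
    Complex.continuous_ofReal.comp_continuousOn hfc
  have hfcC' : ContinuousOn (fun x => (f' x : ℂ)) (Set.Icc l r) :=
    Complex.continuous_ofReal.comp_continuousOn hf'
  set g : ℝ → ℂ := fun x => b x / f x with hgdef
  set g' : ℝ → ℂ := fun x => (b' x * f x - b x * f' x) / (f x : ℂ) ^ 2 with hg'def
  have hg : ∀ x ∈ Set.Icc l r, HasDerivAt g (g' x) x := fun x hx =>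
    (hb x hx).div (hf x hx).ofReal_comp (hfneC x hx)
  have hg' : ContinuousOn g' (Set.Icc l r) :=
    ((hb'.mul hfcC).sub (hbc.mul hfcC')).div (hfcC.pow 2) (fun x hx => pow_ne_zero 2 (hfneC x hx))
  have hgM : ∀ x ∈ Set.Icc l r, ‖g x‖ ≤ M / c₀ := by
    intro x hx
    simp only [hgdef, norm_div, Complex.norm_real, Real.norm_eq_abs]
    gcongr
    · exact hbM x hx
    · exact hf0 x hx
  have hgM' : ∀ x ∈ Set.Icc l r, ‖g' x‖ ≤ M / c₀ + M * D / c₀ ^ 2 := by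
    intro x hx
    have : g' x = b' x / f x - b x * f' x / (f x : ℂ) ^ 2 := by
      simp only [hg'def]; have := hfneC x hx; field_simp
    rw [this]
    refine (norm_sub_le _ _).trans ?_
    simp only [norm_div, norm_mul, norm_pow, Complex.norm_real, Real.norm_eq_abs]
    gcongr
    · exact hbM' x hx
    · exact hf0 x hx
    · exact hbM x hx
    · exact hfD x hx
    · exact hf0 x hx
  have key := integral_osc_eq hlr hδ hμ hg hg' hq hq' hΦ hfc
  have e1 : ∫ x in l..r, b x * osc (μ * Φ x) = ∫ x in l..r, f x * g x * osc (μ * Φ x) := by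
    apply intervalIntegral.integral_congr
    intro x hx
    rw [Set.uIcc_of_le hlr] at hx
    have := hfneC x hx
    simp only [hgdef]; field_simp
  rw [e1, key]
  have hl : l ∈ Set.Icc l r := ⟨le_rfl, hlr⟩
  have hr : r ∈ Set.Icc l r := ⟨hlr, le_rfl⟩
  have k1 := (continuous_lorentz hδ).comp_continuousOn hqc
  have ii : ∀ {u : ℝ → ℝ}, ContinuousOn u (Set.Icc l r) → IntervalIntegrable u volume l r := by
    intro u hu
    apply ContinuousOn.intervalIntegrable
    rwa [Set.uIcc_of_le hlr]
  have n1 : ‖∫ x in l..r, f x * g x * lorentz δ (q x) * osc (μ * Φ x)‖ ≤ M * E := by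
    calc _ ≤ ∫ x in l..r, M * lorentz δ (q x) := by
          apply intervalIntegral.norm_integral_le_of_norm_le hlr _ (ii (continuousOn_const.mul k1))
          refine ae_of_all _ fun x hx => ?_
          have hx' := Set.Ioc_subset_Icc_self hx
          have : (f x : ℂ) * g x = b x := by
            have := hfneC x hx'
            simp only [hgdef]; field_simp
          rw [this, norm_mul, norm_mul, norm_osc, mul_one, Complex.norm_real, Real.norm_eq_abs,
            abs_of_nonneg (lorentz_nonneg _ _)]
          exact mul_le_mul_of_nonneg_right (hbM x hx') (lorentz_nonneg _ _)
      _ ≤ M * E := by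
          rw [intervalIntegral.integral_const_mul]; gcongr
  have k2 : IntervalIntegrable (fun x => M / c₀ * (1 / δ ^ 2) * (|q' x| * lorentz δ (q x)))
      volume l r := ii (continuousOn_const.mul (hq'.abs.mul k1))
  have n2 : ‖∫ x in l..r, (g' x * regInv δ (q x) + g x * (regInvDeriv δ (q x) * q' x))
      * osc (μ * Φ x)‖ ≤
      (r - l) * (M / c₀ + M * D / c₀ ^ 2) * (1 / (2 * δ)) + M / c₀ * (2 * Real.pi) / δ := by
    calc _ ≤ ∫ x in l..r, ((M / c₀ + M * D / c₀ ^ 2) * (1 / (2 * δ))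
            + M / c₀ * (1 / δ ^ 2) * (|q' x| * lorentz δ (q x))) := by
          apply intervalIntegral.norm_integral_le_of_norm_le hlr _
            ((ii continuousOn_const).add k2)
          refine ae_of_all _ fun x hx => ?_
          have hx' := Set.Ioc_subset_Icc_self hx
          rw [norm_mul, norm_osc, mul_one]
          refine (norm_add_le _ _).trans ?_
          simp only [norm_mul, Complex.norm_real, Real.norm_eq_abs]
          have h1 : |regInvDeriv δ (q x)| ≤ 1 / δ ^ 2 * lorentz δ (q x) := by
            rw [one_div, inv_mul_eq_div, le_div_iff₀ (by positivity), mul_comm]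
            exact sq_mul_abs_regInvDeriv hδ _
          have h2 := abs_regInv_le hδ (q x)
          have h3 := hgM x hx'
          have h4 := hgM' x hx'
          calc _ ≤ (M / c₀ + M * D / c₀ ^ 2) * (1 / (2 * δ))
                + M / c₀ * (1 / δ ^ 2 * lorentz δ (q x) * |q' x|) := by gcongr
            _ = _ := by ring
      _ ≤ _ := by
          rw [intervalIntegral.integral_add (ii continuousOn_const) k2, intervalIntegral.integral_const,
            intervalIntegral.integral_const_mul, smul_eq_mul]
          have : M / c₀ * (1 / δ ^ 2) * ∫ x in l..r, |q' x| * lorentz δ (q x) ≤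
              M / c₀ * (1 / δ ^ 2) * (2 * (Real.pi * δ)) := by gcongr
          refine (add_le_add_right this _).trans (le_of_eq ?_)
          field_simp
  have bd : ∀ x ∈ Set.Icc l r, ‖g x * regInv δ (q x) * osc (μ * Φ x)‖ ≤ M / c₀ * (1 / (2 * δ)) := by
    intro x hx
    rw [norm_mul, norm_mul, norm_osc, mul_one, Complex.norm_real, Real.norm_eq_abs]
    have h2 := abs_regInv_le hδ (q x)
    have h3 := hgM x hx
    gcongr
  refine (norm_add_le _ _).trans (add_le_add n1 ?_)
  rw [norm_mul]
  have hn : ‖1 / (Complex.I * (μ : ℂ))‖ = 1 / μ := by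
    rw [norm_div, norm_mul, norm_one, Complex.norm_I, one_mul, Complex.norm_real,
      Real.norm_eq_abs, abs_of_pos hμ]
  rw [hn]
  have hfin : (r - l) * (M / c₀ + M * D / c₀ ^ 2) * (1 / (2 * δ)) ≤
      (r - l) * (M / c₀ + M * D / c₀ ^ 2) * (1 / δ) := by
    have : 0 ≤ (r - l) * (M / c₀ + M * D / c₀ ^ 2) := by
      have := sub_nonneg.2 hlr; positivity
    apply mul_le_mul_of_nonneg_left _ this
    apply one_div_le_one_div_of_le hδ; linarith
  calc _ ≤ 1 / μ * (M / c₀ * (1 / (2 * δ)) + M / c₀ * (1 / (2 * δ)) +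
        ((r - l) * (M / c₀ + M * D / c₀ ^ 2) * (1 / δ) + M / c₀ * (2 * Real.pi) / δ)) := by
        gcongr
        refine (norm_sub_le _ _).trans (add_le_add ((norm_sub_le _ _).trans
          (add_le_add (bd r hr) (bd l hl))) (n2.trans ?_))
        gcongr
    _ = _ := by field_simp; ring

/-- Van der Corput bound `O(μ^{-1/3})` (with `μ = ν⁻³`), `Φ' = f q`, `q' = f p`, assuming
that either `q'` or `p'` is bounded below. -/
theorem vanDerCorput {c₀ c D ℓ : ℝ} (hc1 : 0 < c₀) (hc0 : 0 < c) (hD : 0 ≤ D) (hℓ : 0 ≤ ℓ) :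
    ∃ C : ℝ, 0 ≤ C ∧ ∀ (f f' q q' p p' Φ : ℝ → ℝ) (b b' : ℝ → ℂ) (l r μ ν M : ℝ), l ≤ r →
      r - l ≤ ℓ → 0 < μ → 0 < ν → ν ≤ 1 → μ * ν ^ 3 = 1 → 0 ≤ M →
      (∀ x ∈ Set.Icc l r, HasDerivAt b (b' x) x) → ContinuousOn b' (Set.Icc l r) →
      (∀ x ∈ Set.Icc l r, ‖b x‖ ≤ M) → (∀ x ∈ Set.Icc l r, ‖b' x‖ ≤ M) →
      (∀ x ∈ Set.Icc l r, HasDerivAt Φ (f x * q x) x) →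
      (∀ x ∈ Set.Icc l r, HasDerivAt q (q' x) x) → ContinuousOn q' (Set.Icc l r) →
      (∀ x ∈ Set.Icc l r, q' x = f x * p x) →
      (∀ x ∈ Set.Icc l r, HasDerivAt p (p' x) x) → ContinuousOn p' (Set.Icc l r) →
      (∀ x ∈ Set.Icc l r, HasDerivAt f (f' x) x) → ContinuousOn f' (Set.Icc l r) →
      (∀ x ∈ Set.Icc l r, c₀ ≤ |f x|) → (∀ x ∈ Set.Icc l r, |f' x| ≤ D) →
      ((∀ x ∈ Set.Icc l r, c ≤ |q' x|) ∨ ∀ x ∈ Set.Icc l r, c ≤ |p' x|) →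
      ‖∫ x in l..r, b x * osc (μ * Φ x)‖ ≤ C * M * ν := by
  refine ⟨(Real.pi / c + Real.pi / c₀) + (1 / c₀ + ℓ * (1 / c₀ + D / c₀ ^ 2)
        + 2 * Real.pi / c₀), by positivity, ?_⟩
  intro f f' q q' p p' Φ b b' l r μ ν M hlr hrl hμ hν hν1 hμν hM hb hb' hbM hbM' hΦ hq hq' hqp
    hp hp' hf hf' hf0 hfD hs
  have hδ : 0 < ν ^ 2 := by positivity
  have hE : ∫ x in l..r, lorentz (ν ^ 2) (q x) ≤ (Real.pi / c + Real.pi / c₀) * ν := by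
    rcases hs with hs | hs
    · refine (integral_lorentz_comp_le hlr hδ hc0 hq hq' hs).trans ?_
      have h1 : Real.pi * ν ^ 2 / c ≤ Real.pi / c * ν := by
        rw [div_mul_eq_mul_div]
        gcongr
        nlinarith
      have h2 : 0 ≤ Real.pi / c₀ * ν := by positivity
      nlinarith
    · exact integral_lorentz_comp_le_of_second hlr hν hc0 hc1 hq hq' hqp
        (fun x hx => (hf x hx).continuousAt.continuousWithinAt) hf0 hp hp' hs
  have hE' : ∫ x in l..r, |q' x| * lorentz (ν ^ 2) (q x) ≤ 2 * (Real.pi * ν ^ 2) := by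
    rcases hs with hs | hs
    · refine (integral_abs_deriv_mul_lorentz_le hlr hδ hq hq' ?_).trans ?_
      · rcases hq'.sign_of_le_abs hc0 hs with h | h
        · exact Or.inl fun x hx => hc0.le.trans (h x hx)
        · exact Or.inr fun x hx => (h x hx).trans (by linarith)
      · have : 0 ≤ Real.pi * ν ^ 2 := by positivity
        linarith
    · exact integral_abs_deriv_mul_lorentz_le_two hlr hδ hc0 hc1 hq hq' hqp
        (fun x hx => (hf x hx).continuousAt.continuousWithinAt) hf0 hp hp' hs
  refine (norm_integral_osc_le hlr hδ hμ hc1 hM hD hb hb' hbM hbM' hq hq' hΦ hf hf' hf0 hfD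
    hE hE').trans ?_
  have : 1 / (μ * ν ^ 2) = ν := by
    rw [div_eq_iff (by positivity)]
    linarith
  rw [this]
  have : (r - l) * (M / c₀ + M * D / c₀ ^ 2) ≤ ℓ * (M / c₀ + M * D / c₀ ^ 2) := by gcongr
  calc _ ≤ M * ((Real.pi / c + Real.pi / c₀) * ν) + ν * (M / c₀ + ℓ * (M / c₀ + M * D / c₀ ^ 2)
        + 2 * Real.pi * M / c₀) := by gcongr
    _ = _ := by ring

theorem intervalIntegral_swap_of_continuousOn {f : ℝ → ℝ → ℂ} {a b c d : ℝ} (hab : a ≤ b)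
    (hcd : c ≤ d) (hf : ContinuousOn (Function.uncurry f) (Set.Icc a b ×ˢ Set.Icc c d)) :
    ∫ x in a..b, ∫ y in c..d, f x y = ∫ y in c..d, ∫ x in a..b, f x y := by
  simp only [intervalIntegral.integral_of_le hab, intervalIntegral.integral_of_le hcd]
  apply integral_integral_swap
  rw [Measure.prod_restrict]
  exact (hf.integrableOn_compact (isCompact_Icc.prod isCompact_Icc)).mono_set
    (Set.prod_mono Set.Ioc_subset_Icc_self Set.Ioc_subset_Icc_self)

/-- Translation of an integral over the support of a cutoff. -/
theorem integral_cutoff_translate {χ w : ℝ → ℂ} {R y : ℝ}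
    (hχs : ∀ x, 3 / 2 ≤ |x| → χ x = 0) (hy : |y| + 2 ≤ R) :
    ∫ x in (-(3 / 2 : ℝ))..(3 / 2), χ x * w (y + x) =
      ∫ x in (-R)..R, χ (x - y) * w x := by
  have hy' := abs_le.1 (by linarith : |y| ≤ R - 2)
  rw [intervalIntegral.integral_eq_integral_of_support_subset,
    intervalIntegral.integral_eq_integral_of_support_subset]
  · rw [← integral_sub_right_eq_self (fun x => χ x * w (y + x)) y]
    simp
  · intro x hx
    have h1 : χ (x - y) ≠ 0 := left_ne_zero_of_mul hx
    have h2 : |x - y| < 3 / 2 := by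
      by_contra! h; exact h1 (hχs _ h)
    rw [abs_lt] at h2
    constructor <;> linarith
  · intro x hx
    have h1 : χ x ≠ 0 := left_ne_zero_of_mul hx
    have h2 : |x| < 3 / 2 := by
      by_contra! h; exact h1 (hχs _ h)
    rw [abs_lt] at h2
    constructor <;> linarith

theorem norm_integral_lorentz_mul_le {κ J : ℝ → ℂ} {R δ C₁ C₂ : ℝ} (hR : 0 ≤ R) (hδ : 0 < δ)
    (hC₁ : 0 ≤ C₁)
    (h : ∀ x ∈ Set.Icc (-R) R, ‖κ x * J x‖ ≤ C₁ * lorentz δ x + C₂) :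
    ‖∫ x in (-R)..R, κ x * J x‖ ≤ C₁ * (Real.pi * δ) + 2 * R * C₂ := by
  have hle : -R ≤ R := by linarith
  have k := (continuous_lorentz hδ)
  have i1 : IntervalIntegrable (fun x => C₁ * lorentz δ x) volume (-R) R :=
    (continuous_const.mul k).intervalIntegrable _ _
  have i2 : IntervalIntegrable (fun _ => C₂) volume (-R) R := intervalIntegrable_const
  refine (intervalIntegral.norm_integral_le_of_norm_le hle
    (ae_of_all _ fun x hx => h x (Set.Ioc_subset_Icc_self hx)) (i1.add i2)).trans ?_
  rw [intervalIntegral.integral_add i1 i2, intervalIntegral.integral_const,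
    intervalIntegral.integral_const_mul, smul_eq_mul]
  have := mul_le_mul_of_nonneg_left (integral_lorentz_le hδ hle) hC₁
  linarith

/-- Chain of derivatives with bounds for a real phase derivative `F` on `[1/2, 3/2]`. -/
structure PhaseBounds (F F1 F2 F3 : ℝ → ℝ) (c D : ℝ) : Prop where
  hasDerivAt : ∀ A ∈ Set.Icc (1 / 2 : ℝ) (3 / 2), HasDerivAt F (F1 A) A
  hasDerivAt_one : ∀ A ∈ Set.Icc (1 / 2 : ℝ) (3 / 2), HasDerivAt F1 (F2 A) A
  hasDerivAt_two : ∀ A ∈ Set.Icc (1 / 2 : ℝ) (3 / 2), HasDerivAt F2 (F3 A) A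
  continuousOn_three : ContinuousOn F3 (Set.Icc (1 / 2 : ℝ) (3 / 2))
  le : ∀ A ∈ Set.Icc (1 / 2 : ℝ) (3 / 2), |F A| ≤ D
  le_one : ∀ A ∈ Set.Icc (1 / 2 : ℝ) (3 / 2), |F1 A| ≤ D
  le_two : ∀ A ∈ Set.Icc (1 / 2 : ℝ) (3 / 2), |F2 A| ≤ D
  le_three : ∀ A ∈ Set.Icc (1 / 2 : ℝ) (3 / 2), |F3 A| ≤ D
  ge_one : ∀ A ∈ Set.Icc (1 / 2 : ℝ) (3 / 2), c ≤ |F1 A|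

/-- A `C¹` cutoff supported in `(-3/2, 3/2)`, bounded with its derivative by `B`. -/
structure CutoffBounds (χ χ' : ℝ → ℂ) (B : ℝ) : Prop where
  hasDerivAt : ∀ x, HasDerivAt χ (χ' x) x
  continuous_deriv : Continuous χ'
  le : ∀ x, ‖χ x‖ ≤ B
  le_deriv : ∀ x, ‖χ' x‖ ≤ B
  eq_zero : ∀ x, 3 / 2 ≤ |x| → χ x = 0

theorem CutoffBounds.continuous {χ χ' : ℝ → ℂ} {B : ℝ} (h : CutoffBounds χ χ' B) :
    Continuous χ :=
  continuous_iff_continuousAt.2 fun x => (h.hasDerivAt x).continuousAt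

theorem CutoffBounds.nonneg {χ χ' : ℝ → ℂ} {B : ℝ} (h : CutoffBounds χ χ' B) : 0 ≤ B :=
  (norm_nonneg _).trans (h.le 0)

/-- Phase after the change of variables `Υ = ρ - F(A)`. -/
theorem norm_integral_inner_le {c c₁ D B : ℝ} (hc : 0 < c) (hc₁ : 0 < c₁) (hD : 1 ≤ D)
    (hB : 0 ≤ B) :
    ∃ C ρ₀ : ℝ, 0 ≤ C ∧ 0 < ρ₀ ∧ ∀ (F F1 F2 F3 P : ℝ → ℝ) (g g' χ χ' : ℝ → ℂ)
      (X μ ν M ρ : ℝ), PhaseBounds F F1 F2 F3 c D →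
      ((∀ A ∈ Set.Icc (1 / 2 : ℝ) (3 / 2), c₁ ≤ |1 - 2 * F A * F1 A|) ∨
        ∀ A ∈ Set.Icc (1 / 2 : ℝ) (3 / 2), c₁ ≤ |F2 A + 2 * F1 A ^ 3|) →
      (∀ A ∈ Set.Icc (1 / 2 : ℝ) (3 / 2), HasDerivAt P (F A) A) →
      CutoffBounds χ χ' B →
      0 < μ → 0 < ν → ν ≤ 1 → μ * ν ^ 3 = 1 → 0 ≤ M →
      (∀ A ∈ Set.Icc (1 / 2 : ℝ) (3 / 2), HasDerivAt g (g' A) A) →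
      ContinuousOn g' (Set.Icc (1 / 2 : ℝ) (3 / 2)) →
      (∀ A ∈ Set.Icc (1 / 2 : ℝ) (3 / 2), ‖g A‖ ≤ M) →
      (∀ A ∈ Set.Icc (1 / 2 : ℝ) (3 / 2), ‖g' A‖ ≤ M) → |ρ| ≤ ρ₀ →
      ‖∫ A in (1 / 2 : ℝ)..(3 / 2), g A * χ (ρ - F A) *
        osc (μ * (-P A + (F A - ρ) * A - (F A - ρ) ^ 3 / 3 - X * (F A - ρ)))‖ ≤ C * M * ν := by
  set K : ℝ := 2 * D + D / c ^ 2 + D / c ^ 3 + 3 * D ^ 2 / c ^ 4 + 1 with hK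
  have hK1 : 1 ≤ K := by
    have : 0 ≤ 2 * D + D / c ^ 2 + D / c ^ 3 + 3 * D ^ 2 / c ^ 4 := by positivity
    linarith
  have hD0 : 0 < D := by linarith
  set c₂ : ℝ := c₁ / (2 * D ^ 2) with hc₂
  have hc₂0 : 0 < c₂ := by positivity
  obtain ⟨C, hC, hvdc⟩ := vanDerCorput (c₀ := c) (c := c₂) (D := D) (ℓ := 1) hc hc₂0 hD0.le
    zero_le_one
  refine ⟨C * (B + B * D), c₂ / K, by positivity, by positivity, ?_⟩
  intro F F1 F2 F3 P g g' χ χ' X μ ν M ρ hF hcase hP hχ hμ hν hν1 hμν hM hg hg' hgM hgM' hρ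
  have hFc : ContinuousOn F (Set.Icc (1 / 2 : ℝ) (3 / 2)) :=
    fun x hx => (hF.hasDerivAt x hx).continuousAt.continuousWithinAt
  have hF1c : ContinuousOn F1 (Set.Icc (1 / 2 : ℝ) (3 / 2)) :=
    fun x hx => (hF.hasDerivAt_one x hx).continuousAt.continuousWithinAt
  have hF2c : ContinuousOn F2 (Set.Icc (1 / 2 : ℝ) (3 / 2)) :=
    fun x hx => (hF.hasDerivAt_two x hx).continuousAt.continuousWithinAt
  have hgc : ContinuousOn g (Set.Icc (1 / 2 : ℝ) (3 / 2)) :=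
    fun x hx => (hg x hx).continuousAt.continuousWithinAt
  have hne : ∀ A ∈ Set.Icc (1 / 2 : ℝ) (3 / 2), F1 A ≠ 0 := fun A hA h => by
    have := hF.ge_one A hA; rw [h, abs_zero] at this; linarith
  have hρK : |ρ| * K ≤ c₂ := by rwa [le_div_iff₀ (by linarith)] at hρ
  have hc₂c : 2 * c₂ ≤ c₁ := by
    rw [hc₂, mul_div_assoc', div_le_iff₀ (by positivity)]
    have : 1 ≤ D ^ 2 := by nlinarith
    nlinarith
  have hb : ∀ A ∈ Set.Icc (1 / 2 : ℝ) (3 / 2), HasDerivAt (fun A => g A * χ (ρ - F A))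
      (g' A * χ (ρ - F A) + g A * (χ' (ρ - F A) * (-F1 A : ℝ))) A := by
    intro A hA
    have h1 := (hχ.hasDerivAt (ρ - F A)).scomp A ((hF.hasDerivAt A hA).const_sub ρ)
    refine ((hg A hA).mul h1).congr_deriv ?_
    simp only [Function.comp_apply, Complex.real_smul]
    ring
  have hχc : ContinuousOn (fun A => χ (ρ - F A)) (Set.Icc (1 / 2 : ℝ) (3 / 2)) :=
    hχ.continuous.comp_continuousOn (continuousOn_const.sub hFc)
  have hχc' : ContinuousOn (fun A => χ' (ρ - F A)) (Set.Icc (1 / 2 : ℝ) (3 / 2)) :=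
    hχ.continuous_deriv.comp_continuousOn (continuousOn_const.sub hFc)
  have hF1C : ContinuousOn (fun A => ((-F1 A : ℝ) : ℂ)) (Set.Icc (1 / 2 : ℝ) (3 / 2)) :=
    Complex.continuous_ofReal.comp_continuousOn hF1c.neg
  have main := hvdc F1 F2 (fun A => A - (F A - ρ) ^ 2 - X - ρ / F1 A)
    (fun A => 1 - 2 * (F A - ρ) * F1 A + ρ * F2 A / F1 A ^ 2)
    (fun A => 1 / F1 A - 2 * (F A - ρ) + ρ * F2 A / F1 A ^ 3)
    (fun A => -F2 A / F1 A ^ 2 - 2 * F1 A + ρ * (F3 A / F1 A ^ 3 - 3 * F2 A ^ 2 / F1 A ^ 4))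
    (fun A => -P A + (F A - ρ) * A - (F A - ρ) ^ 3 / 3 - X * (F A - ρ))
    (fun A => g A * χ (ρ - F A))
    (fun A => g' A * χ (ρ - F A) + g A * (χ' (ρ - F A) * (-F1 A : ℝ)))
    (1 / 2) (3 / 2) μ ν ((B + B * D) * M) (by norm_num) (by norm_num) hμ hν hν1 hμν
    (mul_nonneg (by positivity) hM) hb
    ((hg'.mul hχc).add (hgc.mul (hχc'.mul hF1C))) ?_ ?_ ?_ ?_ ?_ ?_ ?_ ?_ hF.hasDerivAt_one hF2c
    hF.ge_one hF.le_two ?_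
  · refine main.trans (le_of_eq (by ring))
  · intro A hA
    rw [norm_mul]
    calc ‖g A‖ * ‖χ (ρ - F A)‖ ≤ M * B := by
          gcongr
          · exact hgM A hA
          · exact hχ.le _
      _ ≤ _ := by
        have : 0 ≤ B * D * M := by positivity
        nlinarith
  · intro A hA
    refine (norm_add_le _ _).trans ?_
    rw [norm_mul, norm_mul, norm_mul, Complex.norm_real, Real.norm_eq_abs, abs_neg]
    calc _ ≤ M * B + M * (B * D) := by
          gcongr
          · exact hgM' A hA
          · exact hχ.le _
          · exact hgM A hA
          · exact hχ.le_deriv _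
          · exact hF.le_one A hA
      _ = _ := by ring
  · intro A hA
    have h0 := hF.hasDerivAt A hA
    have h1 := h0.sub_const ρ
    refine ((((hP A hA).neg.add (h1.mul (hasDerivAt_id A))).sub ((h1.pow 3).div_const 3)).sub
      (h1.const_mul X)).congr_deriv ?_
    have := hne A hA
    simp only [id]
    field_simp
    ring
  · intro A hA
    have h1 := (hF.hasDerivAt A hA).sub_const ρ
    refine ((((hasDerivAt_id A).sub (h1.pow 2)).sub_const X).sub
      ((hasDerivAt_const A ρ).div (hF.hasDerivAt_one A hA) (hne A hA))).congr_deriv ?_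
    ring
  · exact ((continuousOn_const.sub ((continuousOn_const.mul (hFc.sub continuousOn_const)).mul
      hF1c)).add ((continuousOn_const.mul hF2c).div (hF1c.pow 2) fun A hA => pow_ne_zero 2 (hne A hA)))
  · intro A hA
    have := hne A hA
    field_simp
  · intro A hA
    have h1 := (hF.hasDerivAt A hA).sub_const ρ
    have h2 := hF.hasDerivAt_one A hA
    have h3 := hF.hasDerivAt_two A hA
    have hn := hne A hA
    refine ((((hasDerivAt_const A (1 : ℝ)).div h2 hn).sub (h1.const_mul 2)).add
      ((h3.const_mul ρ).div (h2.pow 3) (pow_ne_zero 3 hn))).congr_deriv ?_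
    simp only [Pi.pow_apply]
    field_simp
    ring
  · exact (((hF2c.neg.div (hF1c.pow 2) fun A hA => pow_ne_zero 2 (hne A hA)).sub
      (continuousOn_const.mul hF1c)).add (continuousOn_const.mul
      ((hF.continuousOn_three.div (hF1c.pow 3) fun A hA => pow_ne_zero 3 (hne A hA)).sub
      ((continuousOn_const.mul (hF2c.pow 2)).div (hF1c.pow 4)
        fun A hA => pow_ne_zero 4 (hne A hA)))))
  · refine hcase.imp (fun h A hA => ?_) (fun h A hA => ?_)
    · have e : 1 - 2 * (F A - ρ) * F1 A + ρ * F2 A / F1 A ^ 2 =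
          (1 - 2 * F A * F1 A) - (-(ρ * (2 * F1 A + F2 A / F1 A ^ 2))) := by ring
      have h1 : |-(ρ * (2 * F1 A + F2 A / F1 A ^ 2))| ≤ c₂ := by
        rw [abs_neg, abs_mul]
        refine le_trans ?_ hρK
        gcongr
        refine (abs_add_le _ _).trans ?_
        rw [abs_mul, abs_div, abs_pow, abs_two]
        have : 2 * |F1 A| + |F2 A| / |F1 A| ^ 2 ≤ 2 * D + D / c ^ 2 := by
          gcongr
          exacts [hF.le_one A hA, hF.le_two A hA, hF.ge_one A hA]
        have : 0 ≤ D / c ^ 3 + 3 * D ^ 2 / c ^ 4 := by positivity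
        linarith
      rw [e]
      have := abs_sub_abs_le_abs_sub (1 - 2 * F A * F1 A) (-(ρ * (2 * F1 A + F2 A / F1 A ^ 2)))
      have := h A hA
      linarith
    · have hn := hne A hA
      have e : -F2 A / F1 A ^ 2 - 2 * F1 A + ρ * (F3 A / F1 A ^ 3 - 3 * F2 A ^ 2 / F1 A ^ 4) =
          ρ * (F3 A / F1 A ^ 3 - 3 * F2 A ^ 2 / F1 A ^ 4)
            - (F2 A + 2 * F1 A ^ 3) / F1 A ^ 2 := by
        field_simp
        ring
      have h1 : |ρ * (F3 A / F1 A ^ 3 - 3 * F2 A ^ 2 / F1 A ^ 4)| ≤ c₂ := by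
        rw [abs_mul]
        refine le_trans ?_ hρK
        gcongr
        refine (abs_sub _ _).trans ?_
        rw [abs_div, abs_div, abs_mul, abs_pow, abs_pow, abs_pow, abs_of_pos (three_pos (α := ℝ))]
        have : |F3 A| / |F1 A| ^ 3 + 3 * |F2 A| ^ 2 / |F1 A| ^ 4 ≤
            D / c ^ 3 + 3 * D ^ 2 / c ^ 4 := by
          gcongr
          exacts [hF.le_three A hA, hF.ge_one A hA, hF.le_two A hA, hF.ge_one A hA]
        have : 0 ≤ D / c ^ 2 := by positivity
        linarith
      have h2 : 2 * c₂ ≤ |(F2 A + 2 * F1 A ^ 3) / F1 A ^ 2| := by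
        rw [abs_div, abs_pow, le_div_iff₀ (by positivity)]
        calc 2 * c₂ * |F1 A| ^ 2 ≤ 2 * c₂ * D ^ 2 := by
              gcongr; exact hF.le_one A hA
          _ = c₁ := by rw [hc₂]; field_simp
          _ ≤ _ := h A hA
      rw [e, abs_sub_comm]
      have := abs_sub_abs_le_abs_sub ((F2 A + 2 * F1 A ^ 3) / F1 A ^ 2)
        (ρ * (F3 A / F1 A ^ 3 - 3 * F2 A ^ 2 / F1 A ^ 4))
      linarith

theorem PhaseBounds.continuousOn {F F1 F2 F3 : ℝ → ℝ} {c D : ℝ} (hF : PhaseBounds F F1 F2 F3 c D) :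
    ContinuousOn F (Set.Icc (1 / 2 : ℝ) (3 / 2)) :=
  fun x hx => (hF.hasDerivAt x hx).continuousAt.continuousWithinAt

theorem norm_integral_kernel_le {c c₁ D B : ℝ} (hc : 0 < c) (hc₁ : 0 < c₁) (hD : 1 ≤ D)
    (hB : 0 ≤ B) :
    ∃ C : ℝ, 0 ≤ C ∧ ∀ (F F1 F2 F3 P : ℝ → ℝ) (g g' χ χ' κ : ℝ → ℂ)
      (X μ ν δ M : ℝ), PhaseBounds F F1 F2 F3 c D →
      ((∀ A ∈ Set.Icc (1 / 2 : ℝ) (3 / 2), c₁ ≤ |1 - 2 * F A * F1 A|) ∨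
        ∀ A ∈ Set.Icc (1 / 2 : ℝ) (3 / 2), c₁ ≤ |F2 A + 2 * F1 A ^ 3|) →
      (∀ A ∈ Set.Icc (1 / 2 : ℝ) (3 / 2), HasDerivAt P (F A) A) →
      CutoffBounds χ χ' B →
      0 < μ → 0 < ν → ν ≤ 1 → μ * ν ^ 3 = 1 → 0 < δ → δ ≤ ν → 0 ≤ M →
      (∀ A ∈ Set.Icc (1 / 2 : ℝ) (3 / 2), HasDerivAt g (g' A) A) →
      ContinuousOn g' (Set.Icc (1 / 2 : ℝ) (3 / 2)) →
      (∀ A ∈ Set.Icc (1 / 2 : ℝ) (3 / 2), ‖g A‖ ≤ M) →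
      (∀ A ∈ Set.Icc (1 / 2 : ℝ) (3 / 2), ‖g' A‖ ≤ M) →
      Continuous κ → (∀ ρ, |ρ| ≤ D + 2 → ‖κ ρ‖ ≤ (D + 2) * lorentz δ ρ) →
      ‖∫ A in (1 / 2 : ℝ)..(3 / 2), ∫ Υ in (-(3 / 2 : ℝ))..(3 / 2),
        g A * osc (-(μ * P A)) * (χ Υ * (κ (F A + Υ) * osc (μ * (Υ ^ 3 / 3 + Υ * (X - A)))))‖
        ≤ C * M * (δ * ν) := by
  obtain ⟨C, ρ₀, hC, hρ₀, hin⟩ := norm_integral_inner_le hc hc₁ hD hB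
  set R : ℝ := D + 2 with hR
  have hR0 : 0 < R := by linarith
  refine ⟨R * C * Real.pi + 2 * R * (R * (1 / ρ₀ ^ 2) * B), by positivity, ?_⟩
  intro F F1 F2 F3 P g g' χ χ' κ X μ ν δ M hF hcase hP hχ hμ hν hν1 hμν hδ hδν hM hg hg' hgM hgM'
    hκ hκb
  have hPc : ContinuousOn P (Set.Icc (1 / 2 : ℝ) (3 / 2)) :=
    fun x hx => (hP x hx).continuousAt.continuousWithinAt
  have hFc := hF.continuousOn
  have hgc : ContinuousOn g (Set.Icc (1 / 2 : ℝ) (3 / 2)) :=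
    fun x hx => (hg x hx).continuousAt.continuousWithinAt
  have e1 : ∫ A in (1 / 2 : ℝ)..(3 / 2), ∫ Υ in (-(3 / 2 : ℝ))..(3 / 2),
        g A * osc (-(μ * P A)) * (χ Υ * (κ (F A + Υ) * osc (μ * (Υ ^ 3 / 3 + Υ * (X - A))))) =
      ∫ A in (1 / 2 : ℝ)..(3 / 2), ∫ ρ in (-R)..R, κ ρ * (g A * χ (ρ - F A) *
        osc (μ * (-P A + (F A - ρ) * A - (F A - ρ) ^ 3 / 3 - X * (F A - ρ)))) := by
    apply intervalIntegral.integral_congr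
    intro A hA
    rw [Set.uIcc_of_le (by norm_num)] at hA
    have := integral_cutoff_translate (χ := χ) (R := R) (y := F A)
      (w := fun ρ => κ ρ * osc (μ * ((ρ - F A) ^ 3 / 3 + (ρ - F A) * (X - A)))) hχ.eq_zero
      (by have := hF.le A hA; linarith)
    simp only [add_sub_cancel_left] at this
    simp only [intervalIntegral.integral_const_mul]
    rw [this, ← intervalIntegral.integral_const_mul]
    apply intervalIntegral.integral_congr
    intro ρ _
    simp only
    rw [show μ * (-P A + (F A - ρ) * A - (F A - ρ) ^ 3 / 3 - X * (F A - ρ)) =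
      -(μ * P A) + μ * ((ρ - F A) ^ 3 / 3 + (ρ - F A) * (X - A)) by ring, osc_add]
    ring
  have hfst : Set.MapsTo Prod.fst (Set.Icc (1 / 2 : ℝ) (3 / 2) ×ˢ Set.Icc (-R) R)
      (Set.Icc (1 / 2 : ℝ) (3 / 2)) := fun x hx => hx.1
  have hF2 : ContinuousOn (fun x : ℝ × ℝ => F x.1) (Set.Icc (1 / 2 : ℝ) (3 / 2) ×ˢ Set.Icc (-R) R) :=
    hFc.comp continuousOn_fst hfst
  have hP2 : ContinuousOn (fun x : ℝ × ℝ => P x.1) (Set.Icc (1 / 2 : ℝ) (3 / 2) ×ˢ Set.Icc (-R) R) :=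
    hPc.comp continuousOn_fst hfst
  have hg2 : ContinuousOn (fun x : ℝ × ℝ => g x.1) (Set.Icc (1 / 2 : ℝ) (3 / 2) ×ˢ Set.Icc (-R) R) :=
    hgc.comp continuousOn_fst hfst
  rw [e1, intervalIntegral_swap_of_continuousOn (by norm_num) (by linarith)]
  · simp only [intervalIntegral.integral_const_mul]
    refine (norm_integral_lorentz_mul_le (C₁ := R * (C * M * ν))
      (C₂ := R * (δ ^ 2 / ρ₀ ^ 2) * (M * B)) hR0.le hδ (by positivity) ?_).trans ?_
    · intro ρ hρ
      have hρ' : |ρ| ≤ R := abs_le.2 hρ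
      have hl := lorentz_nonneg δ ρ
      rw [norm_mul]
      rcases le_total |ρ| ρ₀ with h | h
      · have h1 := hin F F1 F2 F3 P g g' χ χ' X μ ν M ρ hF hcase hP hχ hμ hν hν1 hμν hM hg hg'
          hgM hgM' h
        have : 0 ≤ R * (δ ^ 2 / ρ₀ ^ 2) * (M * B) := by positivity
        calc _ ≤ R * lorentz δ ρ * (C * M * ν) := by
              gcongr
              exact hκb ρ hρ'
          _ ≤ _ := by linarith
      · have h1 : ‖∫ A in (1 / 2 : ℝ)..(3 / 2), g A * χ (ρ - F A) *
            osc (μ * (-P A + (F A - ρ) * A - (F A - ρ) ^ 3 / 3 - X * (F A - ρ)))‖ ≤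
            M * B * |(3 / 2 : ℝ) - 1 / 2| := by
          apply intervalIntegral.norm_integral_le_of_norm_le_const
          intro A hA
          rw [Set.uIoc_of_le (by norm_num)] at hA
          rw [norm_mul, norm_osc, mul_one, norm_mul]
          gcongr
          exacts [hgM A (Set.Ioc_subset_Icc_self hA), hχ.le _]
        have h2 : |(3 / 2 : ℝ) - 1 / 2| = 1 := by norm_num
        rw [h2, mul_one] at h1
        have : 0 ≤ R * (C * M * ν) * lorentz δ ρ := by positivity
        calc _ ≤ R * (δ ^ 2 / ρ₀ ^ 2) * (M * B) := by
              gcongr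
              refine (hκb ρ hρ').trans ?_
              gcongr
              exact lorentz_le_of_le hρ₀ h
          _ ≤ _ := by linarith
    · have : δ ^ 2 ≤ δ * ν := by nlinarith
      calc _ ≤ R * (C * M * ν) * (Real.pi * δ) + 2 * R * (R * (δ * ν / ρ₀ ^ 2) * (M * B)) := by
            gcongr
        _ = _ := by ring
  · apply ContinuousOn.mul
    · exact (hκ.comp continuous_snd).continuousOn
    · apply ContinuousOn.mul
      · exact hg2.mul (hχ.continuous.comp_continuousOn (continuousOn_snd.sub hF2))
      · apply continuous_osc.comp_continuousOn
        have hFρ := hF2.sub continuousOn_snd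
        exact continuousOn_const.mul (((hP2.neg.add (hFρ.mul continuousOn_fst)).sub
          ((hFρ.pow 3).div_const 3)).sub (continuousOn_const.mul hFρ))

/-- Amplitudes which are `C²` on `[1/2, 3/2]`, with bounds. -/
structure AmplitudeBounds (a a1 a2 : ℝ → ℂ) (M : ℝ) : Prop where
  hasDerivAt : ∀ A ∈ Set.Icc (1 / 2 : ℝ) (3 / 2), HasDerivAt a (a1 A) A
  hasDerivAt_one : ∀ A ∈ Set.Icc (1 / 2 : ℝ) (3 / 2), HasDerivAt a1 (a2 A) A
  continuousOn_two : ContinuousOn a2 (Set.Icc (1 / 2 : ℝ) (3 / 2))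
  le : ∀ A ∈ Set.Icc (1 / 2 : ℝ) (3 / 2), ‖a A‖ ≤ M
  le_one : ∀ A ∈ Set.Icc (1 / 2 : ℝ) (3 / 2), ‖a1 A‖ ≤ M
  le_two : ∀ A ∈ Set.Icc (1 / 2 : ℝ) (3 / 2), ‖a2 A‖ ≤ M

theorem AmplitudeBounds.nonneg {a a1 a2 : ℝ → ℂ} {M : ℝ} (h : AmplitudeBounds a a1 a2 M) :
    0 ≤ M := (norm_nonneg _).trans (h.le 1 (by norm_num))

theorem AmplitudeBounds.continuousOn {a a1 a2 : ℝ → ℂ} {M : ℝ} (h : AmplitudeBounds a a1 a2 M) :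
    ContinuousOn a (Set.Icc (1 / 2 : ℝ) (3 / 2)) :=
  fun x hx => (h.hasDerivAt x hx).continuousAt.continuousWithinAt

theorem AmplitudeBounds.continuousOn_one {a a1 a2 : ℝ → ℂ} {M : ℝ}
    (h : AmplitudeBounds a a1 a2 M) : ContinuousOn a1 (Set.Icc (1 / 2 : ℝ) (3 / 2)) :=
  fun x hx => (h.hasDerivAt_one x hx).continuousAt.continuousWithinAt

theorem AmplitudeBounds.mul {a a1 a2 b b1 b2 : ℝ → ℂ} {M N : ℝ} (h : AmplitudeBounds a a1 a2 M)
    (k : AmplitudeBounds b b1 b2 N) :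
    AmplitudeBounds (fun A => a A * b A) (fun A => a1 A * b A + a A * b1 A)
      (fun A => a2 A * b A + 2 * (a1 A * b1 A) + a A * b2 A) (4 * (M * N)) where
  hasDerivAt A hA := (h.hasDerivAt A hA).mul (k.hasDerivAt A hA)
  hasDerivAt_one A hA := (((h.hasDerivAt_one A hA).mul (k.hasDerivAt A hA)).add
    ((h.hasDerivAt A hA).mul (k.hasDerivAt_one A hA))).congr_deriv (by ring)
  continuousOn_two := ((h.continuousOn_two.mul k.continuousOn).add
    (continuousOn_const.mul (h.continuousOn_one.mul k.continuousOn_one))).add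
    (h.continuousOn.mul k.continuousOn_two)
  le A hA := by
    have hM := h.nonneg
    have hN := k.nonneg
    rw [norm_mul]
    calc _ ≤ M * N := by
          gcongr
          exacts [h.le A hA, k.le A hA]
      _ ≤ _ := by nlinarith [mul_nonneg hM hN]
  le_one A hA := by
    have hM := h.nonneg
    have hN := k.nonneg
    refine (norm_add_le _ _).trans ?_
    rw [norm_mul, norm_mul]
    calc _ ≤ M * N + M * N := by
          gcongr
          exacts [h.le_one A hA, k.le A hA, h.le A hA, k.le_one A hA]
      _ ≤ _ := by nlinarith [mul_nonneg hM hN]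
  le_two A hA := by
    have hM := h.nonneg
    have hN := k.nonneg
    refine (norm_add₃_le).trans ?_
    rw [norm_mul, norm_mul, norm_mul, norm_mul, Complex.norm_ofNat]
    calc _ ≤ M * N + 2 * (M * N) + M * N := by
          gcongr
          exacts [h.le_two A hA, k.le A hA, h.le_one A hA, k.le_one A hA, h.le A hA, k.le_two A hA]
      _ = _ := by ring

theorem intervalIntegral_eq_setIntegral_prod {f : ℝ → ℝ → ℂ} {a b c d : ℝ} (hab : a ≤ b)
    (hcd : c ≤ d) (hf : ContinuousOn (Function.uncurry f) (Set.Icc a b ×ˢ Set.Icc c d)) :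
    ∫ x in a..b, ∫ y in c..d, f x y =
      ∫ z in Set.Ioc a b ×ˢ Set.Ioc c d, Function.uncurry f z := by
  simp only [intervalIntegral.integral_of_le hab, intervalIntegral.integral_of_le hcd]
  refine (setIntegral_prod (μ := volume) (ν := volume) (Function.uncurry f) ?_).symm
  exact (hf.integrableOn_compact (isCompact_Icc.prod isCompact_Icc)).mono_set
    (Set.prod_mono Set.Ioc_subset_Icc_self Set.Ioc_subset_Icc_self)

theorem norm_intervalIntegral_add₃_le {f g k : ℝ → ℝ → ℂ} {a b c d E₁ E₂ E₃ : ℝ} (hab : a ≤ b)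
    (hcd : c ≤ d) (hf : ContinuousOn (Function.uncurry f) (Set.Icc a b ×ˢ Set.Icc c d))
    (hg : ContinuousOn (Function.uncurry g) (Set.Icc a b ×ˢ Set.Icc c d))
    (hk : ContinuousOn (Function.uncurry k) (Set.Icc a b ×ˢ Set.Icc c d))
    (h₁ : ‖∫ x in a..b, ∫ y in c..d, f x y‖ ≤ E₁) (h₂ : ‖∫ x in a..b, ∫ y in c..d, g x y‖ ≤ E₂)
    (h₃ : ‖∫ x in a..b, ∫ y in c..d, k x y‖ ≤ E₃) :
    ‖∫ x in a..b, ∫ y in c..d, (f x y + g x y + k x y)‖ ≤ E₁ + E₂ + E₃ := by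
  have hi : ∀ {u : ℝ × ℝ → ℂ}, ContinuousOn u (Set.Icc a b ×ˢ Set.Icc c d) →
      IntegrableOn u (Set.Ioc a b ×ˢ Set.Ioc c d) volume := fun hu =>
    (hu.integrableOn_compact (isCompact_Icc.prod isCompact_Icc)).mono_set
      (Set.prod_mono Set.Ioc_subset_Icc_self Set.Ioc_subset_Icc_self)
  rw [intervalIntegral_eq_setIntegral_prod hab hcd hf] at h₁
  rw [intervalIntegral_eq_setIntegral_prod hab hcd hg] at h₂
  rw [intervalIntegral_eq_setIntegral_prod hab hcd hk] at h₃
  rw [intervalIntegral_eq_setIntegral_prod hab hcd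
    (((hf.add hg).add hk).congr fun _ _ => rfl)]
  have : ∫ z in Set.Ioc a b ×ˢ Set.Ioc c d,
      Function.uncurry (fun x y => f x y + g x y + k x y) z =
      (∫ z in Set.Ioc a b ×ˢ Set.Ioc c d, Function.uncurry f z) +
      (∫ z in Set.Ioc a b ×ˢ Set.Ioc c d, Function.uncurry g z) +
      ∫ z in Set.Ioc a b ×ˢ Set.Ioc c d, Function.uncurry k z := by
    rw [← integral_add' (hi hf) (hi hg), ← integral_add' ((hi hf).add (hi hg)) (hi hk)]
    rfl
  rw [this]
  exact (norm_add₃_le).trans (by linarith)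

/-- The kernel `regInv δ / (iμ)`. -/
noncomputable def invKernel (μ δ x : ℝ) : ℂ := (1 / (Complex.I * μ)) * regInv δ x

/-- The kernel `regInvDeriv δ / (iμ)`. -/
noncomputable def invDerivKernel (μ δ x : ℝ) : ℂ := (1 / (Complex.I * μ)) * regInvDeriv δ x

theorem norm_one_div_I_mul {μ : ℝ} (hμ : 0 < μ) : ‖1 / (Complex.I * (μ : ℂ))‖ = 1 / μ := by
  rw [norm_div, norm_mul, norm_one, Complex.norm_I, one_mul, Complex.norm_real,
    Real.norm_eq_abs, abs_of_pos hμ]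

theorem norm_invKernel_le {μ δ R x : ℝ} (hμ : 0 < μ) (hμδ : μ * δ ^ 2 = 1) (hx : |x| ≤ R) :
    ‖invKernel μ δ x‖ ≤ R * lorentz δ x := by
  have h1 : 1 / μ = δ ^ 2 := by field_simp; linarith
  rw [invKernel, norm_mul, norm_one_div_I_mul hμ, h1, Complex.norm_real, Real.norm_eq_abs,
    sq_mul_abs_regInv]
  exact mul_le_mul_of_nonneg_right hx (lorentz_nonneg _ _)

theorem norm_invDerivKernel_le {μ δ x : ℝ} (hμ : 0 < μ) (hδ : 0 < δ) (hμδ : μ * δ ^ 2 = 1) :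
    ‖invDerivKernel μ δ x‖ ≤ lorentz δ x := by
  have h1 : 1 / μ = δ ^ 2 := by field_simp; linarith
  rw [invDerivKernel, norm_mul, norm_one_div_I_mul hμ, h1, Complex.norm_real, Real.norm_eq_abs]
  exact sq_mul_abs_regInvDeriv hδ x

theorem continuous_invKernel {μ δ : ℝ} (hδ : 0 < δ) : Continuous (invKernel μ δ) :=
  continuous_const.mul (Complex.continuous_ofReal.comp (continuous_regInv hδ))

theorem continuous_invDerivKernel {μ δ : ℝ} (hδ : 0 < δ) : Continuous (invDerivKernel μ δ) :=
  continuous_const.mul (Complex.continuous_ofReal.comp (continuous_regInvDeriv hδ))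

/-- Regularized integration by parts with vanishing boundary terms, `Φ' = s q`, `s = ±1`. -/
theorem integral_osc_eq_of_boundary {q q' Φ : ℝ → ℝ} {g g' : ℝ → ℂ} {l r δ μ s : ℝ} (hlr : l ≤ r)
    (hδ : 0 < δ) (hμ : 0 < μ) (hs : s * s = 1) (hl : g l = 0) (hr : g r = 0)
    (hg : ∀ x ∈ Set.Icc l r, HasDerivAt g (g' x) x) (hg' : ContinuousOn g' (Set.Icc l r))
    (hq : ∀ x ∈ Set.Icc l r, HasDerivAt q (q' x) x) (hq' : ContinuousOn q' (Set.Icc l r))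
    (hΦ : ∀ x ∈ Set.Icc l r, HasDerivAt Φ (s * q x) x) :
    ∫ x in l..r, g x * osc (μ * Φ x) =
      ∫ x in l..r, (g x * lorentz δ (q x) + (-s * g' x) * invKernel μ δ (q x)
        + (-s * g x * q' x) * invDerivKernel μ δ (q x)) * osc (μ * Φ x) := by
  have hsC : (s : ℂ) * s = 1 := by exact_mod_cast hs
  have key := integral_osc_eq (f := fun _ => s) (g := fun x => s * g x) (g' := fun x => s * g' x)
    hlr hδ hμ (fun x hx => (hg x hx).const_mul _) (continuousOn_const.mul hg') hq hq' hΦ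
    continuousOn_const
  simp only [hl, hr, mul_zero, zero_mul, sub_zero, zero_sub, ← mul_assoc, hsC, one_mul] at key
  have hgc : ContinuousOn g (Set.Icc l r) := fun x hx => (hg x hx).continuousAt.continuousWithinAt
  have hqc : ContinuousOn q (Set.Icc l r) := fun x hx => (hq x hx).continuousAt.continuousWithinAt
  have hΦc : ContinuousOn Φ (Set.Icc l r) := fun x hx => (hΦ x hx).continuousAt.continuousWithinAt
  have hoc : ContinuousOn (fun x => osc (μ * Φ x)) (Set.Icc l r) :=
    continuous_osc.comp_continuousOn (continuousOn_const.mul hΦc)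
  have hqc' : ContinuousOn (fun x => (q' x : ℂ)) (Set.Icc l r) :=
    Complex.continuous_ofReal.comp_continuousOn hq'
  have i1 : IntervalIntegrable (fun x => g x * lorentz δ (q x) * osc (μ * Φ x)) volume l r := by
    apply ContinuousOn.intervalIntegrable
    rw [Set.uIcc_of_le hlr]
    exact (hgc.mul (Complex.continuous_ofReal.comp_continuousOn
      ((continuous_lorentz hδ).comp_continuousOn hqc))).mul hoc
  have i2 : IntervalIntegrable (fun x => ((-s * g' x) * invKernel μ δ (q x)
        + (-s * g x * q' x) * invDerivKernel μ δ (q x)) * osc (μ * Φ x)) volume l r := by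
    apply ContinuousOn.intervalIntegrable
    rw [Set.uIcc_of_le hlr]
    exact (((continuousOn_const.mul hg').mul ((continuous_invKernel hδ).comp_continuousOn hqc)).add
      (((continuousOn_const.mul hgc).mul hqc').mul
        ((continuous_invDerivKernel hδ).comp_continuousOn hqc))).mul hoc
  rw [key, ← intervalIntegral.integral_neg, ← intervalIntegral.integral_const_mul]
  simp only [add_assoc, add_mul (g _ * _)]
  rw [intervalIntegral.integral_add i1 i2]
  congr 1
  apply intervalIntegral.integral_congr
  intro x _
  simp only [invKernel, invDerivKernel]
  ring

theorem norm_integral_two_le {c c₁ D B : ℝ} (hc : 0 < c) (hc₁ : 0 < c₁) (hD : 1 ≤ D)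
    (hB : 0 ≤ B) :
    ∃ C : ℝ, 0 ≤ C ∧ ∀ (F F1 F2 F3 P : ℝ → ℝ) (a a1 a2 χ χ' : ℝ → ℂ)
      (X μ ν δ M : ℝ), PhaseBounds F F1 F2 F3 c D →
      ((∀ A ∈ Set.Icc (1 / 2 : ℝ) (3 / 2), c₁ ≤ |1 - 2 * F A * F1 A|) ∨
        ∀ A ∈ Set.Icc (1 / 2 : ℝ) (3 / 2), c₁ ≤ |F2 A + 2 * F1 A ^ 3|) →
      (∀ A ∈ Set.Icc (1 / 2 : ℝ) (3 / 2), HasDerivAt P (F A) A) →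
      CutoffBounds χ χ' B →
      0 < μ → 0 < ν → ν ≤ 1 → μ * ν ^ 3 = 1 → 0 < δ → μ * δ ^ 2 = 1 →
      AmplitudeBounds a a1 a2 M → a (1 / 2) = 0 → a (3 / 2) = 0 →
      ‖∫ A in (1 / 2 : ℝ)..(3 / 2), a A * osc (-(μ * P A)) *
        ∫ Υ in (-(3 / 2 : ℝ))..(3 / 2), χ Υ * osc (μ * (Υ ^ 3 / 3 + Υ * (X - A)))‖
        ≤ C * M * (δ * ν) := by
  obtain ⟨C, hC, hker⟩ := norm_integral_kernel_le hc hc₁ hD hB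
  refine ⟨C * (2 + 2 * D), by positivity, ?_⟩
  intro F F1 F2 F3 P a a1 a2 χ χ' X μ ν δ M hF hcase hP hχ hμ hν hν1 hμν hδ hμδ ha hal har
  have hδν : δ ≤ ν := by
    have h1 : δ ^ 2 ≤ ν ^ 2 := by
      have h2 : μ * δ ^ 2 ≤ μ * ν ^ 2 := by
        rw [hμδ, ← hμν]
        gcongr μ * ?_
        exact pow_le_pow_of_le_one hν.le hν1 (by norm_num)
      exact le_of_mul_le_mul_left h2 hμ
    exact (pow_le_pow_iff_left₀ hδ.le hν.le two_ne_zero).1 h1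
  have hM := ha.nonneg
  have hPc : ContinuousOn P (Set.Icc (1 / 2 : ℝ) (3 / 2)) :=
    fun x hx => (hP x hx).continuousAt.continuousWithinAt
  have hFc := hF.continuousOn
  have hF1c : ContinuousOn (fun A => (F1 A : ℂ)) (Set.Icc (1 / 2 : ℝ) (3 / 2)) :=
    Complex.continuous_ofReal.comp_continuousOn
      fun x hx => (hF.hasDerivAt_one x hx).continuousAt.continuousWithinAt
  have hF2c : ContinuousOn (fun A => (F2 A : ℂ)) (Set.Icc (1 / 2 : ℝ) (3 / 2)) :=
    Complex.continuous_ofReal.comp_continuousOn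
      fun x hx => (hF.hasDerivAt_two x hx).continuousAt.continuousWithinAt
  have hcont : ∀ {g κ : ℝ → ℂ}, ContinuousOn g (Set.Icc (1 / 2 : ℝ) (3 / 2)) → Continuous κ →
      ContinuousOn (Function.uncurry fun A Υ => g A * osc (-(μ * P A)) * (χ Υ * (κ (F A + Υ) *
        osc (μ * (Υ ^ 3 / 3 + Υ * (X - A))))))
        (Set.Icc (1 / 2 : ℝ) (3 / 2) ×ˢ Set.Icc (-(3 / 2) : ℝ) (3 / 2)) := by
    intro g κ hg hκ
    have hfst : Set.MapsTo Prod.fst (Set.Icc (1 / 2 : ℝ) (3 / 2) ×ˢ Set.Icc (-(3 / 2) : ℝ) (3 / 2))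
      (Set.Icc (1 / 2 : ℝ) (3 / 2)) := fun x hx => hx.1
    apply ContinuousOn.mul
    · exact (hg.comp continuousOn_fst hfst).mul (continuous_osc.comp_continuousOn
        (continuousOn_const.mul (hPc.comp continuousOn_fst hfst)).neg)
    · apply (hχ.continuous.comp continuous_snd).continuousOn.mul
      apply (hκ.comp_continuousOn ((hFc.comp continuousOn_fst hfst).add continuousOn_snd)).mul
      exact Continuous.continuousOn (continuous_osc.comp (by fun_prop))
  have e1 : ∫ A in (1 / 2 : ℝ)..(3 / 2), a A * osc (-(μ * P A)) *
        ∫ Υ in (-(3 / 2 : ℝ))..(3 / 2), χ Υ * osc (μ * (Υ ^ 3 / 3 + Υ * (X - A))) =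
      ∫ A in (1 / 2 : ℝ)..(3 / 2), ∫ Υ in (-(3 / 2 : ℝ))..(3 / 2),
        (a A * osc (-(μ * P A)) * (χ Υ * ((lorentz δ (F A + Υ) : ℂ) *
          osc (μ * (Υ ^ 3 / 3 + Υ * (X - A)))))
        + a1 A * osc (-(μ * P A)) * (χ Υ * (invKernel μ δ (F A + Υ) *
          osc (μ * (Υ ^ 3 / 3 + Υ * (X - A)))))
        + (a A * F1 A) * osc (-(μ * P A)) * (χ Υ * (invDerivKernel μ δ (F A + Υ) *
          osc (μ * (Υ ^ 3 / 3 + Υ * (X - A)))))) := by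
    simp only [← intervalIntegral.integral_const_mul]
    rw [intervalIntegral_swap_of_continuousOn (a := 1 / 2) (b := 3 / 2) (by norm_num) (by norm_num),
      intervalIntegral_swap_of_continuousOn (a := 1 / 2) (b := 3 / 2) (by norm_num) (by norm_num)]
    · apply intervalIntegral.integral_congr
      intro Υ _
      have key := integral_osc_eq_of_boundary (g := a) (g' := a1) (q := fun A => F A + Υ)
        (q' := F1) (Φ := fun A => -P A - Υ * A) (s := -1) (by norm_num) hδ hμ (by norm_num) hal har
        ha.hasDerivAt ha.continuousOn_one (fun A hA => (hF.hasDerivAt A hA).add_const Υ)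
        (fun x hx => (hF.hasDerivAt_one x hx).continuousAt.continuousWithinAt)
        (fun A hA => ((hP A hA).neg.sub ((hasDerivAt_id A).const_mul Υ)).congr_deriv
          (by ring))
      have hosc : ∀ A, osc (-(μ * P A)) * osc (μ * (Υ ^ 3 / 3 + Υ * (X - A))) =
          osc (μ * (-P A - Υ * A)) * osc (μ * (Υ ^ 3 / 3 + Υ * X)) := by
        intro A
        rw [← osc_add, ← osc_add]
        congr 1
        ring
      have h1 : ∫ A in (1 / 2 : ℝ)..(3 / 2), a A * osc (-(μ * P A)) *
          (χ Υ * osc (μ * (Υ ^ 3 / 3 + Υ * (X - A)))) =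
          χ Υ * osc (μ * (Υ ^ 3 / 3 + Υ * X)) *
            ∫ A in (1 / 2 : ℝ)..(3 / 2), a A * osc (μ * (-P A - Υ * A)) := by
        rw [← intervalIntegral.integral_const_mul]
        apply intervalIntegral.integral_congr
        intro A _
        linear_combination a A * χ Υ * hosc A
      simp only
      rw [h1, key, ← intervalIntegral.integral_const_mul]
      apply intervalIntegral.integral_congr
      intro A _
      simp only [Complex.ofReal_neg, Complex.ofReal_one, neg_neg, one_mul]
      linear_combination -(a A * lorentz δ (F A + Υ) + a1 A * invKernel μ δ (F A + Υ)
        + a A * F1 A * invDerivKernel μ δ (F A + Υ)) * χ Υ * hosc A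
    · exact (((hcont ha.continuousOn (Complex.continuous_ofReal.comp (continuous_lorentz hδ))).add
        (hcont ha.continuousOn_one (continuous_invKernel hδ))).add
        (hcont (ha.continuousOn.mul hF1c) (continuous_invDerivKernel hδ))).congr fun _ _ => rfl
    · simpa using hcont ha.continuousOn (continuous_const (y := (1 : ℂ)))
  rw [e1]
  have b1 := hker F F1 F2 F3 P a a1 χ χ' (fun x => (lorentz δ x : ℂ)) X μ ν δ M hF hcase hP hχ
    hμ hν hν1 hμν hδ hδν hM ha.hasDerivAt ha.continuousOn_one ha.le ha.le_one
    (Complex.continuous_ofReal.comp (continuous_lorentz hδ)) (by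
      intro ρ _
      have := lorentz_nonneg δ ρ
      rw [Complex.norm_real, Real.norm_eq_abs, abs_of_nonneg this]
      nlinarith)
  have b2 := hker F F1 F2 F3 P a1 a2 χ χ' (invKernel μ δ) X μ ν δ M hF hcase hP hχ
    hμ hν hν1 hμν hδ hδν hM ha.hasDerivAt_one ha.continuousOn_two ha.le_one ha.le_two
    (continuous_invKernel hδ) (fun ρ hρ => norm_invKernel_le hμ hμδ hρ)
  have b3 := hker F F1 F2 F3 P (fun A => a A * F1 A) (fun A => a1 A * F1 A + a A * F2 A) χ χ'
    (invDerivKernel μ δ) X μ ν δ (2 * D * M) hF hcase hP hχ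
    hμ hν hν1 hμν hδ hδν (by positivity)
    (fun A hA => (ha.hasDerivAt A hA).mul (hF.hasDerivAt_one A hA).ofReal_comp)
    ((ha.continuousOn_one.mul hF1c).add (ha.continuousOn.mul hF2c)) (by
      intro A hA
      rw [norm_mul, Complex.norm_real, Real.norm_eq_abs]
      calc _ ≤ M * D := by
            gcongr
            exacts [ha.le A hA, hF.le_one A hA]
        _ ≤ _ := by nlinarith [mul_nonneg hM (by linarith : 0 ≤ D)]) (by
      intro A hA
      refine (norm_add_le _ _).trans ?_
      rw [norm_mul, Complex.norm_real, Real.norm_eq_abs, norm_mul, Complex.norm_real,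
        Real.norm_eq_abs]
      calc _ ≤ M * D + M * D := by
            gcongr
            exacts [ha.le_one A hA, hF.le_one A hA, ha.le A hA, hF.le_two A hA]
        _ = _ := by ring)
    (continuous_invDerivKernel hδ) (fun ρ _ => by
      have := lorentz_nonneg δ ρ
      have := norm_invDerivKernel_le (x := ρ) hμ hδ hμδ
      nlinarith)
  refine (norm_intervalIntegral_add₃_le (by norm_num) (by norm_num)
    (hcont ha.continuousOn (Complex.continuous_ofReal.comp (continuous_lorentz hδ)))
    (hcont ha.continuousOn_one (continuous_invKernel hδ))
    (hcont (ha.continuousOn.mul hF1c) (continuous_invDerivKernel hδ)) b1 b2 b3).trans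
    (le_of_eq (by ring))

/-- Truncated Airy-type integral `∫ χ(y) e^{iμ(y³/3 + yx)} dy`. -/
noncomputable def cutoffAiry (χ : ℝ → ℂ) (μ x : ℝ) : ℂ :=
  ∫ y in (-(3 / 2 : ℝ))..(3 / 2), χ y * osc (μ * (y ^ 3 / 3 + y * x))

theorem continuous_cutoffAiry {χ : ℝ → ℂ} (hχ : Continuous χ) (μ : ℝ) :
    Continuous (cutoffAiry χ μ) := by
  apply intervalIntegral.continuous_parametric_intervalIntegral_of_continuous'
  exact (hχ.comp continuous_snd).mul (continuous_osc.comp (by fun_prop))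

theorem norm_cutoffAiry_le : ∃ C : ℝ, 0 ≤ C ∧ ∀ (χ χ' : ℝ → ℂ) (B μ ν x : ℝ),
    CutoffBounds χ χ' B → 0 < μ → 0 < ν → ν ≤ 1 → μ * ν ^ 3 = 1 →
    ‖cutoffAiry χ μ x‖ ≤ C * B * ν := by
  obtain ⟨C, hC, h⟩ := vanDerCorput (c₀ := 1) (c := 2) (D := 0) (ℓ := 3) one_pos two_pos le_rfl
    (by norm_num)
  refine ⟨C, hC, fun χ χ' B μ ν x hχ hμ hν hν1 hμν => ?_⟩
  refine h (fun _ => 1) (fun _ => 0) (fun y => y ^ 2 + x) (fun y => 2 * y) (fun y => 2 * y)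
    (fun _ => 2) (fun y => y ^ 3 / 3 + y * x) χ χ' (-(3 / 2)) (3 / 2) μ ν B (by norm_num)
    (by norm_num) hμ hν hν1 hμν hχ.nonneg (fun y _ => hχ.hasDerivAt y)
    hχ.continuous_deriv.continuousOn (fun y _ => hχ.le y) (fun y _ => hχ.le_deriv y) ?_ ?_
    (by fun_prop) ?_ ?_ (by fun_prop) ?_ (by fun_prop) ?_ ?_ ?_
  · intro y _
    exact (((hasDerivAt_pow 3 y).div_const 3).add ((hasDerivAt_id y).mul_const x)).congr_deriv
      (by norm_num)
  · intro y _
    exact ((hasDerivAt_pow 2 y).add_const x).congr_deriv (by norm_num)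
  · intro y _; simp
  · intro y _
    exact ((hasDerivAt_id y).const_mul 2).congr_deriv (by norm_num)
  · intro y _; exact hasDerivAt_const _ _
  · intro y _; simp
  · intro y _; simp
  · right; intro y _; simp

theorem integral_comp_sqrt {w : ℝ → ℂ} (hw : Continuous w) {y τ₀ : ℝ} (hτ₀ : 0 ≤ τ₀)
    (hy : τ₀ < y) :
    ∫ S in √(y - τ₀)..√(y + τ₀), w S =
      ∫ τ in (-τ₀)..τ₀, (1 / (2 * √(y + τ)) : ℝ) * w √(y + τ) := by
  have hpos : ∀ τ ∈ Set.uIcc (-τ₀) τ₀, 0 < y + τ := by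
    intro τ hτ
    rw [Set.uIcc_of_le (by linarith)] at hτ
    linarith [hτ.1]
  have h := intervalIntegral.integral_deriv_smul_comp (a := -τ₀) (b := τ₀)
    (f := fun τ => √(y + τ)) (f' := fun τ => 1 / (2 * √(y + τ))) (g := w)
    (fun τ hτ => ((hasDerivAt_id τ).const_add y).sqrt (hpos τ hτ).ne')
    (continuousOn_const.div (by fun_prop) fun τ hτ => by
      have := Real.sqrt_pos.2 (hpos τ hτ); positivity) hw
  simp only [Function.comp_apply, Complex.real_smul, ← sub_eq_add_neg] at h
  exact h.symm

/-- Localization of an integral with kernel `κ (S² - y)` near the two roots `S = ±√y`. -/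
theorem norm_integral_sub_near_le {w κ : ℝ → ℂ} {B δ y τ₀ : ℝ} (hw : Continuous w)
    (hκ : Continuous κ) (hwB : ∀ S, |S| ≤ 3 / 2 → ‖w S‖ ≤ B)
    (hκB : ∀ τ, |τ| ≤ 2 → ‖κ τ‖ ≤ 2 * lorentz δ τ) (hy : 1 / 4 ≤ y) (hy' : y ≤ 3 / 2)
    (hτ₀ : 0 < τ₀) (hτ₀' : τ₀ ≤ 1 / 16) :
    ‖(∫ S in (-(3 / 2 : ℝ))..(3 / 2), w S * κ (S ^ 2 - y)) -
      ((∫ τ in (-τ₀)..τ₀, (1 / (2 * √(y + τ)) : ℝ) * (w √(y + τ) * κ τ)) +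
      ∫ τ in (-τ₀)..τ₀, (1 / (2 * √(y + τ)) : ℝ) * (w (-√(y + τ)) * κ τ))‖
      ≤ 6 * B / τ₀ ^ 2 * δ ^ 2 := by
  have hB : 0 ≤ B := (norm_nonneg _).trans (hwB 0 (by norm_num))
  set G : ℝ → ℂ := fun S => w S * κ (S ^ 2 - y) with hG
  have hGc : Continuous G := hw.mul (hκ.comp (by fun_prop))
  have hi : ∀ a b, IntervalIntegrable G volume a b := fun a b => hGc.intervalIntegrable a b
  set s : ℝ := √(y - τ₀) with hs
  set t : ℝ := √(y + τ₀) with ht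
  have hs2 : s ^ 2 = y - τ₀ := Real.sq_sqrt (by linarith)
  have ht2 : t ^ 2 = y + τ₀ := Real.sq_sqrt (by linarith)
  have hs0 : 0 ≤ s := Real.sqrt_nonneg _
  have ht0 : 0 ≤ t := Real.sqrt_nonneg _
  have hst : s ≤ t := Real.sqrt_le_sqrt (by linarith)
  have ht3 : t ≤ 3 / 2 := by nlinarith
  have hsq : ∀ τ ∈ Set.uIcc (-τ₀) τ₀, √(y + τ) ^ 2 - y = τ := by
    intro τ hτ
    rw [Set.uIcc_of_le (by linarith)] at hτ
    rw [Real.sq_sqrt (by linarith [hτ.1])]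
    ring
  have e1 : ∫ τ in (-τ₀)..τ₀, (1 / (2 * √(y + τ)) : ℝ) * (w √(y + τ) * κ τ) =
      ∫ S in s..t, G S := by
    rw [hs, ht, integral_comp_sqrt hGc hτ₀.le (by linarith)]
    apply intervalIntegral.integral_congr
    intro τ hτ
    simp only [hG, hsq τ hτ]
  have e2 : ∫ τ in (-τ₀)..τ₀, (1 / (2 * √(y + τ)) : ℝ) * (w (-√(y + τ)) * κ τ) =
      ∫ S in (-t)..(-s), G S := by
    rw [← intervalIntegral.integral_comp_neg, hs, ht,
      integral_comp_sqrt (w := fun S => G (-S)) (hGc.comp continuous_neg) hτ₀.le (by linarith)]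
    apply intervalIntegral.integral_congr
    intro τ hτ
    simp only [hG, neg_sq, hsq τ hτ]
  have far : ∀ a b : ℝ, a ≤ b → -(3 / 2) ≤ a → b ≤ 3 / 2 →
      (∀ S ∈ Set.Icc a b, τ₀ ≤ |S ^ 2 - y|) →
      ‖∫ S in a..b, G S‖ ≤ B * (2 * (δ ^ 2 / τ₀ ^ 2)) * (b - a) := by
    intro a b hab ha hb h
    have hn := intervalIntegral.norm_integral_le_of_norm_le_const (a := a) (b := b) (f := G)
      (C := B * (2 * (δ ^ 2 / τ₀ ^ 2))) (by
        intro S hS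
        rw [Set.uIoc_of_le hab] at hS
        have hS' : |S| ≤ 3 / 2 := abs_le.2 ⟨by linarith [hS.1], by linarith [hS.2]⟩
        have hS2 : S ^ 2 ≤ 9 / 4 := by
          rw [← sq_abs]; nlinarith [abs_nonneg S]
        rw [hG, norm_mul]
        gcongr
        · exact hwB S hS'
        · refine (hκB _ ?_).trans ?_
          · rw [abs_le]; constructor <;> nlinarith [sq_nonneg S]
          · gcongr
            exact lorentz_le_of_le hτ₀ (h S (Set.Ioc_subset_Icc_self hS)))
    rwa [abs_of_nonneg (by linarith)] at hn
  have f1 := far (-(3 / 2)) (-t) (by linarith) le_rfl (by linarith) (by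
    intro S hS
    refine le_trans ?_ (le_abs_self _)
    nlinarith [hS.1, hS.2])
  have f2 := far (-s) s (by linarith) (by linarith) (by linarith) (by
    intro S hS
    refine le_trans ?_ (neg_le_abs _)
    nlinarith [hS.1, hS.2])
  have f3 := far t (3 / 2) (by linarith) (by linarith) le_rfl (by
    intro S hS
    refine le_trans ?_ (le_abs_self _)
    nlinarith [hS.1, hS.2])
  have split : ∫ S in (-(3 / 2 : ℝ))..(3 / 2), G S = (∫ S in (-(3 / 2 : ℝ))..(-t), G S) +
      (∫ S in (-t)..(-s), G S) + (∫ S in (-s)..s, G S) + (∫ S in s..t, G S) +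
      ∫ S in t..(3 / 2), G S := by
    rw [intervalIntegral.integral_add_adjacent_intervals (hi _ _) (hi _ _),
      intervalIntegral.integral_add_adjacent_intervals (hi _ _) (hi _ _),
      intervalIntegral.integral_add_adjacent_intervals (hi _ _) (hi _ _),
      intervalIntegral.integral_add_adjacent_intervals (hi _ _) (hi _ _)]
  rw [e1, e2, split]
  have e3 : (∫ S in (-(3 / 2 : ℝ))..(-t), G S) +
      (∫ S in (-t)..(-s), G S) + (∫ S in (-s)..s, G S) + (∫ S in s..t, G S) +
      (∫ S in t..(3 / 2), G S) - ((∫ S in s..t, G S) + ∫ S in (-t)..(-s), G S) =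
      (∫ S in (-(3 / 2 : ℝ))..(-t), G S) + (∫ S in (-s)..s, G S) + ∫ S in t..(3 / 2), G S := by
    ring
  rw [e3]
  refine norm_add₃_le.trans ((add_le_add (add_le_add f1 f2) f3).trans ?_)
  have h0 : 0 ≤ B * (2 * (δ ^ 2 / τ₀ ^ 2)) := by positivity
  calc _ = B * (2 * (δ ^ 2 / τ₀ ^ 2)) * (3 - 2 * (t - s)) := by ring
    _ ≤ B * (2 * (δ ^ 2 / τ₀ ^ 2)) * 3 := by gcongr; linarith
    _ = _ := by ring

theorem exists_amplitudeBounds_comp_sub {G : ℝ → ℂ} (hG : ContDiffOn ℝ 2 G (Set.Ioi 0)) :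
    ∃ M : ℝ, ∀ β : ℝ, -(1 / 16) ≤ β → β ≤ 5 / 16 → AmplitudeBounds (fun A => G (A - β))
      (fun A => deriv G (A - β)) (fun A => deriv (deriv G) (A - β)) M := by
  have h1 : ContDiffOn ℝ 1 (deriv G) (Set.Ioi 0) := hG.deriv_of_isOpen isOpen_Ioi (by norm_num)
  have h2 : ContDiffOn ℝ 0 (deriv (deriv G)) (Set.Ioi 0) :=
    h1.deriv_of_isOpen isOpen_Ioi (by norm_num)
  set K : Set ℝ := Set.Icc (3 / 16) (25 / 16) with hK
  have hKsub : K ⊆ Set.Ioi 0 := fun x hx => lt_of_lt_of_le (by norm_num) hx.1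
  have hKc : IsCompact K := isCompact_Icc
  obtain ⟨M0, hM0⟩ := hKc.exists_bound_of_continuousOn (hG.continuousOn.mono hKsub)
  obtain ⟨M1, hM1⟩ := hKc.exists_bound_of_continuousOn (h1.continuousOn.mono hKsub)
  obtain ⟨M2, hM2⟩ := hKc.exists_bound_of_continuousOn (h2.continuousOn.mono hKsub)
  refine ⟨max M0 (max M1 M2), fun β hβ hβ' => ?_⟩
  have hmem : ∀ A ∈ Set.Icc (1 / 2 : ℝ) (3 / 2), A - β ∈ K := fun A hA =>
    ⟨by linarith [hA.1], by linarith [hA.2]⟩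
  have hsub : ∀ A : ℝ, HasDerivAt (fun A => A - β) 1 A := fun A => (hasDerivAt_id A).sub_const β
  have hd : ∀ g : ℝ → ℂ, DifferentiableOn ℝ g (Set.Ioi 0) → ∀ A ∈ Set.Icc (1 / 2 : ℝ) (3 / 2),
      HasDerivAt (fun A => g (A - β)) (deriv g (A - β)) A := by
    intro g hg A hA
    have := ((hg _ (hKsub (hmem A hA))).differentiableAt
      (isOpen_Ioi.mem_nhds (hKsub (hmem A hA)))).hasDerivAt.scomp A (hsub A)
    simpa [Function.comp_def] using this
  refine ⟨hd G (hG.differentiableOn (by norm_num)), hd _ (h1.differentiableOn (by norm_num)), ?_,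
    fun A hA => (hM0 _ (hmem A hA)).trans (le_max_left _ _),
    fun A hA => (hM1 _ (hmem A hA)).trans ((le_max_left _ _).trans (le_max_right _ _)),
    fun A hA => (hM2 _ (hmem A hA)).trans ((le_max_right _ _).trans (le_max_right _ _))⟩
  exact h2.continuousOn.comp (by fun_prop) fun A hA => hKsub (hmem A hA)

/-- Uniform nondegeneracy of the phases obtained by restricting to `S² = A - α + τ`. -/
def PhaseFamilyBounds (h1 : ℝ → ℝ) (α τ₀ c c₁ D : ℝ) : Prop :=
  ∀ ε : ℝ, ε = 1 ∨ ε = -1 → ∀ τ : ℝ, |τ| ≤ τ₀ → ∃ F1 F2 F3 : ℝ → ℝ,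
    PhaseBounds (fun A => ε * (√(A - α + τ) - τ / (2 * √(A - α + τ))) - h1 A) F1 F2 F3 c D ∧
    ((∀ A ∈ Set.Icc (1 / 2 : ℝ) (3 / 2),
      c₁ ≤ |1 - 2 * (ε * (√(A - α + τ) - τ / (2 * √(A - α + τ))) - h1 A) * F1 A|) ∨
      ∀ A ∈ Set.Icc (1 / 2 : ℝ) (3 / 2), c₁ ≤ |F2 A + 2 * F1 A ^ 3|)

theorem norm_integral_near_le {c c₁ D B τ₀ ε : ℝ} (hc : 0 < c) (hc₁ : 0 < c₁) (hD : 1 ≤ D)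
    (hB : 0 ≤ B) (hτ₀ : 0 < τ₀) (hτ₀' : τ₀ ≤ 1 / 16) (hε : ε = 1 ∨ ε = -1) {cS : ℝ → ℂ}
    (hcS : ContDiff ℝ 2 cS) :
    ∃ C : ℝ, 0 ≤ C ∧ ∀ (α X μ ν δ M : ℝ) (h h1 : ℝ → ℝ) (K K1 K2 χ χ' κ : ℝ → ℂ),
      0 ≤ α → α ≤ 1 / 4 → PhaseFamilyBounds h1 α τ₀ c c₁ D →
      (∀ A ∈ Set.Icc (1 / 2 : ℝ) (3 / 2), HasDerivAt h (h1 A) A) →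
      CutoffBounds χ χ' B → 0 < μ → 0 < ν → ν ≤ 1 → μ * ν ^ 3 = 1 → 0 < δ → μ * δ ^ 2 = 1 →
      AmplitudeBounds K K1 K2 M → K (1 / 2) = 0 → K (3 / 2) = 0 →
      Continuous κ → (∀ τ, |τ| ≤ 2 → ‖κ τ‖ ≤ 2 * lorentz δ τ) →
      ‖∫ A in (1 / 2 : ℝ)..(3 / 2), K A * osc (μ * h A) * cutoffAiry χ μ (X - A) *
        ∫ τ in (-τ₀)..τ₀, (1 / (2 * √(A - α + τ)) : ℝ) * (cS (ε * √(A - α + τ)) *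
          osc (μ * ((ε * √(A - α + τ)) ^ 3 / 3 + (ε * √(A - α + τ)) * (α - A))) * κ τ)‖
        ≤ C * M * (δ ^ 2 * ν) := by
  obtain ⟨C, hC, hmain⟩ := norm_integral_two_le hc hc₁ hD hB
  set G : ℝ → ℂ := fun y => (1 / (2 * √y) : ℝ) * cS (ε * √y) with hGdef
  have hG : ContDiffOn ℝ 2 G (Set.Ioi 0) := by
    have hs : ContDiffOn ℝ 2 (fun y : ℝ => √y) (Set.Ioi 0) := fun y hy =>
      (Real.contDiffAt_sqrt (ne_of_gt hy)).contDiffWithinAt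
    apply ContDiffOn.mul
    · exact Complex.ofRealCLM.contDiff.comp_contDiffOn
        (contDiffOn_const.div (contDiffOn_const.mul hs) fun y hy => by
          have := Real.sqrt_pos.2 hy; positivity)
    · exact hcS.comp_contDiffOn (contDiffOn_const.mul hs)
  obtain ⟨M', hM'⟩ := exists_amplitudeBounds_comp_sub hG
  have hM'0 : 0 ≤ M' := (hM' 0 (by norm_num) (by norm_num)).nonneg
  refine ⟨2 * (C * (4 * M')) * Real.pi, by positivity, ?_⟩
  intro α X μ ν δ M h h1 K K1 K2 χ χ' κ hα hα' hph hh hχ hμ hν hν1 hμν hδ hμδ hK hKl hKr hκ hκb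
  have hM := hK.nonneg
  have hε2 : ε ^ 2 = 1 := by rcases hε with rfl | rfl <;> norm_num
  have hε3 : ε ^ 3 = ε := by rw [pow_succ, hε2, one_mul]
  have hhc : ContinuousOn h (Set.Icc (1 / 2 : ℝ) (3 / 2)) :=
    fun x hx => (hh x hx).continuousAt.continuousWithinAt
  have hpos : ∀ A ∈ Set.Icc (1 / 2 : ℝ) (3 / 2), ∀ τ ∈ Set.Icc (-τ₀) τ₀, 0 < A - α + τ :=
    fun A hA τ hτ => by linarith [hA.1, hτ.1]
  set P : ℝ → ℝ → ℝ := fun τ A => -h A - ε * (τ * √(A - α + τ) - 2 / 3 * √(A - α + τ) ^ 3) with hP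
  have e1 : ∫ A in (1 / 2 : ℝ)..(3 / 2), K A * osc (μ * h A) * cutoffAiry χ μ (X - A) *
        ∫ τ in (-τ₀)..τ₀, (1 / (2 * √(A - α + τ)) : ℝ) * (cS (ε * √(A - α + τ)) *
          osc (μ * ((ε * √(A - α + τ)) ^ 3 / 3 + (ε * √(A - α + τ)) * (α - A))) * κ τ) =
      ∫ A in (1 / 2 : ℝ)..(3 / 2), ∫ τ in (-τ₀)..τ₀, κ τ * ((K A * G (A - (α - τ))) *
        osc (-(μ * P τ A)) * cutoffAiry χ μ (X - A)) := by
    apply intervalIntegral.integral_congr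
    intro A hA
    rw [Set.uIcc_of_le (by norm_num)] at hA
    simp only
    rw [← intervalIntegral.integral_const_mul]
    apply intervalIntegral.integral_congr
    intro τ hτ
    rw [Set.uIcc_of_le (by linarith)] at hτ
    simp only [hGdef, hP]
    have hsq : √(A - α + τ) ^ 2 = A - α + τ := Real.sq_sqrt (hpos A hA τ hτ).le
    have e : -(μ * (-h A - ε * (τ * √(A - α + τ) - 2 / 3 * √(A - α + τ) ^ 3))) = μ * h A +
        μ * ((ε * √(A - α + τ)) ^ 3 / 3 + (ε * √(A - α + τ)) * (α - A)) := by
      rw [mul_pow, hε3, show α - A = τ - √(A - α + τ) ^ 2 by rw [hsq]; ring]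
      ring
    rw [e, osc_add, show A - (α - τ) = A - α + τ by ring]
    ring
  have hfst : Set.MapsTo Prod.fst (Set.Icc (1 / 2 : ℝ) (3 / 2) ×ˢ Set.Icc (-τ₀) τ₀)
      (Set.Icc (1 / 2 : ℝ) (3 / 2)) := fun x hx => hx.1
  rw [e1, intervalIntegral_swap_of_continuousOn (by norm_num) (by linarith)]
  · simp only [intervalIntegral.integral_const_mul]
    refine (norm_integral_lorentz_mul_le (C₁ := 2 * (C * (4 * (M * M')) * (δ * ν)))
      (C₂ := 0) hτ₀.le hδ (by positivity) ?_).trans (le_of_eq (by ring))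
    intro τ hτ
    obtain ⟨F1, F2, F3, hF, hcase⟩ := hph ε hε τ (abs_le.2 hτ)
    have hPd : ∀ A ∈ Set.Icc (1 / 2 : ℝ) (3 / 2), HasDerivAt (P τ)
        (ε * (√(A - α + τ) - τ / (2 * √(A - α + τ))) - h1 A) A := by
      intro A hA
      have hp := hpos A hA τ hτ
      have hs := Real.sqrt_pos.2 hp
      have hd : HasDerivAt (fun A => √(A - α + τ)) (1 / (2 * √(A - α + τ))) A :=
        (((hasDerivAt_id A).sub_const α).add_const τ).sqrt hp.ne'
      refine (((hh A hA).neg).sub (((hd.const_mul τ).sub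
        ((hd.pow 3).const_mul (2 / 3))).const_mul ε)).congr_deriv ?_
      field_simp
      ring
    have hb := hmain _ F1 F2 F3 (P τ) _ _ _ χ χ' X μ ν δ _ hF hcase hPd hχ hμ hν hν1 hμν hδ hμδ
      (hK.mul (hM' (α - τ) (by linarith [hτ.2]) (by linarith [hτ.1])))
      (by simp only [hKl, zero_mul]) (by simp only [hKr, zero_mul])
    rw [norm_mul, add_zero]
    have hk := hκb τ (abs_le.2 ⟨by linarith [hτ.1], by linarith [hτ.2]⟩)
    calc _ ≤ 2 * lorentz δ τ * (C * (4 * (M * M')) * (δ * ν)) :=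
          mul_le_mul hk hb (norm_nonneg _) (mul_nonneg two_pos.le (lorentz_nonneg _ _))
      _ = _ := by ring
  · apply ContinuousOn.mul
    · exact (hκ.comp continuous_snd).continuousOn
    · apply ContinuousOn.mul
      · apply ContinuousOn.mul
        · apply ContinuousOn.mul
          · exact hK.continuousOn.comp continuousOn_fst hfst
          · refine hG.continuousOn.comp (f := fun x : ℝ × ℝ => x.1 - (α - x.2)) (by fun_prop) ?_
            intro x hx
            have := hpos x.1 hx.1 x.2 hx.2
            simp only [Set.mem_Ioi]
            linarith
        · apply continuous_osc.comp_continuousOn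
          apply ContinuousOn.neg
          apply continuousOn_const.mul
          apply ContinuousOn.sub
          · exact (hhc.comp continuousOn_fst hfst).neg
          · fun_prop
      · exact ((continuous_cutoffAiry hχ.continuous μ).comp (by fun_prop)).continuousOn

theorem norm_integral_amplitude_mul_kernel_le {c c₁ D B τ₀ : ℝ} (hc : 0 < c) (hc₁ : 0 < c₁)
    (hD : 1 ≤ D) (hB : 0 ≤ B) (hτ₀ : 0 < τ₀) (hτ₀' : τ₀ ≤ 1 / 16) {cS : ℝ → ℂ}
    (hcS : ContDiff ℝ 2 cS) :
    ∃ C : ℝ, 0 ≤ C ∧ ∀ (α X μ ν δ M : ℝ) (h h1 : ℝ → ℝ) (K K1 K2 χ χ' κ : ℝ → ℂ),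
      0 ≤ α → α ≤ 1 / 4 → PhaseFamilyBounds h1 α τ₀ c c₁ D →
      (∀ A ∈ Set.Icc (1 / 2 : ℝ) (3 / 2), HasDerivAt h (h1 A) A) →
      CutoffBounds χ χ' B → 0 < μ → 0 < ν → ν ≤ 1 → μ * ν ^ 3 = 1 → 0 < δ → μ * δ ^ 2 = 1 →
      AmplitudeBounds K K1 K2 M → K (1 / 2) = 0 → K (3 / 2) = 0 →
      Continuous κ → (∀ τ, |τ| ≤ 2 → ‖κ τ‖ ≤ 2 * lorentz δ τ) →
      ‖∫ A in (1 / 2 : ℝ)..(3 / 2), K A * osc (μ * h A) * cutoffAiry χ μ (X - A) *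
        ∫ S in (-(3 / 2 : ℝ))..(3 / 2), cS S * osc (μ * (S ^ 3 / 3 + S * (α - A))) *
          κ (S ^ 2 - (A - α))‖
        ≤ C * M * (δ ^ 2 * ν) := by
  obtain ⟨C₁, hC₁, h₁⟩ := norm_integral_near_le (ε := 1) hc hc₁ hD hB hτ₀ hτ₀' (Or.inl rfl) hcS
  obtain ⟨C₂, hC₂, h₂⟩ := norm_integral_near_le (ε := -1) hc hc₁ hD hB hτ₀ hτ₀' (Or.inr rfl) hcS
  obtain ⟨CU, hCU, hU⟩ := norm_cutoffAiry_le
  obtain ⟨Bc, hBc⟩ := (isCompact_Icc (a := -(3 / 2 : ℝ)) (b := 3 / 2)).exists_bound_of_continuousOn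
    hcS.continuous.continuousOn
  have hBc0 : 0 ≤ Bc := (norm_nonneg _).trans (hBc 0 (by norm_num))
  refine ⟨C₁ + C₂ + CU * B * (6 * Bc / τ₀ ^ 2), by positivity, ?_⟩
  intro α X μ ν δ M h h1 K K1 K2 χ χ' κ hα hα' hph hh hχ hμ hν hν1 hμν hδ hμδ hK hKl hKr hκ hκb
  have hM := hK.nonneg
  have hhc : ContinuousOn h (Set.Icc (1 / 2 : ℝ) (3 / 2)) :=
    fun x hx => (hh x hx).continuousAt.continuousWithinAt
  have g₁ := h₁ α X μ ν δ M h h1 K K1 K2 χ χ' κ hα hα' hph hh hχ hμ hν hν1 hμν hδ hμδ hK hKl hKr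
    hκ hκb
  have g₂ := h₂ α X μ ν δ M h h1 K K1 K2 χ χ' κ hα hα' hph hh hχ hμ hν hν1 hμν hδ hμδ hK hKl hKr
    hκ hκb
  set k : ℝ → ℂ := fun A => K A * osc (μ * h A) * cutoffAiry χ μ (X - A) with hk
  have hkc : ContinuousOn k (Set.Icc (1 / 2 : ℝ) (3 / 2)) :=
    (hK.continuousOn.mul (continuous_osc.comp_continuousOn (continuousOn_const.mul hhc))).mul
      ((continuous_cutoffAiry hχ.continuous μ).comp (by fun_prop)).continuousOn
  have hkb : ∀ A ∈ Set.Icc (1 / 2 : ℝ) (3 / 2), ‖k A‖ ≤ M * (CU * B * ν) := by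
    intro A hA
    rw [hk, norm_mul, norm_mul, norm_osc, mul_one]
    exact mul_le_mul (hK.le A hA) (hU χ χ' B μ ν _ hχ hμ hν hν1 hμν) (norm_nonneg _) hM
  set w : ℝ → ℝ → ℂ := fun A S => cS S * osc (μ * (S ^ 3 / 3 + S * (α - A))) with hw
  have hwc : Continuous (Function.uncurry w) :=
    (hcS.continuous.comp continuous_snd).mul (continuous_osc.comp (by fun_prop))
  set I₀ : ℝ → ℂ := fun A => ∫ S in (-(3 / 2 : ℝ))..(3 / 2), w A S * κ (S ^ 2 - (A - α)) with hI₀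
  set J : ℝ → ℝ → ℂ := fun ε A => ∫ τ in (-τ₀)..τ₀, (1 / (2 * √(A - α + τ)) : ℝ) *
    (w A (ε * √(A - α + τ)) * κ τ) with hJ
  have hI₀c : Continuous I₀ := by
    apply intervalIntegral.continuous_parametric_intervalIntegral_of_continuous'
    exact hwc.mul (hκ.comp (by fun_prop))
  have hJc : ∀ ε : ℝ, ContinuousOn (J ε) (Set.Icc (1 / 2 : ℝ) (3 / 2)) := by
    intro ε
    have hm : ∀ A ∈ Set.Icc (1 / 2 : ℝ) (3 / 2), ∀ τ ∈ Set.Icc (-τ₀) τ₀,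
        max (1 / 16) (A - α + τ) = A - α + τ := fun A hA τ hτ =>
      max_eq_right (by linarith [hA.1, hτ.1])
    have hc' : Continuous fun A => ∫ τ in (-τ₀)..τ₀, (1 / (2 * √(max (1 / 16) (A - α + τ))) : ℝ) *
        (w A (ε * √(A - α + τ)) * κ τ) := by
      apply intervalIntegral.continuous_parametric_intervalIntegral_of_continuous'
      apply Continuous.mul
      · refine Complex.continuous_ofReal.comp (continuous_const.div (by fun_prop) fun x => ?_)
        have : 0 < √(max (1 / 16) (x.1 - α + x.2)) :=
          Real.sqrt_pos.2 (lt_of_lt_of_le (by norm_num) (le_max_left _ _))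
        positivity
      · exact (hwc.comp (f := fun x : ℝ × ℝ => (x.1, ε * √(x.1 - α + x.2))) (by fun_prop)).mul
          (hκ.comp continuous_snd)
    refine hc'.continuousOn.congr fun A hA => ?_
    apply intervalIntegral.integral_congr
    intro τ hτ
    rw [Set.uIcc_of_le (by linarith)] at hτ
    simp only [hm A hA τ hτ]
  have hint : ∀ f : ℝ → ℂ, ContinuousOn f (Set.Icc (1 / 2 : ℝ) (3 / 2)) →
      IntervalIntegrable (fun A => k A * f A) volume (1 / 2) (3 / 2) := fun f hf =>
    (hkc.mul hf).intervalIntegrable_of_Icc (by norm_num)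
  have hdiff : ‖∫ A in (1 / 2 : ℝ)..(3 / 2), k A * (I₀ A - (J 1 A + J (-1) A))‖ ≤
      M * (CU * B * ν) * (6 * Bc / τ₀ ^ 2 * δ ^ 2) * |(3 / 2 : ℝ) - 1 / 2| := by
    apply intervalIntegral.norm_integral_le_of_norm_le_const
    intro A hA
    rw [Set.uIoc_of_le (by norm_num)] at hA
    have hA' := Set.Ioc_subset_Icc_self hA
    rw [norm_mul]
    refine mul_le_mul (hkb A hA') ?_ (norm_nonneg _) (by positivity)
    have := norm_integral_sub_near_le (w := w A) (κ := κ) (B := Bc) (δ := δ) (y := A - α)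
      (τ₀ := τ₀) (hwc.comp (by fun_prop : Continuous fun S : ℝ => (A, S))) hκ (fun S hS => by
        rw [hw, norm_mul, norm_osc, mul_one]
        exact hBc S (abs_le.1 hS)) hκb (by linarith [hA.1]) (by linarith [hA.2]) hτ₀ hτ₀'
    simpa only [hI₀, hJ, one_mul, neg_one_mul] using this
  have hsplit : ∫ A in (1 / 2 : ℝ)..(3 / 2), k A * I₀ A =
      (∫ A in (1 / 2 : ℝ)..(3 / 2), k A * (I₀ A - (J 1 A + J (-1) A))) +
      ((∫ A in (1 / 2 : ℝ)..(3 / 2), k A * J 1 A) + ∫ A in (1 / 2 : ℝ)..(3 / 2), k A * J (-1) A) := by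
    have i₁ : IntervalIntegrable (fun A => k A * (I₀ A - (J 1 A + J (-1) A))) volume (1 / 2)
        (3 / 2) := hint _ (hI₀c.continuousOn.sub ((hJc 1).add (hJc (-1))))
    have i₂ : IntervalIntegrable (fun A => k A * J 1 A + k A * J (-1) A) volume (1 / 2)
        (3 / 2) := (hint _ (hJc 1)).add (hint _ (hJc (-1)))
    rw [← intervalIntegral.integral_add (hint _ (hJc 1)) (hint _ (hJc (-1))),
      ← intervalIntegral.integral_add i₁ i₂]
    apply intervalIntegral.integral_congr
    intro A _
    ring
  have h1' : |(3 / 2 : ℝ) - 1 / 2| = 1 := by norm_num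
  rw [h1', mul_one] at hdiff
  change ‖∫ A in (1 / 2 : ℝ)..(3 / 2), k A * I₀ A‖ ≤ _
  rw [hsplit]
  refine (norm_add_le _ _).trans ((add_le_add hdiff ((norm_add_le _ _).trans
    (add_le_add g₁ g₂))).trans (le_of_eq (by ring)))

theorem norm_integral_three_le {c c₁ D B τ₀ : ℝ} (hc : 0 < c) (hc₁ : 0 < c₁)
    (hD : 1 ≤ D) (hτ₀ : 0 < τ₀) (hτ₀' : τ₀ ≤ 1 / 16) {χ : ℝ → ℂ}
    (hχ3 : ContDiff ℝ 3 χ) (hχ : CutoffBounds χ (deriv χ) B) :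
    ∃ C : ℝ, 0 ≤ C ∧ ∀ (α X μ ν δ M : ℝ) (h h1 : ℝ → ℝ) (K K1 K2 : ℝ → ℂ),
      0 ≤ α → α ≤ 1 / 4 → PhaseFamilyBounds h1 α τ₀ c c₁ D →
      (∀ A ∈ Set.Icc (1 / 2 : ℝ) (3 / 2), HasDerivAt h (h1 A) A) →
      0 < μ → 0 < ν → ν ≤ 1 → μ * ν ^ 3 = 1 → 0 < δ → μ * δ ^ 2 = 1 →
      AmplitudeBounds K K1 K2 M → K (1 / 2) = 0 → K (3 / 2) = 0 →
      ‖∫ A in (1 / 2 : ℝ)..(3 / 2), K A * osc (μ * h A) * cutoffAiry χ μ (X - A) *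
        cutoffAiry χ μ (α - A)‖ ≤ C * M * (δ ^ 2 * ν) := by
  have hB := hχ.nonneg
  have hd2 : ContDiff ℝ 2 (deriv χ) :=
    (contDiff_succ_iff_deriv (n := 2) (𝕜 := ℝ).1 (hχ3.of_le (by norm_num))).2.2
  have hχ2 : ContDiff ℝ 2 χ := hχ3.of_le (by norm_num)
  obtain ⟨C₁, hC₁, h₁⟩ := norm_integral_amplitude_mul_kernel_le hc hc₁ hD hB hτ₀ hτ₀' hχ2
  obtain ⟨C₂, hC₂, h₂⟩ := norm_integral_amplitude_mul_kernel_le hc hc₁ hD hB hτ₀ hτ₀' hd2.neg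
  obtain ⟨C₃, hC₃, h₃⟩ := norm_integral_amplitude_mul_kernel_le hc hc₁ hD hB hτ₀ hτ₀'
    (cS := fun S : ℝ => -(χ S * (2 * (S : ℂ))))
    (hχ2.mul (contDiff_const.mul Complex.ofRealCLM.contDiff)).neg
  refine ⟨C₁ + C₂ + C₃, by positivity, ?_⟩
  intro α X μ ν δ M h h1 K K1 K2 hα hα' hph hh hμ hν hν1 hμν hδ hμδ hK hKl hKr
  have hhc : ContinuousOn h (Set.Icc (1 / 2 : ℝ) (3 / 2)) :=
    fun x hx => (hh x hx).continuousAt.continuousWithinAt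
  have b₁ := h₁ α X μ ν δ M h h1 K K1 K2 χ _ (fun x => (lorentz δ x : ℂ)) hα hα' hph hh hχ hμ hν
    hν1 hμν hδ hμδ hK hKl hKr (Complex.continuous_ofReal.comp (continuous_lorentz hδ))
    (fun τ _ => by
      have := lorentz_nonneg δ τ
      rw [Complex.norm_real, Real.norm_of_nonneg this]
      linarith)
  have b₂ := h₂ α X μ ν δ M h h1 K K1 K2 χ _ (invKernel μ δ) hα hα' hph hh hχ hμ hν
    hν1 hμν hδ hμδ hK hKl hKr (continuous_invKernel hδ)
    (fun τ hτ => norm_invKernel_le hμ hμδ hτ)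
  have b₃ := h₃ α X μ ν δ M h h1 K K1 K2 χ _ (invDerivKernel μ δ) hα hα' hph hh hχ hμ hν
    hν1 hμν hδ hμδ hK hKl hKr (continuous_invDerivKernel hδ)
    (fun τ _ => by
      have := lorentz_nonneg δ τ
      have := norm_invDerivKernel_le hμ hδ hμδ (x := τ)
      linarith)
  set k : ℝ → ℂ := fun A => K A * osc (μ * h A) * cutoffAiry χ μ (X - A) with hk
  have hkc : ContinuousOn k (Set.Icc (1 / 2 : ℝ) (3 / 2)) :=
    (hK.continuousOn.mul (continuous_osc.comp_continuousOn (continuousOn_const.mul hhc))).mul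
      ((continuous_cutoffAiry hχ.continuous μ).comp (by fun_prop)).continuousOn
  have hA : ∀ A : ℝ, cutoffAiry χ μ (α - A) = ∫ S in (-(3 / 2 : ℝ))..(3 / 2),
      (χ S * osc (μ * (S ^ 3 / 3 + S * (α - A))) * lorentz δ (S ^ 2 - (A - α)) +
      -deriv χ S * osc (μ * (S ^ 3 / 3 + S * (α - A))) * invKernel μ δ (S ^ 2 - (A - α)) +
      -(χ S * (2 * (S : ℂ))) * osc (μ * (S ^ 3 / 3 + S * (α - A))) *
        invDerivKernel μ δ (S ^ 2 - (A - α))) := by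
    intro A
    have := integral_osc_eq_of_boundary (s := 1) (q := fun S => S ^ 2 - (A - α))
      (q' := fun S => 2 * S) (Φ := fun S => S ^ 3 / 3 + S * (α - A)) (g := χ) (g' := deriv χ)
      (l := -(3 / 2)) (r := 3 / 2) (by norm_num) hδ hμ (by norm_num)
      (hχ.eq_zero _ (by norm_num [abs_of_nonneg])) (hχ.eq_zero _ (by norm_num [abs_of_nonneg]))
      (fun x _ => hχ.hasDerivAt x) hχ.continuous_deriv.continuousOn
      (fun x _ => ((hasDerivAt_pow 2 x).sub_const _).congr_deriv (by norm_num))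
      (by fun_prop)
      (fun x _ => (((hasDerivAt_pow 3 x).div_const 3).add
        ((hasDerivAt_id x).mul_const (α - A))).congr_deriv (by norm_num; ring))
    rw [cutoffAiry, this]
    apply intervalIntegral.integral_congr
    intro S _
    push_cast
    ring
  have e : ∫ A in (1 / 2 : ℝ)..(3 / 2), k A * cutoffAiry χ μ (α - A) =
      ∫ A in (1 / 2 : ℝ)..(3 / 2), ∫ S in (-(3 / 2 : ℝ))..(3 / 2),
      (k A * (χ S * osc (μ * (S ^ 3 / 3 + S * (α - A))) * lorentz δ (S ^ 2 - (A - α))) +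
      k A * (-deriv χ S * osc (μ * (S ^ 3 / 3 + S * (α - A))) * invKernel μ δ (S ^ 2 - (A - α))) +
      k A * (-(χ S * (2 * (S : ℂ))) * osc (μ * (S ^ 3 / 3 + S * (α - A))) *
        invDerivKernel μ δ (S ^ 2 - (A - α)))) := by
    apply intervalIntegral.integral_congr
    intro A _
    simp only
    rw [hA, ← intervalIntegral.integral_const_mul]
    simp only [mul_add]
  have hcont : ∀ (cS κ : ℝ → ℂ), Continuous cS → Continuous κ → ContinuousOn
      (Function.uncurry fun A S => k A * (cS S * osc (μ * (S ^ 3 / 3 + S * (α - A))) *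
        κ (S ^ 2 - (A - α)))) (Set.Icc (1 / 2 : ℝ) (3 / 2) ×ˢ Set.Icc (-(3 / 2 : ℝ)) (3 / 2)) := by
    intro cS κ hcS hκ
    refine (hkc.comp continuousOn_fst fun x hx => hx.1).mul (Continuous.continuousOn ?_)
    exact ((hcS.comp continuous_snd).mul (continuous_osc.comp (by fun_prop))).mul
      (hκ.comp (by fun_prop))
  change ‖∫ A in (1 / 2 : ℝ)..(3 / 2), k A * cutoffAiry χ μ (α - A)‖ ≤ _
  rw [e]
  simp only [← intervalIntegral.integral_const_mul] at b₁ b₂ b₃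
  refine (norm_intervalIntegral_add₃_le (by norm_num) (by norm_num) ?_ ?_ ?_ b₁ b₂ b₃).trans
    (le_of_eq (by ring))
  · exact hcont χ (fun x => (lorentz δ x : ℂ)) hχ.continuous
      (Complex.continuous_ofReal.comp (continuous_lorentz hδ))
  · exact hcont _ _ hχ.continuous_deriv.neg (continuous_invKernel hδ)
  · exact hcont (fun S : ℝ => -(χ S * (2 * (S : ℂ)))) _
      (hχ.continuous.mul (by fun_prop)).neg (continuous_invDerivKernel hδ)

theorem HasDerivAt.inv_sqrt {f : ℝ → ℝ} {f' x : ℝ} (hf : HasDerivAt f f' x) (hx : 0 < f x) :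
    HasDerivAt (fun y => (√(f y))⁻¹) (-(f' * (√(f x))⁻¹ ^ 3 / 2)) x := by
  have hs := Real.sqrt_pos.2 hx
  refine ((hf.sqrt hx.ne').fun_inv hs.ne').congr_deriv ?_
  field_simp

theorem PhaseBounds.neg {F F1 F2 F3 : ℝ → ℝ} {c D : ℝ} (h : PhaseBounds F F1 F2 F3 c D) :
    PhaseBounds (fun A => -F A) (fun A => -F1 A) (fun A => -F2 A) (fun A => -F3 A) c D where
  hasDerivAt A hA := (h.hasDerivAt A hA).neg
  hasDerivAt_one A hA := (h.hasDerivAt_one A hA).neg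
  hasDerivAt_two A hA := (h.hasDerivAt_two A hA).neg
  continuousOn_three := h.continuousOn_three.neg
  le A hA := by simpa using h.le A hA
  le_one A hA := by simpa using h.le_one A hA
  le_two A hA := by simpa using h.le_two A hA
  le_three A hA := by simpa using h.le_three A hA
  ge_one A hA := by simpa using h.ge_one A hA

theorem abs_inv_sqrt_expr_ge {m p s : ℝ} (hm : m = -2 ∨ m = -1 ∨ m = 0 ∨ m = 1 ∨ m = 2)
    (hp : 4 / 5 ≤ p) (hsp : 9 / 10 * p ≤ s) (hsp' : s ≤ 49 / 30 * p) :
    7 / 50 ≤ |s / 2 + m * p| := by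
  rcases hm with rfl | rfl | rfl | rfl | rfl
  · refine le_trans ?_ (neg_le_abs _); linarith
  · refine le_trans ?_ (neg_le_abs _); linarith
  · refine le_trans ?_ (le_abs_self _); linarith
  · refine le_trans ?_ (le_abs_self _); linarith
  · refine le_trans ?_ (le_abs_self _); linarith

theorem second_expr_eq (m p s : ℝ) :
    (-(s ^ 3 / 4) - m * p ^ 3 / 2) + 2 * (s / 2 + m * p) ^ 3 =
      m / 2 * p * (3 * (s + m * p) ^ 2 + (m ^ 2 - 1) * p ^ 2) := by
  ring

theorem abs_second_expr_ge {m p s : ℝ} (hm : m = -2 ∨ m = 1 ∨ m = 2)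
    (hp : 4 / 5 ≤ p) (hsp : 9 / 10 * p ≤ s) :
    1 / 2 ≤ |(-(s ^ 3 / 4) - m * p ^ 3 / 2) + 2 * (s / 2 + m * p) ^ 3| := by
  rw [second_expr_eq]
  have hp0 : 0 < p := by linarith
  have hs0 : 0 < s := by nlinarith
  have h2 : 16 / 25 ≤ p ^ 2 := by nlinarith
  rcases hm with rfl | rfl | rfl
  · refine le_trans ?_ (neg_le_abs _)
    nlinarith [mul_nonneg hp0.le (sq_nonneg (s + -2 * p)), mul_le_mul hp h2 (by norm_num) hp0.le]
  · refine le_trans ?_ (le_abs_self _)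
    nlinarith [mul_nonneg hp0.le (sq_nonneg s), mul_nonneg hp0.le (mul_nonneg hp0.le hs0.le),
      mul_le_mul hp h2 (by norm_num) hp0.le]
  · refine le_trans ?_ (le_abs_self _)
    nlinarith [mul_nonneg hp0.le (sq_nonneg (s + 2 * p)), mul_le_mul hp h2 (by norm_num) hp0.le]

theorem abs_second_expr_ge_of_sub {p s : ℝ} (hp : 4 / 5 ≤ p) (hsp : 1 / 200 ≤ |s - p|) :
    1 / 100000 ≤ |(-(s ^ 3 / 4) - (-1) * p ^ 3 / 2) + 2 * (s / 2 + (-1) * p) ^ 3| := by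
  rw [second_expr_eq]
  refine le_trans ?_ (neg_le_abs _)
  have h2 : (1 / 200) ^ 2 ≤ (s - p) ^ 2 := by
    rw [← sq_abs (s - p)]
    gcongr
  nlinarith [mul_le_mul hp h2 (by norm_num) (by linarith)]

theorem abs_first_expr_ge {σ r s p T : ℝ} (hσ : σ * s = 1) (hr : r * p = 1) (hp : 4 / 5 ≤ p)
    (hσr : |r - σ| ≤ 1 / 20) (hσ0 : 1 / 2 ≤ σ) (hr0 : 1 / 2 ≤ r) (hT : 1 ≤ |T|) :
    1 / 5 ≤ |1 - 2 * (σ + 2 * (-1) * r - T / 2) * (s / 2 + (-1) * p)| := by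
  have hs : s = σ⁻¹ := eq_inv_of_mul_eq_one_right hσ
  have hp' : p = r⁻¹ := eq_inv_of_mul_eq_one_right hr
  have hσp : 0 < σ := by linarith
  have hrp : 0 < r := by linarith
  have e : 1 - 2 * (σ + 2 * (-1) * r - T / 2) * (s / 2 + (-1) * p) =
      2 * (r - σ) ^ 2 * (s * p) - T * (p - s / 2) := by
    rw [hs, hp']; field_simp; ring
  have hs2 : s ≤ 2 := by nlinarith
  have hs0 : 0 < s := by rw [hs]; positivity
  have hp2 : p ≤ 2 := by nlinarith
  have h1 : (r - σ) ^ 2 ≤ (1 / 20) ^ 2 := by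
    rw [← sq_abs (r - σ)]; gcongr
  have h2 : 0 ≤ 2 * (r - σ) ^ 2 * (s * p) := by positivity
  have hsp4 : s * p ≤ 4 := by nlinarith
  have h3 : 2 * (r - σ) ^ 2 * (s * p) ≤ 1 / 50 := by nlinarith [sq_nonneg (r - σ), mul_pos hs0 (by linarith : 0 < p)]
  have h4 : p - s / 2 ≥ 7 / 25 := by
    have h5 : s - p = (r - σ) * (s * p) := by rw [hs, hp']; field_simp
    have h6 : |s - p| ≤ 1 / 20 * (2 * p) := by
      rw [h5, abs_mul, abs_of_nonneg (by positivity : 0 ≤ s * p)]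
      gcongr
    have := (abs_le.1 h6).2
    linarith
  rw [e]
  rcases le_total 0 T with h | h
  · rw [abs_of_nonneg h] at hT
    refine le_trans ?_ (neg_le_abs _)
    nlinarith
  · rw [abs_of_nonpos h] at hT
    refine le_trans ?_ (le_abs_self _)
    nlinarith

theorem le_abs_first_add {u v e₀ e₁ c κ : ℝ} (h : c ≤ |1 - 2 * u * v|) (hu : |u| ≤ 11)
    (hv : |v| ≤ 4) (h₀ : |e₀| ≤ κ) (h₁ : |e₁| ≤ κ) (hκ : κ ≤ 1) :
    c - 32 * κ ≤ |1 - 2 * (u + e₀) * (v + e₁)| := by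
  have hκ0 : 0 ≤ κ := (abs_nonneg _).trans h₀
  have e : 1 - 2 * u * v = (1 - 2 * (u + e₀) * (v + e₁)) + 2 * (u * e₁ + v * e₀ + e₀ * e₁) := by
    ring
  have h2 : |2 * (u * e₁ + v * e₀ + e₀ * e₁)| ≤ 32 * κ := by
    rw [abs_mul, abs_two]
    have := abs_add_three (u * e₁) (v * e₀) (e₀ * e₁)
    simp only [abs_mul] at this
    nlinarith [mul_le_mul hu h₁ (abs_nonneg _) (by norm_num),
      mul_le_mul hv h₀ (abs_nonneg _) (by norm_num), mul_le_mul h₀ h₁ (abs_nonneg _) hκ0]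
  rw [e] at h
  have := abs_add_le (1 - 2 * (u + e₀) * (v + e₁)) (2 * (u * e₁ + v * e₀ + e₀ * e₁))
  linarith

theorem le_abs_second_add {u v e₁ e₂ c κ : ℝ} (h : c ≤ |u + 2 * v ^ 3|) 
    (hv : |v| ≤ 4) (h₁ : |e₁| ≤ κ) (h₂ : |e₂| ≤ κ) (hκ : κ ≤ 1) :
    c - 200 * κ ≤ |(u + e₂) + 2 * (v + e₁) ^ 3| := by
  have hκ0 : 0 ≤ κ := (abs_nonneg _).trans h₁
  have e : u + 2 * v ^ 3 = ((u + e₂) + 2 * (v + e₁) ^ 3) +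
      (-e₂ + -(2 * e₁ * (3 * v ^ 2 + 3 * v * e₁ + e₁ ^ 2))) := by
    ring
  have hq : |3 * v ^ 2 + 3 * v * e₁ + e₁ ^ 2| ≤ 75 := by
    rw [abs_le]
    obtain ⟨a1, a2⟩ := abs_le.1 hv
    obtain ⟨b1, b2⟩ := abs_le.1 (h₁.trans hκ)
    constructor <;> nlinarith
  have h2 : |-e₂ + -(2 * e₁ * (3 * v ^ 2 + 3 * v * e₁ + e₁ ^ 2))| ≤ 200 * κ := by
    refine (abs_add_le _ _).trans ?_
    rw [abs_neg, abs_neg, abs_mul, abs_mul, abs_two]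
    nlinarith [mul_le_mul h₁ hq (abs_nonneg _) hκ0]
  rw [e] at h
  have := abs_add_le ((u + e₂) + 2 * (v + e₁) ^ 3)
    (-e₂ + -(2 * e₁ * (3 * v ^ 2 + 3 * v * e₁ + e₁ ^ 2)))
  linarith

set_option maxHeartbeats 1600000 in
theorem exists_phaseBounds {m T τ γ α : ℝ} (hm : m = -2 ∨ m = -1 ∨ m = 0 ∨ m = 1 ∨ m = 2)
    (hT : 1 ≤ |T|) (hT' : |T| ≤ 9) (hτ : |τ| ≤ 1 / 10 ^ 10) (hγ : 0 < γ) (hγ' : γ ≤ 1 / 10 ^ 10)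
    (hα : 0 ≤ α) (hα' : α ≤ 1 / 4) :
    ∃ F F1 F2 F3 : ℝ → ℝ,
      (∀ A, F A = (√(A - α + τ) - τ / (2 * √(A - α + τ))) -
        (T / (2 * √(1 + γ * A)) - 2 * m * √A)) ∧
      PhaseBounds F F1 F2 F3 (1 / 10) 100 ∧
      ((∀ A ∈ Set.Icc (1 / 2 : ℝ) (3 / 2), 1 / 10 ^ 6 ≤ |1 - 2 * F A * F1 A|) ∨
        ∀ A ∈ Set.Icc (1 / 2 : ℝ) (3 / 2), 1 / 10 ^ 6 ≤ |F2 A + 2 * F1 A ^ 3|) := by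
  set σ : ℝ → ℝ := fun A => √(A - α + τ) with hσdef
  set s : ℝ → ℝ := fun A => (√(A - α + τ))⁻¹ with hsdef
  set r : ℝ → ℝ := fun A => √A with hrdef
  set p : ℝ → ℝ := fun A => (√A)⁻¹ with hpdef
  set q : ℝ → ℝ := fun A => (√(1 + γ * A))⁻¹ with hqdef
  obtain ⟨hτ1, hτ2⟩ := abs_le.1 hτ
  obtain ⟨hT1, hT2⟩ := abs_le.1 hT'
  norm_num at hτ1 hτ2 hγ'
  have hm2 : |m| ≤ 2 := by
    rcases hm with rfl | rfl | rfl | rfl | rfl <;> norm_num [abs_of_nonneg]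
  have hy : ∀ A ∈ Set.Icc (1 / 2 : ℝ) (3 / 2), 0 < A - α + τ := fun A hA => by linarith [hA.1]
  have hA0 : ∀ A ∈ Set.Icc (1 / 2 : ℝ) (3 / 2), 0 < A := fun A hA => by linarith [hA.1]
  have hg0 : ∀ A ∈ Set.Icc (1 / 2 : ℝ) (3 / 2), 0 < 1 + γ * A := fun A hA => by
    have := hA0 A hA; positivity
  have hlin : ∀ A, HasDerivAt (fun A : ℝ => A - α + τ) 1 A := fun A =>
    ((hasDerivAt_id A).sub_const α).add_const τ
  have hlinq : ∀ A, HasDerivAt (fun A : ℝ => 1 + γ * A) γ A := fun A =>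
    (((hasDerivAt_id A).const_mul γ).const_add 1).congr_deriv (by simp)
  have dσ : ∀ A ∈ Set.Icc (1 / 2 : ℝ) (3 / 2), HasDerivAt σ (s A / 2) A := fun A hA =>
    ((hlin A).sqrt (hy A hA).ne').congr_deriv (by
      have := Real.sqrt_pos.2 (hy A hA)
      simp only [hsdef]; field_simp)
  have ds : ∀ A ∈ Set.Icc (1 / 2 : ℝ) (3 / 2), HasDerivAt s (-(s A ^ 3 / 2)) A := fun A hA =>
    ((hlin A).inv_sqrt (hy A hA)).congr_deriv (by simp only [hsdef]; ring)
  have dr : ∀ A ∈ Set.Icc (1 / 2 : ℝ) (3 / 2), HasDerivAt r (p A / 2) A := fun A hA =>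
    ((hasDerivAt_id A).sqrt (hA0 A hA).ne').congr_deriv (by
      have := Real.sqrt_pos.2 (hA0 A hA)
      simp only [hpdef, id]; field_simp)
  have dp : ∀ A ∈ Set.Icc (1 / 2 : ℝ) (3 / 2), HasDerivAt p (-(p A ^ 3 / 2)) A := fun A hA =>
    ((hasDerivAt_id A).inv_sqrt (hA0 A hA)).congr_deriv (by simp only [hpdef, id]; ring)
  have dq : ∀ A ∈ Set.Icc (1 / 2 : ℝ) (3 / 2), HasDerivAt q (-(γ * q A ^ 3 / 2)) A := fun A hA =>
    ((hlinq A).inv_sqrt (hg0 A hA)).congr_deriv (by simp only [hqdef])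
  have hσs : ∀ A ∈ Set.Icc (1 / 2 : ℝ) (3 / 2), σ A * s A = 1 := fun A hA =>
    mul_inv_cancel₀ (Real.sqrt_pos.2 (hy A hA)).ne'
  have hrp : ∀ A ∈ Set.Icc (1 / 2 : ℝ) (3 / 2), r A * p A = 1 := fun A hA =>
    mul_inv_cancel₀ (Real.sqrt_pos.2 (hA0 A hA)).ne'
  have hσ2 : ∀ A ∈ Set.Icc (1 / 2 : ℝ) (3 / 2), σ A ^ 2 = A - α + τ := fun A hA =>
    Real.sq_sqrt (hy A hA).le
  have hr2 : ∀ A ∈ Set.Icc (1 / 2 : ℝ) (3 / 2), r A ^ 2 = A := fun A hA =>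
    Real.sq_sqrt (hA0 A hA).le
  have hσpos : ∀ A ∈ Set.Icc (1 / 2 : ℝ) (3 / 2), 0 < σ A := fun A hA =>
    Real.sqrt_pos.2 (hy A hA)
  have hrpos : ∀ A ∈ Set.Icc (1 / 2 : ℝ) (3 / 2), 0 < r A := fun A hA =>
    Real.sqrt_pos.2 (hA0 A hA)
  have hspos : ∀ A ∈ Set.Icc (1 / 2 : ℝ) (3 / 2), 0 < s A := fun A hA => inv_pos.2 (hσpos A hA)
  have hppos : ∀ A ∈ Set.Icc (1 / 2 : ℝ) (3 / 2), 0 < p A := fun A hA => inv_pos.2 (hrpos A hA)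
  have hσle : ∀ A ∈ Set.Icc (1 / 2 : ℝ) (3 / 2), σ A ≤ 5 / 4 := fun A hA => by
    nlinarith [hσ2 A hA, hA.2, hσpos A hA]
  have hσge : ∀ A ∈ Set.Icc (1 / 2 : ℝ) (3 / 2), 49 / 100 ≤ σ A := fun A hA => by
    nlinarith [hσ2 A hA, hA.1, hσpos A hA]
  have hrle : ∀ A ∈ Set.Icc (1 / 2 : ℝ) (3 / 2), r A ≤ 5 / 4 := fun A hA => by
    nlinarith [hr2 A hA, hA.2, hrpos A hA]
  have hrge : ∀ A ∈ Set.Icc (1 / 2 : ℝ) (3 / 2), 7 / 10 ≤ r A := fun A hA => by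
    nlinarith [hr2 A hA, hA.1, hrpos A hA]
  have hsge : ∀ A ∈ Set.Icc (1 / 2 : ℝ) (3 / 2), 4 / 5 ≤ s A := fun A hA => by
    nlinarith [hσs A hA, hσle A hA, hspos A hA]
  have hsle : ∀ A ∈ Set.Icc (1 / 2 : ℝ) (3 / 2), s A ≤ 41 / 20 := fun A hA => by
    nlinarith [hσs A hA, hσge A hA, hspos A hA]
  have hpge : ∀ A ∈ Set.Icc (1 / 2 : ℝ) (3 / 2), 4 / 5 ≤ p A := fun A hA => by
    nlinarith [hrp A hA, hrle A hA, hppos A hA]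
  have hple : ∀ A ∈ Set.Icc (1 / 2 : ℝ) (3 / 2), p A ≤ 10 / 7 := fun A hA => by
    nlinarith [hrp A hA, hrge A hA, hppos A hA]
  have hq0 : ∀ A ∈ Set.Icc (1 / 2 : ℝ) (3 / 2), 0 < q A := fun A hA =>
    inv_pos.2 (Real.sqrt_pos.2 (hg0 A hA))
  have hq1 : ∀ A ∈ Set.Icc (1 / 2 : ℝ) (3 / 2), q A ≤ 1 := fun A hA =>
    inv_le_one_of_one_le₀ (Real.one_le_sqrt.2 (by nlinarith [hA0 A hA]))
  have hq1' : ∀ A ∈ Set.Icc (1 / 2 : ℝ) (3 / 2), 1 - 2 / 10 ^ 10 ≤ q A := fun A hA => by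
    have h1 : √(1 + γ * A) ≤ 1 + γ * A := by
      rw [Real.sqrt_le_left (by linarith [hg0 A hA])]
      nlinarith [hA0 A hA, mul_pos hγ (hA0 A hA)]
    have h2 : q A * √(1 + γ * A) = 1 := inv_mul_cancel₀ (Real.sqrt_pos.2 (hg0 A hA)).ne'
    have h3 : γ * A ≤ 2 / 10 ^ 10 := by nlinarith [hA.2, hA.1]
    nlinarith [hq0 A hA, hq1 A hA, mul_le_mul_of_nonneg_left h1 (hq0 A hA).le,
      mul_pos hγ (hA0 A hA)]
  have hsp : ∀ A ∈ Set.Icc (1 / 2 : ℝ) (3 / 2), 9 / 10 * p A ≤ s A := fun A hA => by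
    have h1 : 9 / 10 * σ A ≤ r A := by
      rw [← pow_le_pow_iff_left₀ (by linarith [hσpos A hA]) (hrpos A hA).le two_ne_zero]
      rw [mul_pow, hσ2 A hA, hr2 A hA]
      linarith [hA.1]
    have := mul_le_mul_of_nonneg_right h1 (mul_pos (hspos A hA) (hppos A hA)).le
    calc 9 / 10 * p A = 9 / 10 * σ A * (s A * p A) := by linear_combination (-9 / 10 * p A) * hσs A hA
      _ ≤ r A * (s A * p A) := this
      _ = s A := by linear_combination s A * hrp A hA
  have hsp' : ∀ A ∈ Set.Icc (1 / 2 : ℝ) (3 / 2), s A ≤ 49 / 30 * p A := fun A hA => by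
    have h1 : r A ≤ 49 / 30 * σ A := by
      rw [← pow_le_pow_iff_left₀ (hrpos A hA).le (by linarith [hσpos A hA]) two_ne_zero]
      rw [mul_pow, hσ2 A hA, hr2 A hA]
      linarith [hA.1]
    have := mul_le_mul_of_nonneg_right h1 (mul_pos (hspos A hA) (hppos A hA)).le
    calc s A = r A * (s A * p A) := by linear_combination -(s A) * hrp A hA
      _ ≤ 49 / 30 * σ A * (s A * p A) := this
      _ = 49 / 30 * p A := by linear_combination (49 / 30 * p A) * hσs A hA
  set e₀ : ℝ → ℝ := fun A => -(τ * s A / 2) + T / 2 * (1 - q A) with he₀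
  set e₁ : ℝ → ℝ := fun A => τ * s A ^ 3 / 4 + T * γ * q A ^ 3 / 4 with he₁
  set e₂ : ℝ → ℝ := fun A => -(3 * τ * s A ^ 5 / 8) - 3 * T * γ ^ 2 * q A ^ 5 / 8 with he₂
  set e₃ : ℝ → ℝ := fun A => 15 * τ * s A ^ 7 / 16 + 15 * T * γ ^ 3 * q A ^ 7 / 16 with he₃
  have hT2' : |T / 2| ≤ 9 / 2 := by rw [abs_div, abs_two]; linarith
  have habs : ∀ {x y a b : ℝ}, |x| ≤ a → 0 ≤ y → y ≤ b → |x * y| ≤ a * b := by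
    intro x y a b hx hy hyb
    rw [abs_mul, abs_of_nonneg hy]
    exact mul_le_mul hx hyb hy ((abs_nonneg _).trans hx)
  have hsk : ∀ A ∈ Set.Icc (1 / 2 : ℝ) (3 / 2), ∀ k : ℕ, s A ^ k ≤ (41 / 20) ^ k :=
    fun A hA k => pow_le_pow_left₀ (hspos A hA).le (hsle A hA) k
  have hpk : ∀ A ∈ Set.Icc (1 / 2 : ℝ) (3 / 2), ∀ k : ℕ, p A ^ k ≤ (10 / 7) ^ k :=
    fun A hA k => pow_le_pow_left₀ (hppos A hA).le (hple A hA) k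
  have hqk : ∀ A ∈ Set.Icc (1 / 2 : ℝ) (3 / 2), ∀ k : ℕ, q A ^ k ≤ 1 :=
    fun A hA k => pow_le_one₀ (hq0 A hA).le (hq1 A hA)
  have hTγ : ∀ k : ℕ, |T * γ ^ (k + 1)| ≤ 9 * (1 / 10 ^ 10) := fun k => by
    refine habs hT' (by positivity) ?_
    rw [pow_succ]
    have : γ ^ k ≤ 1 := pow_le_one₀ hγ.le (by linarith)
    nlinarith
  have b₀ : ∀ A ∈ Set.Icc (1 / 2 : ℝ) (3 / 2), |e₀ A| ≤ 1 / 10 ^ 8 := fun A hA => by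
    have h1 := abs_le.1 (habs hτ (hspos A hA).le (hsle A hA))
    have h2 := abs_le.1 (habs hT2' (by linarith [hq1 A hA])
      (by linarith [hq1' A hA] : 1 - q A ≤ 2 / 10 ^ 10))
    rw [abs_le]
    simp only [he₀]
    constructor <;> linarith [h1.1, h1.2, h2.1, h2.2]
  have b₁ : ∀ A ∈ Set.Icc (1 / 2 : ℝ) (3 / 2), |e₁ A| ≤ 1 / 10 ^ 8 := fun A hA => by
    have h1 := abs_le.1 (habs hτ (pow_nonneg (hspos A hA).le 3) (hsk A hA 3))
    have h2 := abs_le.1 (habs (hTγ 0) (pow_nonneg (hq0 A hA).le 3) (hqk A hA 3))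
    rw [abs_le]
    simp only [he₁]
    norm_num at h1 h2 ⊢
    constructor <;> linarith [h1.1, h1.2, h2.1, h2.2]
  have b₂ : ∀ A ∈ Set.Icc (1 / 2 : ℝ) (3 / 2), |e₂ A| ≤ 1 / 10 ^ 8 := fun A hA => by
    have h1 := abs_le.1 (habs hτ (pow_nonneg (hspos A hA).le 5) (hsk A hA 5))
    have h2 := abs_le.1 (habs (hTγ 1) (pow_nonneg (hq0 A hA).le 5) (hqk A hA 5))
    rw [abs_le]
    simp only [he₂]
    norm_num at h1 h2 ⊢
    constructor <;> linarith [h1.1, h1.2, h2.1, h2.2]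
  have b₃ : ∀ A ∈ Set.Icc (1 / 2 : ℝ) (3 / 2), |e₃ A| ≤ 1 := fun A hA => by
    have h1 := abs_le.1 (habs hτ (pow_nonneg (hspos A hA).le 7) (hsk A hA 7))
    have h2 := abs_le.1 (habs (hTγ 2) (pow_nonneg (hq0 A hA).le 7) (hqk A hA 7))
    rw [abs_le]
    simp only [he₃]
    norm_num at h1 h2 ⊢
    constructor <;> linarith [h1.1, h1.2, h2.1, h2.2]
  have hmp : ∀ A ∈ Set.Icc (1 / 2 : ℝ) (3 / 2), ∀ k : ℕ, |m * p A ^ k| ≤ 2 * (10 / 7) ^ k :=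
    fun A hA k => habs hm2 (pow_nonneg (hppos A hA).le k) (hpk A hA k)
  have hmr : ∀ A ∈ Set.Icc (1 / 2 : ℝ) (3 / 2), |m * r A| ≤ 2 * (5 / 4) :=
    fun A hA => habs hm2 (hrpos A hA).le (hrle A hA)
  have u₀ : ∀ A ∈ Set.Icc (1 / 2 : ℝ) (3 / 2), |σ A + 2 * m * r A - T / 2| ≤ 11 := fun A hA => by
    have h1 := abs_le.1 (hmr A hA)
    have h2 := abs_le.1 hT2'
    rw [abs_le]
    constructor <;> linarith [hσpos A hA, hσle A hA, h1.1, h1.2, h2.1, h2.2]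
  have u₁ : ∀ A ∈ Set.Icc (1 / 2 : ℝ) (3 / 2), |s A / 2 + m * p A| ≤ 4 := fun A hA => by
    have h1 := abs_le.1 (hmp A hA 1)
    norm_num at h1
    rw [abs_le]
    constructor <;> linarith [hspos A hA, hsle A hA, h1.1, h1.2]
  refine ⟨fun A => (σ A + 2 * m * r A - T / 2) + e₀ A, fun A => (s A / 2 + m * p A) + e₁ A,
    fun A => (-(s A ^ 3 / 4) - m * p A ^ 3 / 2) + e₂ A,
    fun A => 3 * s A ^ 5 / 8 + 3 * m * p A ^ 5 / 4 + e₃ A, ?_, ⟨?_, ?_, ?_, ?_, ?_, ?_, ?_, ?_, ?_⟩,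
    ?_⟩
  · intro A
    simp only [he₀, hσdef, hsdef, hrdef, hqdef, div_eq_mul_inv, mul_inv]
    ring
  · intro A hA
    refine ((((dσ A hA).add ((dr A hA).const_mul (2 * m))).sub_const (T / 2)).add
      ((((ds A hA).const_mul τ).div_const 2).neg.add
        (((dq A hA).const_sub 1).const_mul (T / 2)))).congr_deriv ?_
    simp only [he₁]
    ring
  · intro A hA
    refine ((((ds A hA).div_const 2).add ((dp A hA).const_mul m)).add
      (((((ds A hA).pow 3).const_mul τ).div_const 4).add
        ((((dq A hA).pow 3).const_mul (T * γ)).div_const 4))).congr_deriv ?_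
    simp only [he₂]
    norm_num
    ring
  · intro A hA
    refine (((((ds A hA).pow 3).div_const 4).neg.sub
      ((((dp A hA).pow 3).const_mul m).div_const 2)).add
      (((((ds A hA).pow 5).const_mul (3 * τ)).div_const 8).neg.sub
        ((((dq A hA).pow 5).const_mul (3 * T * γ ^ 2)).div_const 8))).congr_deriv ?_
    simp only [he₃]
    norm_num
    ring
  · have cs : ContinuousOn s (Set.Icc (1 / 2 : ℝ) (3 / 2)) :=
      fun A hA => (ds A hA).continuousAt.continuousWithinAt
    have cp : ContinuousOn p (Set.Icc (1 / 2 : ℝ) (3 / 2)) :=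
      fun A hA => (dp A hA).continuousAt.continuousWithinAt
    have cq : ContinuousOn q (Set.Icc (1 / 2 : ℝ) (3 / 2)) :=
      fun A hA => (dq A hA).continuousAt.continuousWithinAt
    simp only [he₃]
    fun_prop
  · intro A hA
    have h1 := abs_le.1 (u₀ A hA)
    have h2 := abs_le.1 (b₀ A hA)
    rw [abs_le]
    constructor <;> linarith [h1.1, h1.2, h2.1, h2.2]
  · intro A hA
    have h1 := abs_le.1 (u₁ A hA)
    have h2 := abs_le.1 (b₁ A hA)
    rw [abs_le]
    constructor <;> linarith [h1.1, h1.2, h2.1, h2.2]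
  · intro A hA
    have h1 := abs_le.1 (hmp A hA 3)
    have h2 := abs_le.1 (b₂ A hA)
    have h3 := hsk A hA 3
    have h4 := pow_pos (hspos A hA) 3
    norm_num at h1 h3
    rw [abs_le]
    constructor <;> linarith [h1.1, h1.2, h2.1, h2.2]
  · intro A hA
    have h1 := abs_le.1 (hmp A hA 5)
    have h2 := abs_le.1 (b₃ A hA)
    have h3 := hsk A hA 5
    have h4 := pow_pos (hspos A hA) 5
    norm_num at h1 h3
    rw [abs_le]
    constructor <;> linarith [h1.1, h1.2, h2.1, h2.2]
  · intro A hA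
    have h1 := abs_inv_sqrt_expr_ge hm (hpge A hA) (hsp A hA) (hsp' A hA)
    have h2 := abs_sub_abs_le_abs_sub (s A / 2 + m * p A) (-e₁ A)
    rw [abs_neg, sub_neg_eq_add] at h2
    have h3 := b₁ A hA
    norm_num at h3 ⊢
    linarith
  · have second : (∀ A ∈ Set.Icc (1 / 2 : ℝ) (3 / 2), 1 / 100000 ≤
        |(-(s A ^ 3 / 4) - m * p A ^ 3 / 2) + 2 * (s A / 2 + m * p A) ^ 3|) →
        ∀ A ∈ Set.Icc (1 / 2 : ℝ) (3 / 2), 1 / 10 ^ 6 ≤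
          |(-(s A ^ 3 / 4) - m * p A ^ 3 / 2) + e₂ A + 2 * ((s A / 2 + m * p A) + e₁ A) ^ 3| := by
      intro h A hA
      refine le_trans ?_ (le_abs_second_add (h A hA) (u₁ A hA) (b₁ A hA) (b₂ A hA) (by norm_num))
      norm_num
    have first : (∀ A ∈ Set.Icc (1 / 2 : ℝ) (3 / 2), 1 / 5 ≤
        |1 - 2 * (σ A + 2 * m * r A - T / 2) * (s A / 2 + m * p A)|) →
        ∀ A ∈ Set.Icc (1 / 2 : ℝ) (3 / 2), 1 / 10 ^ 6 ≤
          |1 - 2 * ((σ A + 2 * m * r A - T / 2) + e₀ A) * ((s A / 2 + m * p A) + e₁ A)| := by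
      intro h A hA
      refine le_trans ?_ (le_abs_first_add (h A hA) (u₀ A hA) (u₁ A hA) (b₀ A hA) (b₁ A hA)
        (by norm_num))
      norm_num
    have hother : (m = -2 ∨ m = 1 ∨ m = 2) ∨ m = 0 ∨ m = -1 := by tauto
    rcases hother with h | rfl | rfl
    · right
      refine second fun A hA => ?_
      exact le_trans (by norm_num) (abs_second_expr_ge h (hpge A hA) (hsp A hA))
    · left
      refine first fun A hA => ?_
      rw [show 1 - 2 * (σ A + 2 * 0 * r A - T / 2) * (s A / 2 + 0 * p A) = T * s A / 2 by
        linear_combination (-1) * hσs A hA, abs_div, abs_mul, abs_two, abs_of_pos (hspos A hA)]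
      nlinarith [hsge A hA, hspos A hA]
    · have hdiff : ∀ A ∈ Set.Icc (1 / 2 : ℝ) (3 / 2), (r A - σ A) * (r A + σ A) = α - τ :=
        fun A hA => by linear_combination hr2 A hA - hσ2 A hA
      rcases le_total |α - τ| (1 / 32) with h | h
      · left
        refine first fun A hA => ?_
        refine abs_first_expr_ge (hσs A hA) (hrp A hA) (hpge A hA) ?_ ?_ ?_ hT
        · have h1 := congrArg abs (hdiff A hA)
          rw [abs_mul, abs_of_pos (add_pos (hrpos A hA) (hσpos A hA))] at h1
          nlinarith [hrge A hA, hσpos A hA, abs_nonneg (r A - σ A)]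
        · have := (abs_le.1 h).2
          nlinarith [hσ2 A hA, hA.1, hσpos A hA]
        · linarith [hrge A hA]
      · right
        refine second fun A hA => ?_
        refine abs_second_expr_ge_of_sub (hpge A hA) ?_
        have h1 := congrArg abs (hdiff A hA)
        rw [abs_mul, abs_of_pos (add_pos (hrpos A hA) (hσpos A hA))] at h1
        have h2 : 1 / 80 ≤ |r A - σ A| := by
          nlinarith [hrle A hA, hσle A hA, abs_nonneg (r A - σ A)]
        have h3 : s A - p A = (r A - σ A) * (s A * p A) := by
          linear_combination (-s A) * hrp A hA + p A * hσs A hA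
        have h4 : 16 / 25 ≤ s A * p A := by nlinarith [hsge A hA, hpge A hA]
        rw [h3, abs_mul, abs_of_pos (mul_pos (hspos A hA) (hppos A hA))]
        nlinarith [abs_nonneg (r A - σ A)]

theorem phaseFamilyBounds {N : ℤ} {T γ α : ℝ} (hN : N ∈ Finset.Icc (-2 : ℤ) 2)
    (hT : 1 ≤ |T|) (hT' : |T| ≤ 9) (hγ : 0 < γ) (hγ' : γ ≤ 1 / 10 ^ 10)
    (hα : 0 ≤ α) (hα' : α ≤ 1 / 4) :
    PhaseFamilyBounds (fun A => T / (2 * √(1 + γ * A)) - 2 * N * √A) α (1 / 10 ^ 10) (1 / 10)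
      (1 / 10 ^ 6) 100 := by
  have hm : (N : ℝ) = -2 ∨ (N : ℝ) = -1 ∨ (N : ℝ) = 0 ∨ (N : ℝ) = 1 ∨ (N : ℝ) = 2 := by
    rw [Finset.mem_Icc] at hN
    have : N = -2 ∨ N = -1 ∨ N = 0 ∨ N = 1 ∨ N = 2 := by omega
    rcases this with rfl | rfl | rfl | rfl | rfl <;> norm_num
  intro ε hε τ hτ
  rcases hε with rfl | rfl
  · obtain ⟨F, F1, F2, F3, hF, hb, hcase⟩ := exists_phaseBounds hm hT hT' hτ hγ hγ' hα hα'
    have hF' : (fun A => 1 * (√(A - α + τ) - τ / (2 * √(A - α + τ))) -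
        (T / (2 * √(1 + γ * A)) - 2 * N * √A)) = F := by
      funext A; rw [hF, one_mul]
    refine ⟨F1, F2, F3, ?_, ?_⟩
    · rw [hF']; exact hb
    · simpa only [hF, one_mul] using hcase
  · have hm' : -(N : ℝ) = -2 ∨ -(N : ℝ) = -1 ∨ -(N : ℝ) = 0 ∨ -(N : ℝ) = 1 ∨ -(N : ℝ) = 2 := by
      rcases hm with h | h | h | h | h <;> rw [h] <;> norm_num
    obtain ⟨F, F1, F2, F3, hF, hb, hcase⟩ := exists_phaseBounds hm' (by rwa [abs_neg] : 1 ≤ |-T|)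
      (by rwa [abs_neg]) hτ hγ hγ' hα hα'
    have hF' : ∀ A, -1 * (√(A - α + τ) - τ / (2 * √(A - α + τ))) -
        (T / (2 * √(1 + γ * A)) - 2 * N * √A) = -F A := by
      intro A; rw [hF]; ring
    refine ⟨fun A => -F1 A, fun A => -F2 A, fun A => -F3 A, ?_, ?_⟩
    · simp only [hF']; exact hb.neg
    · simp only [hF']
      rcases hcase with h | h
      · left
        intro A hA
        rw [show 1 - 2 * -F A * -F1 A = 1 - 2 * F A * F1 A by ring]
        exact h A hA
      · right
        intro A hA
        rw [show -F2 A + 2 * (-F1 A) ^ 3 = -(F2 A + 2 * F1 A ^ 3) by ring, abs_neg]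
        exact h A hA

theorem hasDerivAt_integral_mul_exp {m : Measure ℝ} {g τ : ℝ → ℂ} (hg : AEStronglyMeasurable g m)
    (hτ : AEStronglyMeasurable τ m)
    (hint : ∀ R : ℝ, Integrable (fun u => ‖g u‖ * Real.exp (R * ‖τ u‖)) m) (ω : ℂ) :
    HasDerivAt (fun ω : ℂ => ∫ u, g u * Complex.exp (ω * τ u) ∂m)
      (∫ u, g u * τ u * Complex.exp (ω * τ u) ∂m) ω := by
  have hm : ∀ ω : ℂ, AEStronglyMeasurable (fun u => Complex.exp (ω * τ u)) m := fun ω =>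
    Complex.continuous_exp.comp_aestronglyMeasurable (hτ.const_mul ω)
  have hexp : ∀ (w : ℂ) (u : ℝ), ‖Complex.exp (w * τ u)‖ ≤ Real.exp (‖w‖ * ‖τ u‖) := fun w u => by
    rw [Complex.norm_exp, Real.exp_le_exp, ← norm_mul]
    exact Complex.re_le_norm _
  refine (hasDerivAt_integral_of_dominated_loc_of_deriv_le (μ := m)
    (bound := fun u => ‖g u‖ * Real.exp ((‖ω‖ + 2) * ‖τ u‖)) (s := Metric.ball ω 1)
    (F := fun ω u => g u * Complex.exp (ω * τ u))
    (F' := fun ω u => g u * τ u * Complex.exp (ω * τ u)) (Metric.ball_mem_nhds ω one_pos)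
    (Eventually.of_forall fun w => hg.mul (hm w)) ?_ ((hg.mul hτ).mul (hm ω)) ?_ (hint _) ?_).2
  · refine (hint ‖ω‖).mono' (hg.mul (hm ω)) (Eventually.of_forall fun u => ?_)
    rw [norm_mul]
    exact mul_le_mul_of_nonneg_left (hexp ω u) (norm_nonneg _)
  · refine Eventually.of_forall fun u w hw => ?_
    have hw' : ‖w‖ ≤ ‖ω‖ + 1 := by
      have := norm_sub_norm_le w ω
      rw [Metric.mem_ball, dist_eq_norm] at hw
      linarith
    have h1 : ‖τ u‖ ≤ Real.exp ‖τ u‖ := by linarith [Real.add_one_le_exp ‖τ u‖]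
    rw [norm_mul, norm_mul, mul_assoc]
    refine mul_le_mul_of_nonneg_left ?_ (norm_nonneg _)
    calc ‖τ u‖ * ‖Complex.exp (w * τ u)‖ ≤ Real.exp ‖τ u‖ * Real.exp ((‖ω‖ + 1) * ‖τ u‖) := by
          gcongr
          exact (hexp w u).trans (Real.exp_le_exp.2 (by gcongr))
      _ = Real.exp ((‖ω‖ + 2) * ‖τ u‖) := by rw [← Real.exp_add]; congr 1; ring
  · refine Eventually.of_forall fun u w _ => ?_
    refine ((((hasDerivAt_id w).mul_const (τ u)).cexp).const_mul (g u)).congr_deriv ?_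
    simp only [id]
    ring

theorem integrable_exp_neg_sq_add_abs {a : ℝ} (ha : 0 < a) (b d : ℝ) :
    Integrable fun u : ℝ => Real.exp (-a * u ^ 2 + b * |u| + d) := by
  refine ((integrable_exp_neg_mul_sq (half_pos ha)).const_mul
    (Real.exp (b ^ 2 / (2 * a) + d))).mono' (by fun_prop) (Eventually.of_forall fun u => ?_)
  rw [Real.norm_of_nonneg (Real.exp_pos _).le, ← Real.exp_add, Real.exp_le_exp]
  have h : 0 ≤ a / 2 * (|u| - b / a) ^ 2 := by positivity
  have h2 : a / 2 * (|u| - b / a) ^ 2 = a / 2 * u ^ 2 - b * |u| + b ^ 2 / (2 * a) := by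
    rw [← sq_abs u]; field_simp; ring
  nlinarith

theorem pow_le_exp_mul {x : ℝ} (hx : 0 ≤ x) (k : ℕ) : x ^ k ≤ Real.exp (k * x) := by
  rw [Real.exp_nat_mul]
  exact pow_le_pow_left₀ hx (by linarith [Real.add_one_le_exp x]) k

/-- `∫₀^∞ v^k e^{-v³/3 - ωv} dv`. -/
noncomputable def cubicLaplace (k : ℕ) (ω : ℂ) : ℂ :=
  ∫ v in Set.Ioi (0 : ℝ), (v : ℂ) ^ k * Complex.exp (-((v : ℂ) ^ 3 / 3)) *
    Complex.exp (ω * -(v : ℂ))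

theorem integrable_cubicLaplace (k : ℕ) (R : ℝ) :
    Integrable (fun v : ℝ => ‖(v : ℂ) ^ k * Complex.exp (-((v : ℂ) ^ 3 / 3))‖ *
      Real.exp (R * ‖-(v : ℂ)‖)) (volume.restrict (Set.Ioi 0)) := by
  refine ((integrable_exp_neg_sq_add_abs one_pos (k + R + 3 / 4) 0).mono_measure
    Measure.restrict_le_self).mono' (Continuous.aestronglyMeasurable (by fun_prop))
    ((ae_restrict_mem measurableSet_Ioi).mono fun v hv => ?_)
  have hv0 : 0 < v := hv
  have hre : (-((v : ℂ) ^ 3 / 3)).re = -(v ^ 3 / 3) := by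
    rw [show -((v : ℂ) ^ 3 / 3) = ((-(v ^ 3 / 3) : ℝ) : ℂ) by push_cast; ring, Complex.ofReal_re]
  rw [Real.norm_of_nonneg (by positivity), norm_neg, norm_mul, norm_pow, Complex.norm_real,
    Real.norm_of_nonneg hv0.le, Complex.norm_exp, hre, abs_of_pos hv0]
  calc _ ≤ Real.exp (k * v) * Real.exp (-(v ^ 3 / 3)) * Real.exp (R * v) := by
        gcongr
        exact pow_le_exp_mul hv0.le k
    _ ≤ _ := by
      rw [← Real.exp_add, ← Real.exp_add, Real.exp_le_exp]
      nlinarith [mul_nonneg hv0.le (sq_nonneg (v - 3 / 2))]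

theorem hasDerivAt_cubicLaplace (k : ℕ) (ω : ℂ) :
    HasDerivAt (cubicLaplace k) (-cubicLaplace (k + 1) ω) ω := by
  refine (hasDerivAt_integral_mul_exp (Continuous.aestronglyMeasurable (by fun_prop))
    (Continuous.aestronglyMeasurable (by fun_prop)) (integrable_cubicLaplace k) ω).congr_deriv ?_
  rw [cubicLaplace, ← integral_neg]
  congr 1
  funext v
  ring

theorem integrableOn_cubicLaplace (k : ℕ) (ω : ℂ) :
    IntegrableOn (fun v : ℝ => (v : ℂ) ^ k * Complex.exp (-((v : ℂ) ^ 3 / 3)) *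
    Complex.exp (ω * -(v : ℂ))) (Set.Ioi 0) := by
  refine (integrable_cubicLaplace k ‖ω‖).mono' (Continuous.aestronglyMeasurable (by fun_prop))
    (Eventually.of_forall fun v => ?_)
  rw [norm_mul]
  gcongr
  rw [Complex.norm_exp, Real.exp_le_exp, ← norm_mul]
  exact Complex.re_le_norm _

theorem cubicLaplace_two (ω : ℂ) : cubicLaplace 2 ω + ω * cubicLaplace 0 ω = 1 := by
  have hd : ∀ v ∈ Set.Ici (0 : ℝ), HasDerivAt
      (fun v : ℝ => -(Complex.exp (-((v : ℂ) ^ 3 / 3)) * Complex.exp (ω * -(v : ℂ))))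
      ((v : ℂ) ^ 2 * Complex.exp (-((v : ℂ) ^ 3 / 3)) * Complex.exp (ω * -(v : ℂ)) +
        ω * ((v : ℂ) ^ 0 * Complex.exp (-((v : ℂ) ^ 3 / 3)) * Complex.exp (ω * -(v : ℂ)))) v := by
    intro v _
    have h1 : HasDerivAt (fun v : ℝ => (v : ℂ)) 1 v := Complex.ofRealCLM.hasDerivAt
    refine (((((h1.pow 3).div_const 3).neg.cexp).mul ((h1.neg.const_mul ω).cexp)).neg).congr_deriv ?_
    simp only [Pi.pow_apply]
    norm_num
    ring
  have hi2 := integrableOn_cubicLaplace 2 ω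
  have hi0 := integrableOn_cubicLaplace 0 ω
  have hi0' : IntegrableOn (fun v : ℝ => -(Complex.exp (-((v : ℂ) ^ 3 / 3)) *
      Complex.exp (ω * -(v : ℂ)))) (Set.Ioi 0) := by
    refine IntegrableOn.congr_fun hi0.neg (fun v _ => ?_) measurableSet_Ioi
    simp
  have hi' := hi2.add (hi0.const_mul ω)
  have ht := tendsto_zero_of_hasDerivAt_of_integrableOn_Ioi
    (fun v hv => hd v (Set.mem_Ici.2 (le_of_lt hv))) hi' hi0'
  have h := integral_Ioi_of_hasDerivAt_of_tendsto' hd hi' ht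
  rw [integral_add hi2 (hi0.const_mul ω), integral_const_mul] at h
  simpa [cubicLaplace] using h

theorem norm_cubicLaplace_le (k : ℕ) {ω : ℂ} (hω : 0 ≤ ω.re) :
    ‖cubicLaplace k ω‖ ≤ ∫ v in Set.Ioi (0 : ℝ), ‖(v : ℂ) ^ k * Complex.exp (-((v : ℂ) ^ 3 / 3))‖ := by
  have hi : IntegrableOn (fun v : ℝ => ‖(v : ℂ) ^ k * Complex.exp (-((v : ℂ) ^ 3 / 3))‖)
    (Set.Ioi 0) := by
    have := integrable_cubicLaplace k 0
    simp only [zero_mul, Real.exp_zero, mul_one] at this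
    exact this
  refine norm_integral_le_of_norm_le hi ((ae_restrict_mem measurableSet_Ioi).mono fun v hv => ?_)
  rw [norm_mul]
  refine mul_le_of_le_one_right (norm_nonneg _) ?_
  rw [Complex.norm_exp, Real.exp_le_one_iff]
  have hv0 : 0 < v := hv
  have : (ω * -(v : ℂ)).re = -(ω.re * v) := by simp
  rw [this]
  nlinarith

theorem cubicLaplace_zero_zero : cubicLaplace 0 0 =
    ((3 : ℝ) ^ (-(2 : ℝ) / 3) * Real.Gamma (1 / 3) : ℝ) := by
  have h := _root_.integral_rpow_mul_exp_neg_mul_rpow (p := 3) (q := 0) (b := 1 / 3) (by norm_num)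
    (by norm_num) (by norm_num)
  have e : cubicLaplace 0 0 = ((∫ x in Set.Ioi (0 : ℝ), x ^ (0 : ℝ) *
      Real.exp (-(1 / 3) * x ^ (3 : ℝ)) : ℝ) : ℂ) := by
    rw [cubicLaplace, ← integral_complex_ofReal]
    refine setIntegral_congr_fun measurableSet_Ioi fun v hv => ?_
    have : v ^ (3 : ℝ) = v ^ 3 := by norm_cast
    simp only [this, Real.rpow_zero]
    push_cast
    simp
    ring_nf
  have hc : (1 / 3 : ℝ) ^ (-((0 : ℝ) + 1) / 3) * (1 / 3) = 3 ^ (-(2 : ℝ) / 3) := by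
    rw [one_div, Real.inv_rpow (by norm_num), ← Real.rpow_neg (by norm_num),
      ← Real.rpow_neg_one (3 : ℝ), ← Real.rpow_add (by norm_num)]
    norm_num
  rw [e, h, hc, zero_add]

theorem cubicLaplace_one_zero : cubicLaplace 1 0 =
    ((3 : ℝ) ^ (-(1 : ℝ) / 3) * Real.Gamma (2 / 3) : ℝ) := by
  have h := _root_.integral_rpow_mul_exp_neg_mul_rpow (p := 3) (q := 1) (b := 1 / 3) (by norm_num)
    (by norm_num) (by norm_num)
  have e : cubicLaplace 1 0 = ((∫ x in Set.Ioi (0 : ℝ), x ^ (1 : ℝ) *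
      Real.exp (-(1 / 3) * x ^ (3 : ℝ)) : ℝ) : ℂ) := by
    rw [cubicLaplace, ← integral_complex_ofReal]
    refine setIntegral_congr_fun measurableSet_Ioi fun v hv => ?_
    have : v ^ (3 : ℝ) = v ^ 3 := by norm_cast
    simp only [this, Real.rpow_one]
    push_cast
    rw [zero_mul, Complex.exp_zero, mul_one, pow_one]
    ring_nf
  have hc : (1 / 3 : ℝ) ^ (-((1 : ℝ) + 1) / 3) * (1 / 3) = 3 ^ (-(1 : ℝ) / 3) := by
    rw [one_div, Real.inv_rpow (by norm_num), ← Real.rpow_neg (by norm_num),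
      ← Real.rpow_neg_one (3 : ℝ), ← Real.rpow_add (by norm_num)]
    norm_num
  rw [e, h, hc, one_add_one_eq_two]

/-- `e^{iπ/6}`. -/
noncomputable def rot : ℂ := Complex.exp ((Real.pi / 6 : ℝ) * Complex.I)

theorem rot_re : rot.re = √3 / 2 := by
  rw [rot, Complex.exp_ofReal_mul_I_re, Real.cos_pi_div_six]

theorem rot_im : rot.im = 1 / 2 := by
  rw [rot, Complex.exp_ofReal_mul_I_im, Real.sin_pi_div_six]

theorem rot_re_pos : 0 < rot.re := by
  rw [rot_re]
  positivity

theorem rot_re_sq : rot.re ^ 2 = 3 / 4 := by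
  rw [rot_re, div_pow, Real.sq_sqrt (by norm_num)]
  norm_num

theorem norm_rot : ‖rot‖ = 1 := Complex.norm_exp_ofReal_mul_I _

theorem rot_ne_zero : rot ≠ 0 := Complex.exp_ne_zero _

theorem rot_pow_three : rot ^ 3 = Complex.I := by
  rw [rot, ← Complex.exp_nat_mul]
  refine Eq.trans ?_ Complex.exp_pi_div_two_mul_I
  congr 1
  push_cast
  ring

theorem rot_sq : rot ^ 2 = Complex.exp ((Real.pi / 3 : ℂ) * Complex.I) := by
  rw [rot, ← Complex.exp_nat_mul]
  congr 1
  push_cast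
  ring

theorem inv_rot_sq : (rot⁻¹) ^ 2 = Complex.exp (-(Real.pi / 3 : ℂ) * Complex.I) := by
  rw [inv_pow, rot_sq, ← Complex.exp_neg, neg_mul]

theorem inv_rot_eq_conj : rot⁻¹ = (starRingEnd ℂ) rot := by
  rw [Complex.inv_def, Complex.normSq_eq_norm_sq, norm_rot]
  simp

theorem rot_sq_re : (rot ^ 2).re = 1 / 2 := by
  rw [pow_two, Complex.mul_re, rot_im]
  nlinarith [rot_re_sq]

theorem inv_rot_sq_re : ((rot⁻¹) ^ 2).re = 1 / 2 := by
  rw [inv_rot_eq_conj, ← map_pow, Complex.conj_re, rot_sq_re]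

theorem rot_sq_im : (rot ^ 2).im = rot.re := by
  rw [pow_two, Complex.mul_im, rot_im]
  ring

theorem rot_add_inv_ne_zero : rot + rot⁻¹ ≠ 0 := by
  intro h
  have := congrArg Complex.re h
  rw [inv_rot_eq_conj, Complex.add_re, Complex.conj_re, Complex.zero_re] at this
  linarith [rot_re_pos]

theorem wronskian_eq {q y y1 w w1 : ℝ → ℂ} (hy : ∀ x, HasDerivAt y (y1 x) x)
    (hy1 : ∀ x, HasDerivAt y1 (q x * y x) x) (hw : ∀ x, HasDerivAt w (w1 x) x)
    (hw1 : ∀ x, HasDerivAt w1 (q x * w x) x) (x z : ℝ) :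
    y x * w1 x - y1 x * w x = y z * w1 z - y1 z * w z := by
  have hd : ∀ x, HasDerivAt (fun x => y x * w1 x - y1 x * w x) 0 x := fun x =>
    (((hy x).mul (hw1 x)).sub ((hy1 x).mul (hw x))).congr_deriv (by ring)
  exact is_const_of_deriv_eq_zero (fun x => (hd x).differentiableAt) (fun x => (hd x).deriv) x z

theorem HasDerivAt.comp_mul_ofReal {g : ℂ → ℂ} {g' a : ℂ} {x : ℝ} (hg : HasDerivAt g g' (a * x)) :
    HasDerivAt (fun x : ℝ => g (a * x)) (a * g') x := by
  have h1 : HasDerivAt (fun v : ℝ => (v : ℂ)) 1 x := Complex.ofRealCLM.hasDerivAt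
  exact (hg.comp x (h1.const_mul a)).congr_deriv (by ring)

/-- A solution of `f'' = x f` that is bounded on `[0, ∞)`, together with its derivative. -/
noncomputable def realRay (x : ℝ) : ℂ :=
  rot⁻¹ * cubicLaplace 0 (rot ^ 2 * x) + rot * cubicLaplace 0 ((rot⁻¹) ^ 2 * x)

noncomputable def realRayDeriv (x : ℝ) : ℂ :=
  -(rot * cubicLaplace 1 (rot ^ 2 * x) + rot⁻¹ * cubicLaplace 1 ((rot⁻¹) ^ 2 * x))

theorem hasDerivAt_realRay (x : ℝ) : HasDerivAt realRay (realRayDeriv x) x := by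
  refine ((((hasDerivAt_cubicLaplace 0 _).comp_mul_ofReal).const_mul rot⁻¹).add
    (((hasDerivAt_cubicLaplace 0 _).comp_mul_ofReal).const_mul rot)).congr_deriv ?_
  have := rot_ne_zero
  rw [realRayDeriv]
  field_simp
  ring

theorem hasDerivAt_realRayDeriv (x : ℝ) : HasDerivAt realRayDeriv (x * realRay x) x := by
  refine (((((hasDerivAt_cubicLaplace 1 _).comp_mul_ofReal).const_mul rot).add
    (((hasDerivAt_cubicLaplace 1 _).comp_mul_ofReal).const_mul rot⁻¹)).neg).congr_deriv ?_
  have hI : rot * rot ^ 2 = Complex.I := by rw [← rot_pow_three]; ring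
  have hI' : rot⁻¹ * (rot⁻¹) ^ 2 = -Complex.I := by
    rw [← Complex.inv_I, ← rot_pow_three, ← inv_pow]; ring
  have h1 := cubicLaplace_two (rot ^ 2 * x)
  have h2 := cubicLaplace_two ((rot⁻¹) ^ 2 * x)
  have e1 : rot⁻¹ = -(Complex.I * rot ^ 2) := by
    have h6 : rot ^ 6 = -1 := by
      rw [show rot ^ 6 = (rot ^ 3) ^ 2 by ring, rot_pow_three, Complex.I_sq]
    have : rot * (rot⁻¹ + Complex.I * rot ^ 2) = 0 := by
      rw [mul_add, mul_inv_cancel₀ rot_ne_zero, ← rot_pow_three]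
      linear_combination h6
    have := (mul_eq_zero.1 this).resolve_left rot_ne_zero
    linear_combination this
  have e2 : rot = Complex.I * (rot⁻¹) ^ 2 := by
    rw [← rot_pow_three]
    have := rot_ne_zero
    field_simp
  rw [show (1 + 1 : ℕ) = 2 from rfl]
  have e3 : cubicLaplace 2 (rot ^ 2 * x) = 1 - rot ^ 2 * x * cubicLaplace 0 (rot ^ 2 * x) := by
    linear_combination h1
  have e4 : cubicLaplace 2 ((rot⁻¹) ^ 2 * x) =
      1 - (rot⁻¹) ^ 2 * x * cubicLaplace 0 ((rot⁻¹) ^ 2 * x) := by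
    linear_combination h2
  rw [e3, e4, realRay]
  generalize cubicLaplace 0 (rot ^ 2 * x) = P
  generalize cubicLaplace 0 ((rot⁻¹) ^ 2 * x) = Q
  linear_combination (1 - rot ^ 2 * x * P) * hI + (1 - (rot⁻¹) ^ 2 * x * Q) * hI' - x * P * e1
    - x * Q * e2

theorem norm_realRay_le : ∃ M, ∀ x : ℝ, 0 ≤ x → ‖realRay x‖ ≤ M ∧ ‖realRayDeriv x‖ ≤ M := by
  have hr : ∀ x : ℝ, 0 ≤ x → 0 ≤ (rot ^ 2 * x).re ∧ 0 ≤ ((rot⁻¹) ^ 2 * x).re := fun x hx => by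
    rw [Complex.re_mul_ofReal, Complex.re_mul_ofReal, rot_sq_re, inv_rot_sq_re]
    constructor <;> positivity
  obtain ⟨M0, h0⟩ : ∃ M, ∀ ω : ℂ, 0 ≤ ω.re → ‖cubicLaplace 0 ω‖ ≤ M :=
    ⟨_, fun ω => norm_cubicLaplace_le 0⟩
  obtain ⟨M1, h1⟩ : ∃ M, ∀ ω : ℂ, 0 ≤ ω.re → ‖cubicLaplace 1 ω‖ ≤ M :=
    ⟨_, fun ω => norm_cubicLaplace_le 1⟩
  refine ⟨max (M0 + M0) (M1 + M1), fun x hx => ⟨(?_ : _ ≤ M0 + M0).trans (le_max_left _ _),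
    (?_ : _ ≤ M1 + M1).trans (le_max_right _ _)⟩⟩
  · refine (norm_add_le _ _).trans ?_
    rw [norm_mul, norm_mul, norm_inv, norm_rot, inv_one, one_mul, one_mul]
    exact add_le_add (h0 _ (hr x hx).1) (h0 _ (hr x hx).2)
  · rw [realRayDeriv, norm_neg]
    refine (norm_add_le _ _).trans ?_
    rw [norm_mul, norm_mul, norm_inv, norm_rot, inv_one, one_mul, one_mul]
    exact add_le_add (h1 _ (hr x hx).1) (h1 _ (hr x hx).2)

/-- The contour `t(u) = ic + b e^{iπ/6} u`. -/
noncomputable def tilt (c b u : ℝ) : ℂ := Complex.I * c + b * rot * u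

/-- `∫ t(u)^k e^{t(u)³/3 + ω t(u)} du` along the contour `tilt c b`. -/
noncomputable def contourAiry (c b : ℝ) (k : ℕ) (ω : ℂ) : ℂ :=
  ∫ u : ℝ, tilt c b u ^ k * Complex.exp (tilt c b u ^ 3 / 3) * Complex.exp (ω * tilt c b u)

@[fun_prop] theorem continuous_tilt (c b : ℝ) : Continuous (tilt c b) := by
  unfold tilt
  fun_prop

theorem hasDerivAt_tilt (c b u : ℝ) : HasDerivAt (tilt c b) (b * rot) u := by
  have h1 : HasDerivAt (fun v : ℝ => (v : ℂ)) 1 u := Complex.ofRealCLM.hasDerivAt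
  exact ((h1.const_mul (b * rot : ℂ)).const_add (Complex.I * c)).congr_deriv (mul_one _)

theorem norm_tilt_le {c b : ℝ} (hc : 0 ≤ c) (hb : 0 ≤ b) (u : ℝ) : ‖tilt c b u‖ ≤ c + b * |u| := by
  refine (norm_add_le _ _).trans ?_
  simp [norm_rot, abs_of_nonneg hc, abs_of_nonneg hb]

theorem tilt_pow_three (c b u : ℝ) : tilt c b u ^ 3 = -(3 * b * c * u) * (c * rot) +
    Complex.I * (3 * b ^ 2 * c * u ^ 2) * rot ^ 2 + Complex.I * (b ^ 3 * u ^ 3 - c ^ 3) := by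
  rw [tilt]
  linear_combination (3 * b * c ^ 2 * rot * u) * Complex.I_sq + (c ^ 3 * Complex.I) * Complex.I_sq
    + (b ^ 3 * u ^ 3 : ℂ) * rot_pow_three

theorem re_tilt_pow_three (c b u : ℝ) :
    (tilt c b u ^ 3 / 3).re = -rot.re * (c * b ^ 2 * u ^ 2 + c ^ 2 * b * u) := by
  have : tilt c b u ^ 3 / 3 = ((-(b * c * u * c) : ℝ) : ℂ) * rot +
      ((b ^ 2 * c * u ^ 2 : ℝ) : ℂ) * (Complex.I * rot ^ 2) +
      ((b ^ 3 * u ^ 3 / 3 - c ^ 3 / 3 : ℝ) : ℂ) * Complex.I := by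
    rw [tilt_pow_three]
    push_cast
    ring
  rw [this, Complex.add_re, Complex.add_re, Complex.re_ofReal_mul, Complex.re_ofReal_mul,
    Complex.re_ofReal_mul, Complex.I_re, Complex.I_mul_re, rot_sq_im]
  ring

theorem integrable_contourAiry {c b : ℝ} (hc : 0 < c) (hb : 0 < b) (k : ℕ) (R : ℝ) :
    Integrable fun u : ℝ => ‖tilt c b u ^ k * Complex.exp (tilt c b u ^ 3 / 3)‖ *
      Real.exp (R * ‖tilt c b u‖) := by
  have ha : 0 < rot.re * (c * b ^ 2) := mul_pos rot_re_pos (by positivity)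
  refine (integrable_exp_neg_sq_add_abs ha (rot.re * (c ^ 2 * b) + (k + |R|) * b)
    ((k + |R|) * c)).mono' (Continuous.aestronglyMeasurable (by fun_prop))
    (Eventually.of_forall fun u => ?_)
  have ht := norm_tilt_le hc.le hb.le u
  rw [Real.norm_of_nonneg (by positivity), norm_mul, norm_pow, Complex.norm_exp, re_tilt_pow_three]
  calc _ ≤ Real.exp (k * (c + b * |u|)) *
        Real.exp (-rot.re * (c * b ^ 2 * u ^ 2 + c ^ 2 * b * u)) *
        Real.exp (|R| * (c + b * |u|)) := by
        gcongr
        · exact (pow_le_exp_mul (norm_nonneg _) k).trans (Real.exp_le_exp.2 (by gcongr))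
        · exact le_abs_self R
    _ ≤ _ := by
      rw [← Real.exp_add, ← Real.exp_add, Real.exp_le_exp]
      have : rot.re * (c ^ 2 * b) * -u ≤ rot.re * (c ^ 2 * b) * |u| :=
        mul_le_mul_of_nonneg_left (neg_le_abs u)
          (mul_nonneg rot_re_pos.le (by positivity))
      nlinarith

theorem hasDerivAt_contourAiry {c b : ℝ} (hc : 0 < c) (hb : 0 < b) (k : ℕ) (ω : ℂ) :
    HasDerivAt (contourAiry c b k) (contourAiry c b (k + 1) ω) ω := by
  refine (hasDerivAt_integral_mul_exp (Continuous.aestronglyMeasurable (by fun_prop))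
    (Continuous.aestronglyMeasurable (by fun_prop))
    (integrable_contourAiry hc hb k) ω).congr_deriv ?_
  rw [contourAiry]
  congr 1
  funext v
  ring

theorem integrable_contourAiry' {c b : ℝ} (hc : 0 < c) (hb : 0 < b) (k : ℕ) (ω : ℂ) :
    Integrable fun u : ℝ => tilt c b u ^ k * Complex.exp (tilt c b u ^ 3 / 3) *
      Complex.exp (ω * tilt c b u) := by
  refine (integrable_contourAiry hc hb k ‖ω‖).mono' (Continuous.aestronglyMeasurable (by fun_prop))
    (Eventually.of_forall fun v => ?_)
  rw [norm_mul]
  gcongr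
  rw [Complex.norm_exp, Real.exp_le_exp, ← norm_mul]
  exact Complex.re_le_norm _

theorem contourAiry_two {c b : ℝ} (hc : 0 < c) (hb : 0 < b) (ω : ℂ) :
    contourAiry c b 2 ω = -ω * contourAiry c b 0 ω := by
  have hb' : (b : ℂ) * rot ≠ 0 := mul_ne_zero (by exact_mod_cast hb.ne') rot_ne_zero
  have hi2 := integrable_contourAiry' hc hb 2 ω
  have hi0 := integrable_contourAiry' hc hb 0 ω
  have hd : ∀ u : ℝ, HasDerivAt (fun u : ℝ => tilt c b u ^ 0 * Complex.exp (tilt c b u ^ 3 / 3) *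
      Complex.exp (ω * tilt c b u)) ((b * rot) *
      (tilt c b u ^ 2 * Complex.exp (tilt c b u ^ 3 / 3) * Complex.exp (ω * tilt c b u) +
      ω * (tilt c b u ^ 0 * Complex.exp (tilt c b u ^ 3 / 3) *
      Complex.exp (ω * tilt c b u)))) u := fun u => by
    have ht := hasDerivAt_tilt c b u
    simp only [pow_zero, one_mul]
    refine ((((ht.pow 3).div_const 3).cexp).mul ((ht.const_mul ω).cexp)).congr_deriv ?_
    simp only [Pi.pow_apply]
    norm_num
    ring
  have h := integral_eq_zero_of_hasDerivAt_of_integrable hd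
    ((hi2.add (hi0.const_mul ω)).const_mul _) hi0
  rw [integral_const_mul, integral_add hi2 (hi0.const_mul ω), integral_const_mul] at h
  have := (mul_eq_zero.1 h).resolve_left hb'
  rw [contourAiry, contourAiry]
  linear_combination this

theorem norm_contourAiry_ray_le {c b : ℝ} (hc : 0 < c) (hb : 0 < b) (k : ℕ) : ∃ M, ∀ x : ℝ,
    ‖contourAiry c b k (rot ^ 2 * x)‖ ≤ Real.exp (-(rot.re * c) * x) * M := by
  have hi : Integrable fun u : ℝ => ‖tilt c b u ^ k * Complex.exp (tilt c b u ^ 3 / 3)‖ := by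
    have := integrable_contourAiry hc hb k 0
    simp only [zero_mul, Real.exp_zero, mul_one] at this
    exact this
  refine ⟨∫ u : ℝ, ‖tilt c b u ^ k * Complex.exp (tilt c b u ^ 3 / 3)‖, fun x => ?_⟩
  rw [← integral_const_mul]
  refine norm_integral_le_of_norm_le (hi.const_mul _) (Eventually.of_forall fun u => ?_)
  have e : rot ^ 2 * x * tilt c b u = (x * c : ℝ) * (Complex.I * rot ^ 2) +
      (x * b * u : ℝ) * Complex.I := by
    rw [tilt]
    push_cast
    linear_combination (x * b * u : ℂ) * rot_pow_three
  rw [norm_mul, mul_comm, Complex.norm_exp, e, Complex.add_re, Complex.re_ofReal_mul,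
    Complex.re_ofReal_mul, Complex.I_re, Complex.I_mul_re, rot_sq_im]
  refine mul_le_mul_of_nonneg_right (Real.exp_le_exp.2 (le_of_eq ?_)) (norm_nonneg _)
  ring

theorem contourAiry_zero_relation {c b : ℝ} (hc : 0 < c) (hb : 0 < b) :
    cubicLaplace 0 0 * (rot ^ 2 * contourAiry c b 1 0) =
      -cubicLaplace 1 0 * contourAiry c b 0 0 := by
  set y : ℝ → ℂ := fun x => contourAiry c b 0 (rot ^ 2 * x) with hy
  set y1 : ℝ → ℂ := fun x => rot ^ 2 * contourAiry c b 1 (rot ^ 2 * x) with hy1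
  have hdy : ∀ x, HasDerivAt y (y1 x) x := fun x =>
    (hasDerivAt_contourAiry hc hb 0 _).comp_mul_ofReal
  have hdy1 : ∀ x : ℝ, HasDerivAt y1 (x * y x) x := fun x => by
    refine (((hasDerivAt_contourAiry hc hb 1 _).comp_mul_ofReal).const_mul (rot ^ 2)).congr_deriv ?_
    rw [show 1 + 1 = 2 from rfl, contourAiry_two hc hb]
    have h6 : rot ^ 6 = -1 := by
      rw [show rot ^ 6 = (rot ^ 3) ^ 2 by ring, rot_pow_three, Complex.I_sq]
    linear_combination (-x * y x) * h6
  have hW := wronskian_eq hasDerivAt_realRay hasDerivAt_realRayDeriv hdy hdy1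
  obtain ⟨M, hM⟩ := norm_realRay_le
  obtain ⟨M0, h0⟩ := norm_contourAiry_ray_le hc hb 0
  obtain ⟨M1, h1⟩ := norm_contourAiry_ray_le hc hb 1
  have hk : 0 < rot.re * c := mul_pos rot_re_pos hc
  have he : Tendsto (fun x : ℝ => Real.exp (-(rot.re * c) * x)) atTop (nhds 0) := by
    simp only [neg_mul]
    exact Real.tendsto_exp_neg_atTop_nhds_zero.comp (tendsto_id.const_mul_atTop hk)
  have hlim : Tendsto (fun x : ℝ => realRay x * y1 x - realRayDeriv x * y x) atTop (nhds 0) := by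
    have hg := he.mul_const (M * M1 + M * M0)
    rw [zero_mul] at hg
    refine squeeze_zero_norm' ((eventually_ge_atTop 0).mono fun x hx => ?_) hg
    have hM0 : 0 ≤ M := (norm_nonneg _).trans (hM x hx).1
    refine (norm_sub_le _ _).trans ?_
    have e4 : ‖y1 x‖ = ‖contourAiry c b 1 (rot ^ 2 * x)‖ := by simp [hy1, norm_rot]
    rw [mul_add, norm_mul (realRay x), norm_mul (realRayDeriv x), e4]
    have e1 := mul_le_mul (hM x hx).1 (h1 x) (norm_nonneg _) hM0
    have e2 := mul_le_mul (hM x hx).2 (h0 x) (norm_nonneg _) hM0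
    have e3 : y x = contourAiry c b 0 (rot ^ 2 * x) := rfl
    rw [e3]
    nlinarith
  have hz : realRay 0 * y1 0 - realRayDeriv 0 * y 0 = 0 :=
    tendsto_nhds_unique (tendsto_const_nhds.congr fun x => (hW x 0).symm) hlim
  have hf : realRay 0 = (rot + rot⁻¹) * cubicLaplace 0 0 := by
    simp [realRay]
    ring
  have hf' : realRayDeriv 0 = -((rot + rot⁻¹) * cubicLaplace 1 0) := by
    simp [realRayDeriv]
    ring
  have hy0 : y 0 = contourAiry c b 0 0 := by simp [hy]
  have hy10 : y1 0 = rot ^ 2 * contourAiry c b 1 0 := by simp [hy1]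
  rw [hf, hf', hy0, hy10] at hz
  refine mul_left_cancel₀ rot_add_inv_ne_zero ?_
  linear_combination hz

theorem cubicLaplace_zero_ne_zero : cubicLaplace 0 0 ≠ 0 := by
  rw [cubicLaplace_zero_zero]
  have := Real.Gamma_pos_of_pos (show (0 : ℝ) < 1 / 3 by norm_num)
  exact_mod_cast (by positivity : (3 : ℝ) ^ (-(2 : ℝ) / 3) * Real.Gamma (1 / 3) ≠ 0)

/-- The derivative of `Aplus`. -/
noncomputable def AplusDeriv (Ai : ℂ → ℂ) (x : ℝ) : ℂ :=
  ((rot⁻¹) ^ 2) ^ 2 * deriv Ai ((rot⁻¹) ^ 2 * x)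

theorem Aplus_eq (Ai : ℂ → ℂ) (x : ℝ) : Aplus Ai x = (rot⁻¹) ^ 2 * Ai ((rot⁻¹) ^ 2 * x) := by
  rw [Aplus, inv_rot_sq]

theorem inv_rot_pow_six : (rot⁻¹) ^ 6 = -1 := by
  rw [inv_pow, show rot ^ 6 = (rot ^ 3) ^ 2 by ring, rot_pow_three, Complex.I_sq]
  norm_num

theorem hasDerivAt_Aplus {Ai : ℂ → ℂ} (hA : Differentiable ℂ Ai) (x : ℝ) :
    HasDerivAt (fun x : ℝ => Aplus Ai x) (AplusDeriv Ai x) x := by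
  simp only [Aplus_eq]
  refine (((hA _).hasDerivAt.comp_mul_ofReal).const_mul _).congr_deriv ?_
  rw [AplusDeriv]
  ring

theorem hasDerivAt_AplusDeriv {Ai : ℂ → ℂ} (hA : Differentiable ℂ (deriv Ai))
    (hode : ∀ z : ℂ, deriv (deriv Ai) z = z * Ai z) (x : ℝ) :
    HasDerivAt (AplusDeriv Ai) (-x * Aplus Ai x) x := by
  refine (((hA _).hasDerivAt.comp_mul_ofReal).const_mul _).congr_deriv ?_
  rw [hode, Aplus_eq]
  linear_combination ((rot⁻¹) ^ 2 * x * Ai ((rot⁻¹) ^ 2 * x)) * inv_rot_pow_six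

theorem three_cpow (s : ℝ) : (3 : ℂ) ^ (s : ℂ) = ((3 : ℝ) ^ s : ℝ) := by
  rw [Complex.ofReal_cpow (by norm_num)]
  norm_num

theorem Airy_zero_relation {Ai : ℂ → ℂ}
    (h0 : Ai 0 = (3 : ℂ) ^ (-(2 : ℂ)/3) / Complex.Gamma (2/3))
    (h1 : deriv Ai 0 = -((3 : ℂ) ^ (-(1 : ℂ)/3)) / Complex.Gamma (1/3)) :
    deriv Ai 0 * cubicLaplace 0 0 = -Ai 0 * cubicLaplace 1 0 := by
  have e2 : Complex.Gamma (2 / 3) = (Real.Gamma (2 / 3) : ℝ) := by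
    rw [← Complex.Gamma_ofReal]; norm_num
  have e1 : Complex.Gamma (1 / 3) = (Real.Gamma (1 / 3) : ℝ) := by
    rw [← Complex.Gamma_ofReal]; norm_num
  have p2 : (3 : ℂ) ^ (-(2 : ℂ)/3) = ((3 : ℝ) ^ (-(2 : ℝ)/3) : ℝ) := by
    rw [← three_cpow]; norm_num
  have p1 : (3 : ℂ) ^ (-(1 : ℂ)/3) = ((3 : ℝ) ^ (-(1 : ℝ)/3) : ℝ) := by
    rw [← three_cpow]; norm_num
  have g1 : ((Real.Gamma (1 / 3) : ℝ) : ℂ) ≠ 0 :=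
    Complex.ofReal_ne_zero.2 (Real.Gamma_pos_of_pos (by norm_num)).ne'
  have g2 : ((Real.Gamma (2 / 3) : ℝ) : ℂ) ≠ 0 :=
    Complex.ofReal_ne_zero.2 (Real.Gamma_pos_of_pos (by norm_num)).ne'
  rw [h0, h1, e1, e2, p1, p2, cubicLaplace_zero_zero, cubicLaplace_one_zero]
  simp only [Complex.ofReal_mul]
  field_simp

theorem Aplus_mul_contourAiry {Ai : ℂ → ℂ} (hA : Differentiable ℂ Ai)
    (hA' : Differentiable ℂ (deriv Ai)) (hode : ∀ z : ℂ, deriv (deriv Ai) z = z * Ai z)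
    (h0 : Ai 0 = (3 : ℂ) ^ (-(2 : ℂ)/3) / Complex.Gamma (2/3))
    (h1 : deriv Ai 0 = -((3 : ℂ) ^ (-(1 : ℂ)/3)) / Complex.Gamma (1/3))
    {c b : ℝ} (hc : 0 < c) (hb : 0 < b) (x : ℝ) :
    Aplus Ai x * contourAiry c b 1 x = AplusDeriv Ai x * contourAiry c b 0 x := by
  have hd : ∀ (k : ℕ) (x : ℝ), HasDerivAt (fun x : ℝ => contourAiry c b k x)
      (contourAiry c b (k + 1) x) x := fun k x => by
    have := HasDerivAt.comp_mul_ofReal (a := 1) (x := x) (hasDerivAt_contourAiry hc hb k (1 * x))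
    simpa using this
  have hW := wronskian_eq (q := fun x => -(x : ℂ)) (hasDerivAt_Aplus hA)
    (hasDerivAt_AplusDeriv hA' hode)
    (hd 0) (fun x => (hd 1 x).congr_deriv (contourAiry_two hc hb x)) x 0
  have hz := contourAiry_zero_relation hc hb
  have hAz := Airy_zero_relation h0 h1
  have hi : (rot⁻¹) ^ 2 * rot ^ 2 = 1 := by
    rw [← mul_pow, inv_mul_cancel₀ rot_ne_zero, one_pow]
  have key : Ai 0 * (rot ^ 2 * contourAiry c b 1 0) = deriv Ai 0 * contourAiry c b 0 0 := by
    refine mul_left_cancel₀ cubicLaplace_zero_ne_zero ?_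
    linear_combination Ai 0 * hz - contourAiry c b 0 0 * hAz
  have hA0 : AplusDeriv Ai 0 = ((rot⁻¹) ^ 2) ^ 2 * deriv Ai 0 := by simp [AplusDeriv]
  rw [Aplus_eq Ai 0, hA0, Complex.ofReal_zero, mul_zero] at hW
  refine sub_eq_zero.1 (hW.trans ?_)
  simp only [zero_add]
  linear_combination ((rot⁻¹) ^ 2) ^ 2 * key - (rot⁻¹) ^ 2 * Ai 0 * contourAiry c b 1 0 * hi

theorem hasDerivAt_integral_mul_exp_I {g : ℝ → ℂ} {τ : ℝ → ℝ} (hτ : Continuous τ)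
    (hg : Integrable g) (hgτ : Integrable fun u => g u * (Complex.I * τ u)) (ε : ℝ) :
    HasDerivAt (fun ε : ℝ => ∫ u, g u * Complex.exp (Complex.I * (ε * τ u)))
      (∫ u, g u * (Complex.I * τ u) * Complex.exp (Complex.I * (ε * τ u))) ε := by
  have hn : ∀ ε u : ℝ, ‖Complex.exp (Complex.I * (ε * τ u))‖ = 1 := fun ε u => by
    rw [← Complex.ofReal_mul, Complex.norm_exp_I_mul_ofReal]
  have hm : ∀ ε : ℝ, AEStronglyMeasurable
      (fun u => Complex.exp (Complex.I * ((ε : ℂ) * τ u))) volume := fun ε =>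
    Continuous.aestronglyMeasurable (by fun_prop)
  refine (hasDerivAt_integral_of_dominated_loc_of_deriv_le (μ := volume)
    (bound := fun u => ‖g u * (Complex.I * τ u)‖) (s := Set.univ)
    (F := fun (ε : ℝ) u => g u * Complex.exp (Complex.I * (ε * τ u)))
    (F' := fun (ε : ℝ) u => g u * (Complex.I * τ u) * Complex.exp (Complex.I * (ε * τ u)))
    Filter.univ_mem (Eventually.of_forall fun w => hg.1.mul (hm w)) ?_ (hgτ.1.mul (hm ε)) ?_
    hgτ.norm ?_).2
  · refine hg.norm.mono' (hg.1.mul (hm ε)) (Eventually.of_forall fun u => ?_)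
    rw [norm_mul, hn, mul_one]
  · refine Eventually.of_forall fun u w _ => ?_
    rw [norm_mul, hn, mul_one]
  · refine Eventually.of_forall fun u w _ => ?_
    have h1 : HasDerivAt (fun v : ℝ => (v : ℂ)) 1 w := Complex.ofRealCLM.hasDerivAt
    refine ((((h1.mul_const (τ u : ℂ)).const_mul Complex.I).cexp).const_mul (g u)).congr_deriv ?_
    ring

theorem inv_rot_re : (rot⁻¹).re = rot.re := by
  rw [inv_rot_eq_conj, Complex.conj_re]

theorem norm_gauss_rot (k : ℕ) (u : ℝ) : ‖(u : ℂ) ^ k * Complex.exp (-rot⁻¹ * (u : ℂ) ^ 2)‖ =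
    |u| ^ k * Real.exp (-rot.re * u ^ 2) := by
  have : -rot⁻¹ * (u : ℂ) ^ 2 = ((-u ^ 2 : ℝ) : ℂ) * rot⁻¹ := by push_cast; ring
  rw [norm_mul, norm_pow, Complex.norm_real, Real.norm_eq_abs, this, Complex.norm_exp,
    Complex.re_ofReal_mul, inv_rot_re]
  ring_nf

theorem integrable_gauss_rot (k : ℕ) :
    Integrable fun u : ℝ => (u : ℂ) ^ k * Complex.exp (-rot⁻¹ * (u : ℂ) ^ 2) := by
  refine (integrable_exp_neg_sq_add_abs rot_re_pos k 0).mono'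
    (Continuous.aestronglyMeasurable (by fun_prop)) (Eventually.of_forall fun u => ?_)
  rw [norm_gauss_rot, add_zero, add_comm, Real.exp_add]
  exact mul_le_mul_of_nonneg_right (pow_le_exp_mul (abs_nonneg u) k) (Real.exp_pos _).le

/-- `∫ u^k e^{-κu² + iεu³/3} du` with `κ = e^{-iπ/6}`. -/
noncomputable def gaussCubic (k : ℕ) (ε : ℝ) : ℂ :=
  ∫ u : ℝ, (u : ℂ) ^ k * Complex.exp (-rot⁻¹ * (u : ℂ) ^ 2) *
    Complex.exp (Complex.I * (ε * (u ^ 3 / 3 : ℝ)))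

theorem hasDerivAt_gaussCubic (k : ℕ) (ε : ℝ) :
    HasDerivAt (gaussCubic k) (Complex.I / 3 * gaussCubic (k + 3) ε) ε := by
  have e : ∀ u : ℝ, (u : ℂ) ^ k * Complex.exp (-rot⁻¹ * (u : ℂ) ^ 2) *
      (Complex.I * (u ^ 3 / 3 : ℝ)) =
      Complex.I / 3 * ((u : ℂ) ^ (k + 3) * Complex.exp (-rot⁻¹ * (u : ℂ) ^ 2)) := fun u => by
    push_cast
    ring
  refine (hasDerivAt_integral_mul_exp_I (τ := fun u => u ^ 3 / 3) (by fun_prop)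
    (integrable_gauss_rot k) ?_ ε).congr_deriv ?_
  · simp only [e]
    exact (integrable_gauss_rot (k + 3)).const_mul _
  · rw [gaussCubic, ← integral_const_mul]
    simp only [e, mul_assoc]

theorem integrable_gaussCubic (k : ℕ) (ε : ℝ) :
    Integrable fun u : ℝ => (u : ℂ) ^ k * Complex.exp (-rot⁻¹ * (u : ℂ) ^ 2) *
      Complex.exp (Complex.I * (ε * (u ^ 3 / 3 : ℝ))) := by
  refine (integrable_gauss_rot k).norm.mono' (Continuous.aestronglyMeasurable (by fun_prop))
    (Eventually.of_forall fun u => ?_)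
  rw [norm_mul _ (Complex.exp (Complex.I * _)), ← Complex.ofReal_mul,
    Complex.norm_exp_I_mul_ofReal, mul_one]

theorem gaussCubic_one (ε : ℝ) :
    gaussCubic 1 ε = rot * Complex.I * ε / 2 * gaussCubic 2 ε := by
  have hi1 := integrable_gaussCubic 1 ε
  have hi2 := integrable_gaussCubic 2 ε
  have hd : ∀ u : ℝ, HasDerivAt (fun u : ℝ => (u : ℂ) ^ 0 * Complex.exp (-rot⁻¹ * (u : ℂ) ^ 2) *
      Complex.exp (Complex.I * (ε * (u ^ 3 / 3 : ℝ))))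
      (-(2 * rot⁻¹) * ((u : ℂ) ^ 1 * Complex.exp (-rot⁻¹ * (u : ℂ) ^ 2) *
      Complex.exp (Complex.I * (ε * (u ^ 3 / 3 : ℝ)))) +
      Complex.I * ε * ((u : ℂ) ^ 2 * Complex.exp (-rot⁻¹ * (u : ℂ) ^ 2) *
      Complex.exp (Complex.I * (ε * (u ^ 3 / 3 : ℝ))))) u := fun u => by
    have h1 : HasDerivAt (fun v : ℝ => (v : ℂ)) 1 u := Complex.ofRealCLM.hasDerivAt
    push_cast
    simp only [pow_zero, one_mul]
    refine ((((h1.pow 2).const_mul (-rot⁻¹)).cexp).mul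
      (((((h1.pow 3).div_const 3).const_mul (ε : ℂ)).const_mul Complex.I).cexp)).congr_deriv ?_
    simp only [Pi.pow_apply]
    norm_num
    ring
  have h := integral_eq_zero_of_hasDerivAt_of_integrable hd
    ((hi1.const_mul _).add (hi2.const_mul _)) (integrable_gaussCubic 0 ε)
  rw [integral_add (hi1.const_mul _) (hi2.const_mul _), integral_const_mul,
    integral_const_mul] at h
  have h' : -(2 * rot⁻¹) * gaussCubic 1 ε + Complex.I * ε * gaussCubic 2 ε = 0 := h
  have hr := rot_ne_zero
  have hr' : rot * rot⁻¹ = 1 := mul_inv_cancel₀ hr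
  linear_combination (-rot / 2) * h' - gaussCubic 1 ε * hr'

theorem gaussCubic_zero_ne_zero : gaussCubic 0 0 ≠ 0 := by
  have h : gaussCubic 0 0 = (Real.pi / rot⁻¹) ^ (1 / 2 : ℂ) := by
    rw [← integral_gaussian_complex (by rw [inv_rot_re]; exact rot_re_pos), gaussCubic]
    simp
  rw [h, Complex.cpow_ne_zero_iff]
  left
  exact div_ne_zero (by exact_mod_cast Real.pi_ne_zero) (inv_ne_zero rot_ne_zero)

theorem contourAiry_zero_eq {c b : ℝ} (hcb : c * b ^ 2 = 1) :
    contourAiry c b 0 (c ^ 2 : ℝ) =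
      Complex.exp (2 / 3 * Complex.I * c ^ 3) * gaussCubic 0 (b ^ 3) ∧
    contourAiry c b 1 (c ^ 2 : ℝ) = Complex.exp (2 / 3 * Complex.I * c ^ 3) *
      (Complex.I * c * gaussCubic 0 (b ^ 3) + b * rot * gaussCubic 1 (b ^ 3)) := by
  have hcb' : (c : ℂ) * b ^ 2 = 1 := by exact_mod_cast hcb
  have hrot : Complex.I * rot ^ 2 = -rot⁻¹ := by
    have h6 : rot ^ 6 = -1 := by
      rw [show rot ^ 6 = (rot ^ 3) ^ 2 by ring, rot_pow_three, Complex.I_sq]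
    rw [← rot_pow_three]
    refine mul_left_cancel₀ rot_ne_zero ?_
    rw [mul_neg, mul_inv_cancel₀ rot_ne_zero]
    linear_combination h6
  have hexp : ∀ u : ℝ, Complex.exp (tilt c b u ^ 3 / 3) *
      Complex.exp ((c ^ 2 : ℝ) * tilt c b u) = Complex.exp (2 / 3 * Complex.I * c ^ 3) *
      (Complex.exp (-rot⁻¹ * (u : ℂ) ^ 2) *
        Complex.exp (Complex.I * ((b ^ 3 : ℝ) * (u ^ 3 / 3 : ℝ)))) := fun u => by
    rw [← Complex.exp_add, ← Complex.exp_add, ← Complex.exp_add, tilt_pow_three, ← hrot, tilt]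
    congr 1
    push_cast
    linear_combination (Complex.I * u ^ 2 * rot ^ 2) * hcb'
  constructor
  · rw [contourAiry, gaussCubic, ← integral_const_mul]
    congr 1
    funext u
    rw [pow_zero, one_mul, hexp, pow_zero, one_mul]
  · rw [contourAiry, gaussCubic, gaussCubic, ← integral_const_mul, ← integral_const_mul,
      ← integral_add ((integrable_gaussCubic 0 _).const_mul _)
        ((integrable_gaussCubic 1 _).const_mul _), ← integral_const_mul]
    congr 1
    funext u
    rw [pow_one, mul_assoc, hexp, tilt]
    ring

/-- The correction to the logarithmic derivative of `Aplus`. -/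
noncomputable def airyCorr (ε : ℝ) : ℂ :=
  rot ^ 2 * Complex.I / 2 * (gaussCubic 2 ε / gaussCubic 0 ε)

noncomputable def airyCorrDeriv (ε : ℝ) : ℂ :=
  rot ^ 2 * Complex.I / 2 * ((Complex.I / 3 * gaussCubic 5 ε * gaussCubic 0 ε -
    gaussCubic 2 ε * (Complex.I / 3 * gaussCubic 3 ε)) / gaussCubic 0 ε ^ 2)

theorem hasDerivAt_airyCorr {ε : ℝ} (hε : gaussCubic 0 ε ≠ 0) :
    HasDerivAt airyCorr (airyCorrDeriv ε) ε :=
  ((hasDerivAt_gaussCubic 2 ε).div (hasDerivAt_gaussCubic 0 ε) hε).const_mul _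

theorem continuousAt_airyCorrDeriv {ε : ℝ} (hε : gaussCubic 0 ε ≠ 0) :
    ContinuousAt airyCorrDeriv ε := by
  have h : ∀ k, ContinuousAt (gaussCubic k) ε := fun k => (hasDerivAt_gaussCubic k ε).continuousAt
  exact continuousAt_const.mul (((((continuousAt_const.mul (h 5)).mul (h 0))).sub
    ((h 2).mul (continuousAt_const.mul (h 3)))).div ((h 0).pow 2) (pow_ne_zero 2 hε))

theorem exists_airyCorr_bounds : ∃ ε₀ > 0, ∃ M, ∀ ε ∈ Set.Ioo (-ε₀) ε₀,
    gaussCubic 0 ε ≠ 0 ∧ ‖airyCorr ε‖ ≤ M ∧ ‖airyCorrDeriv ε‖ ≤ M := by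
  have h0 := gaussCubic_zero_ne_zero
  have e0 : ∀ᶠ ε in nhds (0 : ℝ), gaussCubic 0 ε ≠ 0 :=
    (hasDerivAt_gaussCubic 0 0).continuousAt.eventually_ne h0
  have e1 : ∀ᶠ ε in nhds (0 : ℝ), ‖airyCorr ε‖ < ‖airyCorr 0‖ + 1 :=
    (hasDerivAt_airyCorr h0).continuousAt.norm.eventually_lt_const (lt_add_one _)
  have e2 : ∀ᶠ ε in nhds (0 : ℝ), ‖airyCorrDeriv ε‖ < ‖airyCorrDeriv 0‖ + 1 :=
    (continuousAt_airyCorrDeriv h0).norm.eventually_lt_const (lt_add_one _)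
  obtain ⟨r, hr, h⟩ := Metric.eventually_nhds_iff_ball.1 (e0.and (e1.and e2))
  refine ⟨r, hr, max (‖airyCorr 0‖ + 1) (‖airyCorrDeriv 0‖ + 1), fun ε hε => ?_⟩
  have := h ε (by rw [Real.ball_eq_Ioo]; simpa using hε)
  exact ⟨this.1, this.2.1.le.trans (le_max_left _ _), this.2.2.le.trans (le_max_right _ _)⟩

theorem AplusDeriv_eq {Ai : ℂ → ℂ} (hA : Differentiable ℂ Ai)
    (hA' : Differentiable ℂ (deriv Ai)) (hode : ∀ z : ℂ, deriv (deriv Ai) z = z * Ai z)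
    (h0 : Ai 0 = (3 : ℂ) ^ (-(2 : ℂ)/3) / Complex.Gamma (2/3))
    (h1 : deriv Ai 0 = -((3 : ℂ) ^ (-(1 : ℂ)/3)) / Complex.Gamma (1/3))
    {c b : ℝ} (hc : 0 < c) (hb : 0 < b) (hcb : c * b ^ 2 = 1) (hJ : gaussCubic 0 (b ^ 3) ≠ 0) :
    AplusDeriv Ai (c ^ 2) =
      (Complex.I * c + b ^ 4 * airyCorr (b ^ 3)) * Aplus Ai (c ^ 2 : ℝ) := by
  have h := Aplus_mul_contourAiry hA hA' hode h0 h1 hc hb (c ^ 2)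
  obtain ⟨e0, e1⟩ := contourAiry_zero_eq hcb
  rw [e0, e1, gaussCubic_one] at h
  have hE := Complex.exp_ne_zero (2 / 3 * Complex.I * c ^ 3)
  refine mul_right_cancel₀ (mul_ne_zero hE hJ) ?_
  rw [← h, airyCorr]
  field_simp
  push_cast
  ring

/-- The derivative of `Aminus`. -/
noncomputable def AminusDeriv (Ai : ℂ → ℂ) (x : ℝ) : ℂ :=
  (rot ^ 2) ^ 2 * deriv Ai (rot ^ 2 * x)

theorem Aminus_eq (Ai : ℂ → ℂ) (x : ℝ) : Aminus Ai x = rot ^ 2 * Ai (rot ^ 2 * x) := by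
  rw [Aminus, rot_sq]

theorem hasDerivAt_Aminus {Ai : ℂ → ℂ} (hA : Differentiable ℂ Ai) (x : ℝ) :
    HasDerivAt (fun x : ℝ => Aminus Ai x) (AminusDeriv Ai x) x := by
  simp only [Aminus_eq]
  refine (((hA _).hasDerivAt.comp_mul_ofReal).const_mul _).congr_deriv ?_
  rw [AminusDeriv]
  ring

theorem hasDerivAt_AminusDeriv {Ai : ℂ → ℂ} (hA : Differentiable ℂ (deriv Ai))
    (hode : ∀ z : ℂ, deriv (deriv Ai) z = z * Ai z) (x : ℝ) :
    HasDerivAt (AminusDeriv Ai) (-x * Aminus Ai x) x := by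
  refine (((hA _).hasDerivAt.comp_mul_ofReal).const_mul _).congr_deriv ?_
  have h6 : rot ^ 6 = -1 := by
    rw [show rot ^ 6 = (rot ^ 3) ^ 2 by ring, rot_pow_three, Complex.I_sq]
  rw [hode, Aminus_eq]
  linear_combination (rot ^ 2 * x * Ai (rot ^ 2 * x)) * h6

theorem conj_deriv_Airy_zero {Ai : ℂ → ℂ}
    (h1 : deriv Ai 0 = -((3 : ℂ) ^ (-(1 : ℂ)/3)) / Complex.Gamma (1/3)) :
    (starRingEnd ℂ) (deriv Ai 0) = deriv Ai 0 := by
  have e1 : Complex.Gamma (1 / 3) = (Real.Gamma (1 / 3) : ℝ) := by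
    rw [← Complex.Gamma_ofReal]; norm_num
  have p1 : (3 : ℂ) ^ (-(1 : ℂ)/3) = ((3 : ℝ) ^ (-(1 : ℝ)/3) : ℝ) := by
    rw [← three_cpow]; norm_num
  rw [h1, e1, p1, map_div₀, map_neg, Complex.conj_ofReal, Complex.conj_ofReal]

theorem AminusDeriv_mul_conj {Ai : ℂ → ℂ} (hA : Differentiable ℂ Ai)
    (hA' : Differentiable ℂ (deriv Ai)) (hode : ∀ z : ℂ, deriv (deriv Ai) z = z * Ai z)
    (h0 : (Ai 0).im = 0)
    (h1 : deriv Ai 0 = -((3 : ℂ) ^ (-(1 : ℂ)/3)) / Complex.Gamma (1/3)) (x : ℝ) :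
    AminusDeriv Ai x * (starRingEnd ℂ) (Aplus Ai x) =
      (starRingEnd ℂ) (AplusDeriv Ai x) * Aminus Ai x := by
  have hW := wronskian_eq (q := fun x => -(x : ℂ)) (hasDerivAt_Aminus hA)
    (hasDerivAt_AminusDeriv hA' hode)
    (fun x => (hasDerivAt_Aplus hA x).star) (fun x => (hasDerivAt_AplusDeriv hA' hode x).star.congr_deriv
      (by simp)) x 0
  have hc := Complex.conj_eq_iff_im.2 h0
  have hc' := conj_deriv_Airy_zero h1
  have z : Aminus Ai (0 : ℝ) * star (AplusDeriv Ai 0) -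
      AminusDeriv Ai 0 * star (Aplus Ai (0 : ℝ)) = 0 := by
    rw [Aplus_eq, Aminus_eq, AplusDeriv, AminusDeriv, Complex.ofReal_zero, mul_zero, mul_zero,
      inv_rot_eq_conj]
    simp only [Complex.star_def, map_mul, map_pow, Complex.conj_conj, hc, hc']
    ring
  have := hW.trans z
  simp only [Complex.star_def] at this
  linear_combination -this

/-- Logarithmic derivative of `-A₋/A₊`. -/
theorem hasDerivAt_airyRatio {Ai : ℂ → ℂ} (hA : Differentiable ℂ Ai)
    (hA' : Differentiable ℂ (deriv Ai)) (hode : ∀ z : ℂ, deriv (deriv Ai) z = z * Ai z)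
    (h0 : Ai 0 = (3 : ℂ) ^ (-(2 : ℂ)/3) / Complex.Gamma (2/3))
    (h1 : deriv Ai 0 = -((3 : ℂ) ^ (-(1 : ℂ)/3)) / Complex.Gamma (1/3)) (hre : (Ai 0).im = 0)
    (hne : ∀ w : ℝ, Aplus Ai w ≠ 0)
    {c b : ℝ} (hc : 0 < c) (hb : 0 < b) (hcb : c * b ^ 2 = 1) (hJ : gaussCubic 0 (b ^ 3) ≠ 0) :
    HasDerivAt (fun x : ℝ => -Aminus Ai x / Aplus Ai x)
      ((-(2 * Complex.I * c) + b ^ 4 * ((starRingEnd ℂ) (airyCorr (b ^ 3)) - airyCorr (b ^ 3))) *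
        (-Aminus Ai (c ^ 2 : ℝ) / Aplus Ai (c ^ 2 : ℝ))) (c ^ 2) := by
  refine ((hasDerivAt_Aminus hA _).neg.div (hasDerivAt_Aplus hA _) (hne _)).congr_deriv ?_
  have e1 := AplusDeriv_eq hA hA' hode h0 h1 hc hb hcb hJ
  have e2 := AminusDeriv_mul_conj hA hA' hode hre h1 (c ^ 2)
  have hn := hne (c ^ 2)
  have hn' : (starRingEnd ℂ) (Aplus Ai (c ^ 2 : ℝ)) ≠ 0 := by simpa using hn
  have e3 : AminusDeriv Ai (c ^ 2) = (-(Complex.I * c) + b ^ 4 * (starRingEnd ℂ) (airyCorr (b ^ 3))) *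
      Aminus Ai (c ^ 2 : ℝ) := by
    refine mul_right_cancel₀ hn' ?_
    rw [e2, e1]
    simp only [map_mul, map_add, map_pow, Complex.conj_I, Complex.conj_ofReal]
    ring
  simp only [Pi.neg_apply]
  rw [e1, e3]
  field_simp
  ring

/-- The small parameter `μ^{-1/2} A^{-3/4}`. -/
noncomputable def airyScale (μ A : ℝ) : ℝ := μ ^ (-(1 / 2) : ℝ) * A ^ (-(3 / 4) : ℝ)

/-- Logarithmic derivative of `A ↦ e^{iB(μA^{3/2})}`. -/
noncomputable def reflSlope (μ A : ℝ) : ℂ :=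
  ((starRingEnd ℂ) (airyCorr (airyScale μ A)) - airyCorr (airyScale μ A)) * (A⁻¹ : ℝ)

noncomputable def reflSlopeDeriv (μ A : ℝ) : ℂ :=
  ((starRingEnd ℂ) (airyCorrDeriv (airyScale μ A)) - airyCorrDeriv (airyScale μ A)) *
    (-(3 / 4) * airyScale μ A * A⁻¹ : ℝ) * (A⁻¹ : ℝ) +
  ((starRingEnd ℂ) (airyCorr (airyScale μ A)) - airyCorr (airyScale μ A)) * (-(A ^ 2)⁻¹ : ℝ)

/-- `L` is a phase of the ratio of the two oscillating Airy solutions. -/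
def IsAiryPhase (L : ℝ → ℝ) : Prop :=
  ∀ c b : ℝ, 0 < c → 0 < b → c * b ^ 2 = 1 → gaussCubic 0 (b ^ 3) ≠ 0 →
    HasDerivAt (fun x : ℝ => Complex.exp (-(L x : ℂ) * Complex.I))
      ((-(2 * Complex.I * c) + b ^ 4 * ((starRingEnd ℂ) (airyCorr (b ^ 3)) - airyCorr (b ^ 3))) *
        Complex.exp (-(L (c ^ 2) : ℂ) * Complex.I)) (c ^ 2)

theorem osc_Bfun (L : ℝ → ℝ) {μ A : ℝ} (hμ : 0 < μ) (hA : 0 < A) :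
    osc (Bfun L (μ * A ^ ((3 : ℝ) / 2))) = Complex.I *
      osc (4 / 3 * μ * A ^ ((3 : ℝ) / 2)) *
      Complex.exp (-(L (μ ^ ((2 : ℝ) / 3) * A) : ℂ) * Complex.I) := by
  have e : (μ * A ^ ((3 : ℝ) / 2)) ^ ((2 : ℝ) / 3) = μ ^ ((2 : ℝ) / 3) * A := by
    rw [Real.mul_rpow hμ.le (by positivity), ← Real.rpow_mul hA.le]
    norm_num
  rw [Bfun, e, osc, osc]
  nth_rewrite 2 [← Complex.exp_pi_div_two_mul_I]
  rw [← Complex.exp_add, ← Complex.exp_add]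
  congr 1
  push_cast
  ring

theorem hasDerivAt_osc_Bfun {L : ℝ → ℝ} (hL : IsAiryPhase L) {μ A : ℝ} (hμ : 0 < μ) (hA : 0 < A)
    (hJ : gaussCubic 0 (airyScale μ A) ≠ 0) :
    HasDerivAt (fun A => osc (Bfun L (μ * A ^ ((3 : ℝ) / 2))))
      (reflSlope μ A * osc (Bfun L (μ * A ^ ((3 : ℝ) / 2)))) A := by
  have hev : (fun A : ℝ => osc (Bfun L (μ * A ^ ((3 : ℝ) / 2)))) =ᶠ[nhds A] fun A => Complex.I *
      osc (4 / 3 * μ * A ^ ((3 : ℝ) / 2)) *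
      Complex.exp (-(L (μ ^ ((2 : ℝ) / 3) * A) : ℂ) * Complex.I) :=
    (eventually_gt_nhds hA).mono fun B hB => osc_Bfun L hμ hB
  refine HasDerivAt.congr_of_eventuallyEq ?_ hev
  set c := μ ^ ((1 : ℝ) / 3) * A ^ ((1 : ℝ) / 2) with hc
  set b := μ ^ (-(1 : ℝ) / 6) * A ^ (-(1 : ℝ) / 4) with hb
  have hc0 : 0 < c := by positivity
  have hb0 : 0 < b := by positivity
  have hc2 : c ^ 2 = μ ^ ((2 : ℝ) / 3) * A := by
    rw [hc, mul_pow, ← Real.rpow_natCast, ← Real.rpow_natCast, ← Real.rpow_mul hμ.le,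
      ← Real.rpow_mul hA.le]
    norm_num
  have hb2 : b ^ 2 = c⁻¹ := by
    rw [hb, hc, mul_pow, ← Real.rpow_natCast, ← Real.rpow_natCast, ← Real.rpow_mul hμ.le,
      ← Real.rpow_mul hA.le, mul_inv, ← Real.rpow_neg hμ.le, ← Real.rpow_neg hA.le]
    norm_num
  have hcb : c * b ^ 2 = 1 := by rw [hb2, mul_inv_cancel₀ hc0.ne']
  have hb3 : b ^ 3 = airyScale μ A := by
    rw [hb, airyScale, mul_pow, ← Real.rpow_natCast, ← Real.rpow_natCast, ← Real.rpow_mul hμ.le,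
      ← Real.rpow_mul hA.le]
    norm_num
  have hμc : μ ^ ((2 : ℝ) / 3) * c = μ * A ^ ((1 : ℝ) / 2) := by
    rw [hc, ← mul_assoc, ← Real.rpow_add hμ]
    norm_num
  have hμb : μ ^ ((2 : ℝ) / 3) * b ^ 4 = A⁻¹ := by
    rw [show b ^ 4 = (b ^ 2) ^ 2 by ring, hb2, inv_pow, hc2, mul_inv, ← mul_assoc,
      mul_inv_cancel₀ (by positivity), one_mul]
  have hq := hL c b hc0 hb0 hcb (by rwa [hb3])
  rw [hc2] at hq
  have hlin : HasDerivAt (fun A : ℝ => μ ^ ((2 : ℝ) / 3) * A) (μ ^ ((2 : ℝ) / 3)) A := by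
    simpa using (hasDerivAt_id A).const_mul (μ ^ ((2 : ℝ) / 3))
  have hq' := hq.scomp A hlin
  have hp : HasDerivAt (fun A : ℝ => 4 / 3 * μ * A ^ ((3 : ℝ) / 2)) (2 * μ * A ^ ((1 : ℝ) / 2)) A := by
    refine ((Real.hasDerivAt_rpow_const (Or.inl hA.ne')).const_mul (4 / 3 * μ)).congr_deriv ?_
    norm_num
    ring
  refine ((hp.osc.const_mul Complex.I).mul hq').congr_deriv ?_
  rw [osc_Bfun L hμ hA, reflSlope, hb3]
  simp only [Function.comp, Complex.real_smul]
  have k1 : ((μ ^ ((2 : ℝ) / 3) : ℝ) : ℂ) * c = μ * (A ^ ((1 : ℝ) / 2) : ℝ) := by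
    exact_mod_cast hμc
  have k2 : ((μ ^ ((2 : ℝ) / 3) : ℝ) : ℂ) * b ^ 4 = (A⁻¹ : ℝ) := by
    exact_mod_cast hμb
  generalize Complex.exp (-(L (μ ^ ((2 : ℝ) / 3) * A) : ℂ) * Complex.I) = E
  generalize (starRingEnd ℂ) (airyCorr (airyScale μ A)) - airyCorr (airyScale μ A) = V
  generalize osc (4 / 3 * μ * A ^ ((3 : ℝ) / 2)) = O
  push_cast at k1 k2 ⊢
  linear_combination (-2 * Complex.I * Complex.I * O * E) * k1 + Complex.I * O * E * V * k2

theorem hasDerivAt_airyScale {μ A : ℝ} (hA : 0 < A) :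
    HasDerivAt (airyScale μ) (-(3 / 4) * airyScale μ A * A⁻¹) A := by
  refine ((Real.hasDerivAt_rpow_const (Or.inl hA.ne')).const_mul _).congr_deriv ?_
  rw [Real.rpow_sub_one hA.ne', airyScale]
  ring

theorem hasDerivAt_reflSlope {μ A : ℝ} (hA : 0 < A) (hJ : gaussCubic 0 (airyScale μ A) ≠ 0) :
    HasDerivAt (reflSlope μ) (reflSlopeDeriv μ A) A := by
  have h1 := (hasDerivAt_airyCorr hJ).scomp A (hasDerivAt_airyScale hA)
  have h2 : HasDerivAt (fun A : ℝ => ((A⁻¹ : ℝ) : ℂ)) (-(A ^ 2)⁻¹ : ℝ) A :=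
    (hasDerivAt_inv hA.ne').ofReal_comp
  refine ((h1.star.sub h1).mul h2).congr_deriv ?_
  simp only [reflSlopeDeriv, Function.comp, Complex.real_smul, Complex.star_def, map_mul,
    Complex.conj_ofReal, Pi.sub_apply]
  ring

theorem continuousAt_reflSlopeDeriv {μ A : ℝ} (hA : 0 < A)
    (hJ : gaussCubic 0 (airyScale μ A) ≠ 0) : ContinuousAt (reflSlopeDeriv μ) A := by
  have hs : ContinuousAt (airyScale μ) A := (hasDerivAt_airyScale hA).continuousAt
  have h1 : ContinuousAt (fun A => airyCorr (airyScale μ A)) A :=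
    ContinuousAt.comp (f := airyScale μ) (hasDerivAt_airyCorr hJ).continuousAt hs
  have h2 : ContinuousAt (fun A => airyCorrDeriv (airyScale μ A)) A :=
    ContinuousAt.comp (f := airyScale μ) (continuousAt_airyCorrDeriv hJ) hs
  have hi : ContinuousAt (fun A : ℝ => ((A⁻¹ : ℝ) : ℂ)) A :=
    Complex.continuous_ofReal.continuousAt.comp (continuousAt_inv₀ hA.ne')
  have hm : ContinuousAt (fun A : ℝ => ((-(3 / 4) * airyScale μ A * A⁻¹ : ℝ) : ℂ)) A :=
    Complex.continuous_ofReal.continuousAt.comp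
      ((continuousAt_const.mul hs).mul (continuousAt_inv₀ hA.ne'))
  have hi2 : ContinuousAt (fun A : ℝ => ((-(A ^ 2)⁻¹ : ℝ) : ℂ)) A :=
    Complex.continuous_ofReal.continuousAt.comp
      ((continuousAt_id.pow 2).inv₀ (pow_ne_zero 2 hA.ne')).neg
  exact ((((Complex.continuous_conj.continuousAt.comp h2).sub h2).mul hm).mul hi).add
    (((Complex.continuous_conj.continuousAt.comp h1).sub h1).mul hi2)

theorem osc_int_mul (N : ℤ) (x : ℝ) : osc (N * x) = osc x ^ N := by
  rw [osc, osc, ← Complex.exp_int_mul]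
  congr 1
  push_cast
  ring

theorem airyScale_mem {μ A ε₀ : ℝ} (hε : 0 < ε₀) (hμ : 4 / ε₀ ^ 2 < μ)
    (hA : A ∈ Set.Icc (1 / 2 : ℝ) (3 / 2)) : 0 < airyScale μ A ∧ airyScale μ A < ε₀ := by
  have hA0 : 0 < A := by linarith [hA.1]
  have hμ0 : 0 < μ := lt_trans (by positivity) hμ
  refine ⟨by unfold airyScale; positivity, ?_⟩
  have h1 : A ^ (-(3 / 4) : ℝ) ≤ 2 := by
    calc A ^ (-(3 / 4) : ℝ) ≤ (1 / 2 : ℝ) ^ (-(3 / 4) : ℝ) :=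
          Real.rpow_le_rpow_of_nonpos (by norm_num) hA.1 (by norm_num)
      _ ≤ (1 / 2 : ℝ) ^ (-1 : ℝ) :=
          Real.rpow_le_rpow_of_exponent_ge (by norm_num) (by norm_num) (by norm_num)
      _ = 2 := by rw [Real.rpow_neg_one]; norm_num
  have h2 : μ ^ (-(1 / 2) : ℝ) < ε₀ / 2 := by
    rw [Real.rpow_neg hμ0.le, ← Real.sqrt_eq_rpow, inv_lt_comm₀ (Real.sqrt_pos.2 hμ0) (by positivity)]
    refine Real.lt_sqrt_of_sq_lt ?_
    convert hμ using 1
    field_simp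
    norm_num
  calc airyScale μ A ≤ μ ^ (-(1 / 2) : ℝ) * 2 := by unfold airyScale; gcongr
    _ < ε₀ := by linarith

theorem norm_conj_sub_le {z : ℂ} {M : ℝ} (hz : ‖z‖ ≤ M) : ‖(starRingEnd ℂ) z - z‖ ≤ 2 * M := by
  refine (norm_sub_le _ _).trans ?_
  rw [RCLike.norm_conj]
  linarith

theorem exists_amplitudeBounds_refl {L : ℝ → ℝ} (hL : IsAiryPhase L) : ∃ μ₀ M : ℝ, ∀ μ : ℝ,
    μ₀ < μ → ∀ N ∈ Finset.Icc (-2 : ℤ) 2, ∃ H1 H2 : ℝ → ℂ,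
      AmplitudeBounds (fun A => osc (N * Bfun L (μ * A ^ ((3 : ℝ) / 2)))) H1 H2 M := by
  obtain ⟨r, hr, M, hM⟩ := exists_airyCorr_bounds
  set ε₀ := min r 1 with hε₀
  have hε : 0 < ε₀ := lt_min hr one_pos
  refine ⟨4 / ε₀ ^ 2, 1 + 28 * M + 64 * M ^ 2, fun μ hμ N hN => ?_⟩
  have hμ0 : 0 < μ := lt_trans (by positivity) hμ
  have hM0 : 0 ≤ M := (norm_nonneg _).trans (hM 0 ⟨by linarith, hr⟩).2.1
  have hN2 : ‖(N : ℂ)‖ ≤ 2 := by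
    rw [Complex.norm_intCast]
    rw [Finset.mem_Icc] at hN
    exact abs_le.2 ⟨by exact_mod_cast hN.1, by exact_mod_cast hN.2⟩
  set H : ℝ → ℂ := fun A => osc (N * Bfun L (μ * A ^ ((3 : ℝ) / 2))) with hH
  have key : ∀ A ∈ Set.Icc (1 / 2 : ℝ) (3 / 2), gaussCubic 0 (airyScale μ A) ≠ 0 ∧
      ‖airyCorr (airyScale μ A)‖ ≤ M ∧ ‖airyCorrDeriv (airyScale μ A)‖ ≤ M ∧
      |airyScale μ A| ≤ 1 ∧ |A⁻¹| ≤ 2 ∧ 0 < A := fun A hA => by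
    have hs := airyScale_mem hε hμ hA
    have hA0 : 0 < A := by linarith [hA.1]
    have hb := hM (airyScale μ A) ⟨by linarith, hs.2.trans_le (min_le_left _ _)⟩
    refine ⟨hb.1, hb.2.1, hb.2.2, ?_, ?_, hA0⟩
    · rw [abs_of_pos hs.1]
      exact hs.2.le.trans (min_le_right _ _)
    · rw [abs_of_pos (inv_pos.2 hA0)]
      exact inv_le_of_inv_le₀ (by norm_num) (by linarith [hA.1])
  have hslope : ∀ A ∈ Set.Icc (1 / 2 : ℝ) (3 / 2), ‖reflSlope μ A‖ ≤ 4 * M := fun A hA => by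
    obtain ⟨-, h1, -, -, h4, -⟩ := key A hA
    rw [reflSlope, norm_mul, Complex.norm_real, Real.norm_eq_abs]
    calc _ ≤ 2 * M * 2 := mul_le_mul (norm_conj_sub_le h1) h4 (abs_nonneg _) (by positivity)
      _ = _ := by ring
  have hslope' : ∀ A ∈ Set.Icc (1 / 2 : ℝ) (3 / 2), ‖reflSlopeDeriv μ A‖ ≤ 14 * M := fun A hA => by
    obtain ⟨-, h1, h2, h3, h4, -⟩ := key A hA
    rw [reflSlopeDeriv]
    refine (norm_add_le _ _).trans ?_
    rw [norm_mul, norm_mul, norm_mul, Complex.norm_real, Complex.norm_real, Complex.norm_real,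
      Real.norm_eq_abs, Real.norm_eq_abs, Real.norm_eq_abs, abs_mul, abs_mul, abs_neg, ← inv_pow,
      abs_neg, abs_pow]
    have e1 := norm_conj_sub_le h1
    have e2 := norm_conj_sub_le h2
    calc _ ≤ 2 * M * (|3 / 4| * 1 * 2) * 2 + 2 * M * 2 ^ 2 := by gcongr
      _ = _ := by rw [abs_of_pos (by norm_num)]; ring
  have hd : ∀ A ∈ Set.Icc (1 / 2 : ℝ) (3 / 2), HasDerivAt H (N * reflSlope μ A * H A) A := by
    intro A hA
    obtain ⟨hJ, -, -, -, -, hA0⟩ := key A hA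
    have hq := hasDerivAt_osc_Bfun hL hμ0 hA0 hJ
    have hne : osc (Bfun L (μ * A ^ ((3 : ℝ) / 2))) ≠ 0 := Complex.exp_ne_zero _
    have hz := (hasDerivAt_zpow N _ (Or.inl hne)).comp A hq
    simp only [Function.comp_def, ← osc_int_mul] at hz
    refine hz.congr_deriv ?_
    simp only [hH, osc_int_mul]
    rw [zpow_sub_one₀ hne]
    field_simp
  have hnorm : ∀ A, ‖H A‖ = 1 := fun A => norm_osc _
  have ha1 : ∀ A ∈ Set.Icc (1 / 2 : ℝ) (3 / 2), ‖N * reflSlope μ A * H A‖ ≤ 8 * M := fun A hA => by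
    rw [norm_mul, norm_mul, hnorm, mul_one]
    calc _ ≤ 2 * (4 * M) := mul_le_mul hN2 (hslope A hA) (norm_nonneg _) (by norm_num)
      _ = _ := by ring
  refine ⟨fun A => N * reflSlope μ A * H A,
    fun A => N * reflSlopeDeriv μ A * H A + N * reflSlope μ A * (N * reflSlope μ A * H A),
    hd, fun A hA => ?_, fun A hA => ?_, fun A hA => ?_, fun A hA => ?_, fun A hA => ?_⟩
  · obtain ⟨hJ, -, -, -, -, hA0⟩ := key A hA
    exact ((hasDerivAt_reflSlope hA0 hJ).const_mul (N : ℂ)).mul (hd A hA)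
  · obtain ⟨hJ, -, -, -, -, hA0⟩ := key A hA
    have c1 := (hd A hA).continuousAt
    have c2 := (hasDerivAt_reflSlope hA0 hJ).continuousAt
    have c3 := continuousAt_reflSlopeDeriv hA0 hJ
    exact ContinuousAt.continuousWithinAt (((continuousAt_const.mul c3).mul c1).add
      ((continuousAt_const.mul c2).mul ((continuousAt_const.mul c2).mul c1)))
  · rw [hnorm]
    nlinarith [sq_nonneg M]
  · refine (ha1 A hA).trans ?_
    nlinarith [sq_nonneg M]
  · refine (norm_add_le _ _).trans ?_
    have e1 : ‖N * reflSlopeDeriv μ A * H A‖ ≤ 28 * M := by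
      rw [norm_mul, norm_mul, hnorm, mul_one]
      calc _ ≤ 2 * (14 * M) := mul_le_mul hN2 (hslope' A hA) (norm_nonneg _) (by norm_num)
        _ = _ := by ring
    have e2 : ‖N * reflSlope μ A * (N * reflSlope μ A * H A)‖ ≤ 64 * M ^ 2 := by
      rw [norm_mul, norm_mul (N : ℂ)]
      calc _ ≤ 2 * (4 * M) * (8 * M) := by
            gcongr
            · exact hslope A hA
            · exact ha1 A hA
        _ = _ := by ring
    linarith

theorem isAiryPhase {Ai : ℂ → ℂ} (hA : Differentiable ℂ Ai)
    (hA' : Differentiable ℂ (deriv Ai)) (hode : ∀ z : ℂ, deriv (deriv Ai) z = z * Ai z)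
    (h0 : Ai 0 = (3 : ℂ) ^ (-(2 : ℂ)/3) / Complex.Gamma (2/3))
    (h1 : deriv Ai 0 = -((3 : ℂ) ^ (-(1 : ℂ)/3)) / Complex.Gamma (1/3))
    (hre : (Ai 0).im = 0) (hne : ∀ w : ℝ, Aplus Ai w ≠ 0) {L : ℝ → ℝ}
    (hL : ∀ w : ℝ, Complex.exp (-(L w : ℂ) * Complex.I) = -(Aminus Ai w) / (Aplus Ai w)) :
    IsAiryPhase L := fun c b hc hb hcb hJ => by
  have := hasDerivAt_airyRatio hA hA' hode h0 h1 hre hne hc hb hcb hJ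
  simp only [← hL] at this
  exact this

theorem eq_zero_of_tsupport_subset_Icc {f : ℝ → ℝ} (hf : Continuous f) {a b : ℝ}
    (hs : tsupport f ⊆ Set.Icc a b) {x : ℝ} (hx : x ∉ Set.Ioo a b) : f x = 0 := by
  by_contra h
  refine hx ?_
  rw [← interior_Icc]
  exact interior_maximal ((subset_tsupport f).trans hs) hf.isOpen_support h

theorem hasCompactSupport_of_tsupport_subset_Icc {f : ℝ → ℝ} {a b : ℝ}
    (hs : tsupport f ⊆ Set.Icc a b) : HasCompactSupport f :=
  isCompact_Icc.of_isClosed_subset (isClosed_tsupport f) hs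

theorem exists_cutoffBounds {χ : ℝ → ℝ} (hχ : ContDiff ℝ (⊤ : ℕ∞) χ)
    (hs : tsupport χ ⊆ Set.Ioo (-(3/2) : ℝ) (3/2)) :
    ∃ B, CutoffBounds (fun x => (χ x : ℂ)) (deriv fun x => (χ x : ℂ)) B := by
  have hcs := hasCompactSupport_of_tsupport_subset_Icc (hs.trans Set.Ioo_subset_Icc_self)
  have hd : ∀ x, HasDerivAt (fun x => (χ x : ℂ)) (deriv χ x : ℝ) x := fun x =>
    (hχ.differentiable (by simp) x).hasDerivAt.ofReal_comp
  have hde : (deriv fun x => (χ x : ℂ)) = fun x => ((deriv χ x : ℝ) : ℂ) :=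
    funext fun x => (hd x).deriv
  have hdc : Continuous (deriv χ) := hχ.continuous_deriv (by simp)
  obtain ⟨B0, h0⟩ := hcs.exists_bound_of_continuous hχ.continuous
  obtain ⟨B1, h1⟩ := hcs.deriv.exists_bound_of_continuous hdc
  refine ⟨max B0 B1, ⟨fun x => (hd x).congr_deriv (by rw [hde]), ?_, fun x => ?_, fun x => ?_,
    fun x hx => ?_⟩⟩
  · rw [hde]
    exact Complex.continuous_ofReal.comp hdc
  · rw [Complex.norm_real]
    exact (h0 x).trans (le_max_left _ _)
  · rw [hde, Complex.norm_real]
    exact (h1 x).trans (le_max_right _ _)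
  · rw [eq_zero_of_tsupport_subset_Icc hχ.continuous (hs.trans Set.Ioo_subset_Icc_self),
      Complex.ofReal_zero]
    intro h
    have := abs_lt.2 h
    linarith

theorem exists_amplitudeBounds_of_contDiff {f : ℝ → ℝ} (hf : ContDiff ℝ (⊤ : ℕ∞) f) :
    ∃ M, AmplitudeBounds (fun A => (f A : ℂ)) (fun A => ((deriv f A : ℝ) : ℂ))
      (fun A => ((deriv (deriv f) A : ℝ) : ℂ)) M := by
  have hf1 : ContDiff ℝ (⊤ : ℕ∞) (deriv f) := (contDiff_infty_iff_deriv.1 hf).2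
  have hf2 : Continuous (deriv (deriv f)) := hf1.continuous_deriv (by simp)
  obtain ⟨M0, h0⟩ := (isCompact_Icc (a := (1 / 2 : ℝ)) (b := 3 / 2)).exists_bound_of_continuousOn
    hf.continuous.continuousOn
  obtain ⟨M1, h1⟩ := (isCompact_Icc (a := (1 / 2 : ℝ)) (b := 3 / 2)).exists_bound_of_continuousOn
    hf1.continuous.continuousOn
  obtain ⟨M2, h2⟩ := (isCompact_Icc (a := (1 / 2 : ℝ)) (b := 3 / 2)).exists_bound_of_continuousOn
    hf2.continuousOn
  refine ⟨max M0 (max M1 M2), fun A _ => (hf.differentiable (by simp) A).hasDerivAt.ofReal_comp,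
    fun A _ => (hf1.differentiable (by simp) A).hasDerivAt.ofReal_comp,
    (Complex.continuous_ofReal.comp hf2).continuousOn, fun A hA => ?_, fun A hA => ?_,
    fun A hA => ?_⟩ <;> rw [Complex.norm_real]
  · exact (h0 A hA).trans (le_max_left _ _)
  · exact (h1 A hA).trans ((le_max_left _ _).trans (le_max_right _ _))
  · exact (h2 A hA).trans ((le_max_right _ _).trans (le_max_right _ _))

/-- The part of the phase that depends on `A` only. -/
noncomputable def travelPhase (N : ℤ) (T γ A : ℝ) : ℝ :=
  T * (A - 1) / (√(1 + γ * A) + √(1 + γ)) - 4 / 3 * N * A ^ ((3 : ℝ) / 2)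

theorem hasDerivAt_travelPhase (N : ℤ) (T : ℝ) {γ A : ℝ} (hγ : 0 < γ) (hA : 0 < A) :
    HasDerivAt (travelPhase N T γ) (T / (2 * √(1 + γ * A)) - 2 * N * √A) A := by
  have hev : travelPhase N T γ =ᶠ[nhds A] fun A =>
      T / γ * (√(1 + γ * A) - √(1 + γ)) - 4 / 3 * N * A ^ ((3 : ℝ) / 2) := by
    filter_upwards [eventually_gt_nhds hA] with B hB
    have h1 : √(1 + γ * B) ^ 2 = 1 + γ * B := Real.sq_sqrt (by positivity)
    have h2 : √(1 + γ) ^ 2 = 1 + γ := Real.sq_sqrt (by positivity)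
    have h3 : 0 < √(1 + γ * B) + √(1 + γ) := by positivity
    rw [travelPhase]
    congr 1
    generalize √(1 + γ * B) = s at h1 h3 ⊢
    generalize √(1 + γ) = r at h2 h3 ⊢
    field_simp
    linear_combination T * (h2 - h1)
  refine HasDerivAt.congr_of_eventuallyEq ?_ hev
  have hs : HasDerivAt (fun A => √(1 + γ * A)) (γ / (2 * √(1 + γ * A))) A := by
    refine (((hasDerivAt_id A).const_mul γ).const_add 1).sqrt (by positivity) |>.congr_deriv ?_
    simp
  have hp := (Real.hasDerivAt_rpow_const (p := (3 : ℝ) / 2) (Or.inl hA.ne')).const_mul (4 / 3 * (N : ℝ))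
  refine (((hs.sub_const (√(1 + γ))).const_mul (T / γ)).sub hp).congr_deriv ?_
  rw [show (3 : ℝ) / 2 - 1 = 1 / 2 by norm_num, ← Real.sqrt_eq_rpow]
  field_simp
  ring

theorem integral_four {f : ℝ × ℝ × ℝ × ℝ → ℂ} (hf : Integrable f) :
    ∫ v, f v = ∫ η, ∫ A, ∫ Υ, ∫ S, f (S, Υ, A, η) := by
  have h1 : Integrable (fun w : ℝ × ℝ × ℝ => ∫ S, f (S, w)) := hf.integral_prod_right
  have h2 : Integrable (fun w : ℝ × ℝ => ∫ Υ, ∫ S, f (S, Υ, w)) := h1.integral_prod_right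
  calc ∫ v, f v = ∫ w : ℝ × ℝ × ℝ, ∫ S, f (S, w) := integral_prod_symm f hf
    _ = ∫ w : ℝ × ℝ, ∫ Υ, ∫ S, f (S, Υ, w) := integral_prod_symm _ h1
    _ = _ := integral_prod_symm _ h2

theorem integral_eq_cutoffAiry {χ χ' : ℝ → ℂ} {B : ℝ} (hχ : CutoffBounds χ χ' B) (μ x : ℝ) :
    ∫ y, χ y * osc (μ * (y ^ 3 / 3 + y * x)) = cutoffAiry χ μ x := by
  rw [cutoffAiry, intervalIntegral.integral_of_le (by norm_num)]
  refine (setIntegral_eq_integral_of_forall_compl_eq_zero fun y hy => ?_).symm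
  rw [hχ.eq_zero y, zero_mul]
  by_contra! h
  have := abs_lt.1 h
  exact hy ⟨this.1, this.2.le⟩

theorem Wtrans_integrand_eq (L ψ χ₂ ψ₂ : ℝ → ℝ) (h γ a : ℝ) (hl : γ ^ ((3 : ℝ) / 2) / h ≠ 0)
    (N : ℤ) (T X Y S Υ A η : ℝ) :
    Complex.exp (Complex.I *
      (((γ ^ ((3:ℝ)/2) / h) * PsiTrans L h γ a N T X Y Υ S A η : ℝ) : ℂ)) *
    ((η ^ 2 * ψ η * χ₂ S * χ₂ Υ * ψ₂ A : ℝ) : ℂ) =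
    ((η ^ 2 * ψ η : ℝ) : ℂ) * osc (γ ^ ((3 : ℝ) / 2) / h * η * Y) *
    ((ψ₂ A : ℂ) * osc (N * Bfun L (γ ^ ((3 : ℝ) / 2) / h * η * A ^ ((3 : ℝ) / 2))) *
      osc (γ ^ ((3 : ℝ) / 2) / h * η * travelPhase N T γ A) *
      ((χ₂ Υ : ℂ) * osc (γ ^ ((3 : ℝ) / 2) / h * η * (Υ ^ 3 / 3 + Υ * (X - A)))) *
      ((χ₂ S : ℂ) * osc (γ ^ ((3 : ℝ) / 2) / h * η * (S ^ 3 / 3 + S * (a / γ - A))))) := by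
  have e : γ ^ ((3 : ℝ) / 2) / h * PsiTrans L h γ a N T X Y Υ S A η =
      γ ^ ((3 : ℝ) / 2) / h * η * Y +
      (N * Bfun L (γ ^ ((3 : ℝ) / 2) / h * η * A ^ ((3 : ℝ) / 2)) +
      (γ ^ ((3 : ℝ) / 2) / h * η * travelPhase N T γ A +
      (γ ^ ((3 : ℝ) / 2) / h * η * (Υ ^ 3 / 3 + Υ * (X - A)) +
      γ ^ ((3 : ℝ) / 2) / h * η * (S ^ 3 / 3 + S * (a / γ - A))))) := by
    rw [PsiTrans, travelPhase, mul_comm η (γ ^ ((3 : ℝ) / 2) / h)]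
    generalize γ ^ ((3 : ℝ) / 2) / h = l at hl ⊢
    generalize Bfun L (l * η * A ^ ((3 : ℝ) / 2)) = b
    rw [mul_add, ← mul_assoc l (N / l) b, mul_div_cancel₀ _ hl]
    ring
  rw [show Complex.exp (Complex.I * ((γ ^ ((3 : ℝ) / 2) / h *
    PsiTrans L h γ a N T X Y Υ S A η : ℝ) : ℂ)) = osc (γ ^ ((3 : ℝ) / 2) / h *
    PsiTrans L h γ a N T X Y Υ S A η) from rfl, e, osc_add, osc_add, osc_add, osc_add]
  push_cast
  ring

theorem continuous_PsiTrans {L : ℝ → ℝ} (hL : Continuous L) {h γ a : ℝ} (hγ : 0 < γ) (N : ℤ)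
    (T X Y : ℝ) : Continuous fun v : ℝ × ℝ × ℝ × ℝ =>
      PsiTrans L h γ a N T X Y v.2.1 v.1 v.2.2.1 v.2.2.2 := by
  have hB : Continuous (Bfun L) := by
    unfold Bfun
    exact (by fun_prop : Continuous fun u : ℝ => 4 / 3 * u + Real.pi / 2).sub
      (hL.comp (continuous_id.rpow_const fun _ => Or.inr (by norm_num)))
  have hA : Continuous fun v : ℝ × ℝ × ℝ × ℝ => v.2.2.1 ^ ((3 : ℝ) / 2) :=
    (by fun_prop : Continuous fun v : ℝ × ℝ × ℝ × ℝ => v.2.2.1).rpow_const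
      fun _ => Or.inr (by norm_num)
  have hq : Continuous fun v : ℝ × ℝ × ℝ × ℝ =>
      T * (v.2.2.1 - 1) / (√(1 + γ * v.2.2.1) + √(1 + γ)) :=
    Continuous.div (by fun_prop) (by fun_prop) fun v => by positivity
  have hBv : Continuous fun v : ℝ × ℝ × ℝ × ℝ =>
      Bfun L (v.2.2.2 * (γ ^ ((3:ℝ)/2) / h) * v.2.2.1 ^ ((3:ℝ)/2)) :=
    hB.comp (by fun_prop)
  unfold PsiTrans
  fun_prop

theorem integrable_Wtrans {L ψ χ₂ ψ₂ : ℝ → ℝ} (hL : Continuous L) (hψ : Continuous ψ)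
    (hψs : tsupport ψ ⊆ Set.Icc (1/2 : ℝ) (3/2)) (hψ₂ : Continuous ψ₂)
    (hψ₂s : tsupport ψ₂ ⊆ Set.Icc (1/2 : ℝ) (3/2)) (hχ : Continuous χ₂)
    (hχs : tsupport χ₂ ⊆ Set.Ioo (-(3/2) : ℝ) (3/2)) {h γ a : ℝ} (hγ : 0 < γ) (N : ℤ)
    (T X Y : ℝ) : Integrable fun v : ℝ × ℝ × ℝ × ℝ =>
      Complex.exp (Complex.I *
      (((γ ^ ((3:ℝ)/2) / h) * PsiTrans L h γ a N T X Y v.2.1 v.1 v.2.2.1 v.2.2.2 : ℝ) : ℂ)) *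
    ((v.2.2.2 ^ 2 * ψ v.2.2.2 * χ₂ v.1 * χ₂ v.2.1 * ψ₂ v.2.2.1 : ℝ) : ℂ) := by
  have hP := continuous_PsiTrans hL (h := h) (a := a) hγ N T X Y
  refine Continuous.integrable_of_hasCompactSupport ?_ ?_
  · exact (Complex.continuous_exp.comp (continuous_const.mul
      (Complex.continuous_ofReal.comp (continuous_const.mul hP)))).mul
      (Complex.continuous_ofReal.comp (by fun_prop))
  · have hout : ∀ {f : ℝ → ℝ} {x : ℝ}, x ∉ tsupport f → f x = 0 := image_eq_zero_of_notMem_tsupport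
    have hK : ∀ {f : ℝ → ℝ} {b c : ℝ}, tsupport f ⊆ Set.Icc b c → IsCompact (tsupport f) :=
      hasCompactSupport_of_tsupport_subset_Icc
    have hcχ := hK (hχs.trans Set.Ioo_subset_Icc_self)
    refine HasCompactSupport.intro (hcχ.prod (hcχ.prod ((hK hψ₂s).prod (hK hψs)))) fun v hv => ?_
    have : v.2.2.2 ^ 2 * ψ v.2.2.2 * χ₂ v.1 * χ₂ v.2.1 * ψ₂ v.2.2.1 = 0 := by
      by_contra hne
      simp only [mul_ne_zero_iff] at hne
      obtain ⟨⟨⟨⟨-, k1⟩, k2⟩, k3⟩, k4⟩ := hne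
      exact hv ⟨subset_tsupport _ k2, subset_tsupport _ k3, subset_tsupport _ k4,
        subset_tsupport _ k1⟩
    rw [this, Complex.ofReal_zero, mul_zero]

theorem integral_eq_intervalIntegral_of_tsupport {f : ℝ → ℝ} (hf : Continuous f)
    (hs : tsupport f ⊆ Set.Icc (1/2 : ℝ) (3/2)) {g : ℝ → ℂ} (hg : ∀ x, f x = 0 → g x = 0) :
    ∫ x, g x = ∫ x in (1 / 2 : ℝ)..(3 / 2), g x := by
  rw [intervalIntegral.integral_of_le (by norm_num)]
  refine (setIntegral_eq_integral_of_forall_compl_eq_zero fun x hx => hg x ?_).symm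
  exact eq_zero_of_tsupport_subset_Icc hf hs fun h => hx ⟨h.1, h.2.le⟩

theorem Wtrans_eq {L ψ χ₂ ψ₂ : ℝ → ℝ} {χ' : ℝ → ℂ} {B : ℝ} (hL : Continuous L) (hψ : Continuous ψ)
    (hψs : tsupport ψ ⊆ Set.Icc (1/2 : ℝ) (3/2)) (hψ₂ : Continuous ψ₂)
    (hψ₂s : tsupport ψ₂ ⊆ Set.Icc (1/2 : ℝ) (3/2)) (hχ : Continuous χ₂)
    (hχs : tsupport χ₂ ⊆ Set.Ioo (-(3/2) : ℝ) (3/2))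
    (hχB : CutoffBounds (fun x => (χ₂ x : ℂ)) χ' B) {h γ a : ℝ} (hγ : 0 < γ)
    (hl : γ ^ ((3 : ℝ) / 2) / h ≠ 0) (N : ℤ) (T X Y : ℝ) :
    Wtrans L ψ χ₂ ψ₂ h γ a N T X Y = ((γ ^ 2 / (2 * Real.pi * h) ^ 3 : ℝ) : ℂ) *
      ∫ η in (1 / 2 : ℝ)..(3 / 2), ((η ^ 2 * ψ η : ℝ) : ℂ) * osc (γ ^ ((3 : ℝ) / 2) / h * η * Y) *
        ∫ A in (1 / 2 : ℝ)..(3 / 2), (ψ₂ A : ℂ) *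
          osc (N * Bfun L (γ ^ ((3 : ℝ) / 2) / h * η * A ^ ((3 : ℝ) / 2))) *
          osc (γ ^ ((3 : ℝ) / 2) / h * η * travelPhase N T γ A) *
          cutoffAiry (fun x => (χ₂ x : ℂ)) (γ ^ ((3 : ℝ) / 2) / h * η) (X - A) *
          cutoffAiry (fun x => (χ₂ x : ℂ)) (γ ^ ((3 : ℝ) / 2) / h * η) (a / γ - A) := by
  rw [Wtrans, integral_four (integrable_Wtrans hL hψ hψs hψ₂ hψ₂s hχ hχs hγ N T X Y)]
  congr 1
  simp only [Wtrans_integrand_eq L ψ χ₂ ψ₂ h γ a hl N T X Y]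
  simp only [integral_const_mul, integral_mul_const, integral_eq_cutoffAiry hχB]
  rw [integral_eq_intervalIntegral_of_tsupport hψ hψs fun η hη => by simp [hη]]
  congr 1
  funext η
  rw [integral_eq_intervalIntegral_of_tsupport hψ₂ hψ₂s fun A hA => by simp [hA]]

theorem exists_norm_integral_refl_le {L : ℝ → ℝ} (hL : IsAiryPhase L) {χ₂ ψ₂ : ℝ → ℝ}
    (hψ₂ : ContDiff ℝ (⊤ : ℕ∞) ψ₂) (hψ₂s : tsupport ψ₂ ⊆ Set.Icc (1/2 : ℝ) (3/2))
    (hχ₂ : ContDiff ℝ (⊤ : ℕ∞) χ₂) (hχ₂s : tsupport χ₂ ⊆ Set.Ioo (-(3/2) : ℝ) (3/2)) :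
    ∃ μ₀ C : ℝ, 0 ≤ C ∧ ∀ (μ T γ α X : ℝ), μ₀ < μ → 1 ≤ μ → 1 ≤ |T| → |T| ≤ 9 → 0 < γ →
      γ ≤ 1 / 10 ^ 10 → 0 ≤ α → α ≤ 1 / 4 → ∀ N ∈ Finset.Icc (-2 : ℤ) 2,
      ‖∫ A in (1 / 2 : ℝ)..(3 / 2), (ψ₂ A : ℂ) *
          osc (N * Bfun L (μ * A ^ ((3 : ℝ) / 2))) * osc (μ * travelPhase N T γ A) *
          cutoffAiry (fun x => (χ₂ x : ℂ)) μ (X - A) *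
          cutoffAiry (fun x => (χ₂ x : ℂ)) μ (α - A)‖ ≤ C * μ ^ (-(4 / 3) : ℝ) := by
  obtain ⟨B, hB⟩ := exists_cutoffBounds hχ₂ hχ₂s
  have hχ3 : ContDiff ℝ 3 fun x => (χ₂ x : ℂ) :=
    Complex.ofRealCLM.contDiff.comp (contDiff_infty.1 hχ₂ 3)
  obtain ⟨C, hC, hmain⟩ := norm_integral_three_le (c := 1 / 10) (c₁ := 1 / 10 ^ 6) (D := 100)
    (τ₀ := 1 / 10 ^ 10) (by norm_num) (by norm_num) (by norm_num) (by norm_num) (by norm_num) hχ3 hB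
  obtain ⟨M₂, hM₂⟩ := exists_amplitudeBounds_of_contDiff hψ₂
  obtain ⟨μ₀, M, hM⟩ := exists_amplitudeBounds_refl hL
  have hM0 : 0 ≤ M := by
    obtain ⟨_, _, hH⟩ := hM (μ₀ + 1) (by linarith) 0 (by simp)
    exact hH.nonneg
  refine ⟨μ₀, C * (4 * (M₂ * M)), mul_nonneg hC (mul_nonneg (by norm_num)
    (mul_nonneg hM₂.nonneg hM0)), fun μ T γ α X hμ hμ1 hT hT' hγ hγ' hα hα' N hN => ?_⟩
  obtain ⟨H1, H2, hH⟩ := hM μ hμ N hN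
  have hμ0 : 0 < μ := by linarith
  have hz : ∀ A, A ∉ Set.Ioo (1 / 2 : ℝ) (3 / 2) → ψ₂ A = 0 := fun A hA =>
    eq_zero_of_tsupport_subset_Icc hψ₂.continuous hψ₂s hA
  have hν : μ * (μ ^ (-(1 / 3) : ℝ)) ^ 3 = 1 := by
    rw [← Real.rpow_natCast, ← Real.rpow_mul hμ0.le]
    norm_num [Real.rpow_neg_one, hμ0.ne']
  have hδ : μ * (μ ^ (-(1 / 2) : ℝ)) ^ 2 = 1 := by
    rw [← Real.rpow_natCast, ← Real.rpow_mul hμ0.le]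
    norm_num [Real.rpow_neg_one, hμ0.ne']
  have := hmain α X μ (μ ^ (-(1 / 3) : ℝ)) (μ ^ (-(1 / 2) : ℝ)) _ (travelPhase N T γ) _ _ _ _
    hα hα' (phaseFamilyBounds hN hT hT' hγ hγ' hα hα')
    (fun A hA => hasDerivAt_travelPhase N T hγ (by linarith [hA.1])) hμ0 (by positivity)
    (Real.rpow_le_one_of_one_le_of_nonpos hμ1 (by norm_num)) hν (by positivity) hδ (hM₂.mul hH)
    (by rw [hz _ (by simp)]; simp) (by rw [hz _ (by simp)]; simp)
  refine this.trans (le_of_eq ?_)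
  congr 1
  rw [← Real.rpow_natCast, ← Real.rpow_mul hμ0.le, ← Real.rpow_add hμ0]
  norm_num

theorem prefactor_le {h γ T l C₀ : ℝ} (hh : 0 < h) (hγ : 0 < γ) (hl : l = γ ^ ((3 : ℝ) / 2) / h)
    (hl1 : 1 ≤ l) (hT : 1 ≤ |T|) (hT' : |T| ≤ 9) (hC : 0 ≤ C₀) :
    γ ^ 2 / (2 * Real.pi * h) ^ 3 * (C₀ * (l / 2) ^ (-(4 / 3) : ℝ)) ≤
      36 * C₀ * (√γ / h ^ 2) * min 1 ((h / (γ * (√γ * |T|))) ^ ((1 : ℝ) / 3)) := by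
  have hl0 : 0 < l := by linarith
  have hlγ : γ ^ ((3 : ℝ) / 2) = γ * √γ := by
    rw [Real.sqrt_eq_rpow, ← Real.rpow_one_add' hγ.le (by norm_num)]
    norm_num
  have hs : √γ * √γ = γ := Real.mul_self_sqrt hγ.le
  have hs0 : 0 < √γ := Real.sqrt_pos.2 hγ
  have hT0 : 0 < |T| := by linarith
  have e1 : h / (γ * (√γ * |T|)) = l⁻¹ * |T|⁻¹ := by
    rw [hl, hlγ]
    field_simp
  have e2 : γ ^ 2 / h ^ 3 * l⁻¹ = √γ / h ^ 2 := by
    rw [hl, hlγ]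
    field_simp
    linear_combination -hs
  have hmin : l ^ (-(1 / 3) : ℝ) ≤ 9 * min 1 ((h / (γ * (√γ * |T|))) ^ ((1 : ℝ) / 3)) := by
    rw [e1, Real.mul_rpow (by positivity) (by positivity), Real.inv_rpow hl0.le,
      ← Real.rpow_neg hl0.le]
    have h1 : l ^ (-(1 / 3) : ℝ) ≤ 1 := Real.rpow_le_one_of_one_le_of_nonpos hl1 (by norm_num)
    have h2 : 1 / 9 ≤ (|T|⁻¹) ^ ((1 : ℝ) / 3) := by
      have h3 : 1 / 9 ≤ |T|⁻¹ := by
        rw [one_div]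
        exact inv_anti₀ hT0 hT'
      have h4 : |T|⁻¹ ≤ 1 := inv_le_one_of_one_le₀ hT
      calc 1 / 9 ≤ |T|⁻¹ := h3
        _ = (|T|⁻¹) ^ (1 : ℝ) := (Real.rpow_one _).symm
        _ ≤ _ := Real.rpow_le_rpow_of_exponent_ge (by positivity) h4 (by norm_num)
    have h5 : 0 < l ^ (-(1 / 3) : ℝ) := by positivity
    rw [mul_min_of_nonneg _ _ (by norm_num)]
    refine le_min (by linarith) ?_
    nlinarith
  have hhalf : (l / 2) ^ (-(4 / 3) : ℝ) ≤ 4 * (l⁻¹ * l ^ (-(1 / 3) : ℝ)) := by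
    have e3 : l⁻¹ * l ^ (-(1 / 3) : ℝ) = l ^ (-(4 / 3) : ℝ) := by
      rw [← Real.rpow_neg_one, ← Real.rpow_add hl0]
      norm_num
    have e4 : ((2 : ℝ)⁻¹) ^ (-(4 / 3) : ℝ) ≤ 4 := by
      calc ((2 : ℝ)⁻¹) ^ (-(4 / 3) : ℝ) ≤ ((2 : ℝ)⁻¹) ^ (-2 : ℝ) :=
            Real.rpow_le_rpow_of_exponent_ge (by norm_num) (by norm_num) (by norm_num)
        _ = 4 := by
          rw [Real.inv_rpow (by norm_num), ← Real.rpow_neg (by norm_num)]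
          norm_num
    rw [e3, div_eq_mul_inv, Real.mul_rpow hl0.le (by norm_num), mul_comm]
    gcongr
  have hpi : h ≤ 2 * Real.pi * h := by nlinarith [Real.pi_gt_three]
  calc γ ^ 2 / (2 * Real.pi * h) ^ 3 * (C₀ * (l / 2) ^ (-(4 / 3) : ℝ))
      ≤ γ ^ 2 / h ^ 3 * (C₀ * (4 * (l⁻¹ * l ^ (-(1 / 3) : ℝ)))) := by gcongr
    _ = 4 * C₀ * (√γ / h ^ 2) * l ^ (-(1 / 3) : ℝ) := by rw [← e2]; ring
    _ ≤ 4 * C₀ * (√γ / h ^ 2) * (9 * min 1 ((h / (γ * (√γ * |T|))) ^ ((1 : ℝ) / 3))) := by gcongr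
    _ = _ := by ring

/-- dispersive bound for the transverse waves with `|N| ≤ 2`, for
`1 ≤ |T| ≤ 9`, with `t = √γ T`. -/
theorem dispersion_transverse_mediumT
    (Ai : ℂ → ℂ)
    (hAi_diff : Differentiable ℂ Ai)
    (hAi_diff' : Differentiable ℂ (deriv Ai))
    (hAi_ode : ∀ z : ℂ, deriv (deriv Ai) z = z * Ai z)
    (hAi_zero : Ai 0 = (3 : ℂ) ^ (-(2 : ℂ)/3) / Complex.Gamma (2/3))
    (hAi_zero' : deriv Ai 0 = -((3 : ℂ) ^ (-(1 : ℂ)/3)) / Complex.Gamma (1/3))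
    (hAi_real : ∀ x : ℝ, (Ai x).im = 0)
    (L : ℝ → ℝ)
    (hL_cont : Continuous L)
    (hL_zero : L 0 = Real.pi / 3)
    (hAp_ne : ∀ w : ℝ, Aplus Ai w ≠ 0)
    (hL_char : ∀ w : ℝ, Complex.exp (-(L w : ℂ) * Complex.I) = -(Aminus Ai w) / (Aplus Ai w))
    (ψ : ℝ → ℝ) (hψ : ContDiff ℝ (⊤ : ℕ∞) ψ) (hψs : tsupport ψ ⊆ Set.Icc (1/2 : ℝ) (3/2))
    (ψ₂ : ℝ → ℝ) (hψ₂ : ContDiff ℝ (⊤ : ℕ∞) ψ₂) (hψ₂s : tsupport ψ₂ ⊆ Set.Icc (1/2 : ℝ) (3/2))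
    (χ₂ : ℝ → ℝ) (hχ₂ : ContDiff ℝ (⊤ : ℕ∞) χ₂)
    (hχ₂s : tsupport χ₂ ⊆ Set.Ioo (-(3/2) : ℝ) (3/2))
    : ∃ γ₀ ∈ Set.Ioo (0:ℝ) 1, ∃ lam₀ : ℝ, 8 ≤ lam₀ ∧ ∃ C : ℝ,
      ∀ h γ a : ℝ, 0 < h → h ≤ 1 → 0 < γ → γ ≤ γ₀ → lam₀ ≤ γ ^ ((3:ℝ)/2) / h →
      0 < a → a < γ / 4 →
      ∀ X : ℝ, 0 ≤ X → ∀ Y T : ℝ, 1 ≤ |T| → |T| ≤ 9 →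
        (∑ N ∈ Finset.Icc (-2 : ℤ) 2, ‖Wtrans L ψ χ₂ ψ₂ h γ a N T X Y‖)
          ≤ C * (Real.sqrt γ / h ^ 2) *
            min 1 ((h / (γ * (Real.sqrt γ * |T|))) ^ ((1:ℝ)/3)) := by
  obtain ⟨μ₀, C₁, hC₁, hmain⟩ := exists_norm_integral_refl_le
    (isAiryPhase hAi_diff hAi_diff' hAi_ode hAi_zero hAi_zero' (hAi_real 0) hAp_ne hL_char)
    hψ₂ hψ₂s hχ₂ hχ₂s
  obtain ⟨B, hB⟩ := exists_cutoffBounds hχ₂ hχ₂s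
  obtain ⟨Bψ, hBψ⟩ :=
    (hasCompactSupport_of_tsupport_subset_Icc hψs).exists_bound_of_continuous hψ.continuous
  have hBψ0 : 0 ≤ Bψ := (norm_nonneg _).trans (hBψ 0)
  refine ⟨1 / 10 ^ 10, by norm_num, max 8 (2 * μ₀ + 1), le_max_left _ _,
    5 * (36 * (9 / 4 * Bψ * C₁)), fun h γ a hh _ hγ hγ' hl ha ha' X _ Y T hT hT' => ?_⟩
  set l := γ ^ ((3 : ℝ) / 2) / h with hldef
  have hl8 : 8 ≤ l := (le_max_left _ _).trans hl
  have hlμ : 2 * μ₀ + 1 ≤ l := (le_max_right _ _).trans hl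
  have hα : 0 ≤ a / γ := by positivity
  have hα' : a / γ ≤ 1 / 4 := by
    rw [div_le_iff₀ hγ]
    linarith
  have hN : ∀ N ∈ Finset.Icc (-2 : ℤ) 2, ‖Wtrans L ψ χ₂ ψ₂ h γ a N T X Y‖ ≤
      36 * (9 / 4 * Bψ * C₁) * (√γ / h ^ 2) *
        min 1 ((h / (γ * (√γ * |T|))) ^ ((1 : ℝ) / 3)) := fun N hN => by
    rw [Wtrans_eq hL_cont hψ.continuous hψs hψ₂.continuous hψ₂s hχ₂.continuous hχ₂s hB hγ
      (by rw [← hldef]; linarith) N T X Y, norm_mul, Complex.norm_real,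
      Real.norm_of_nonneg (by positivity)]
    refine le_trans (mul_le_mul_of_nonneg_left ?_ (by positivity))
      (prefactor_le hh hγ hldef (by linarith) hT hT' (by positivity))
    refine (intervalIntegral.norm_integral_le_of_norm_le_const
      (C := 9 / 4 * Bψ * C₁ * (l / 2) ^ (-(4 / 3) : ℝ)) fun η hη => ?_).trans_eq (by norm_num)
    rw [Set.uIoc_of_le (by norm_num)] at hη
    have hη0 : 0 < η := by linarith [hη.1]
    have hμ : l / 2 ≤ l * η := by nlinarith [hη.1]
    have hb := hmain (l * η) T γ (a / γ) X (by linarith) (by linarith) hT hT' hγ hγ' hα hα' N hN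
    have hη2 : ‖((η ^ 2 * ψ η : ℝ) : ℂ)‖ ≤ 9 / 4 * Bψ := by
      rw [Complex.norm_real, norm_mul, Real.norm_of_nonneg (by positivity)]
      refine mul_le_mul ?_ (hBψ η) (norm_nonneg _) (by norm_num)
      nlinarith [hη.2]
    rw [norm_mul, norm_mul, norm_osc, mul_one, mul_assoc (9 / 4 * Bψ)]
    refine mul_le_mul hη2 (hb.trans ?_) (norm_nonneg _) (by positivity)
    exact mul_le_mul_of_nonneg_left
      (Real.rpow_le_rpow_of_nonpos (by linarith) hμ (by norm_num)) hC₁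
  refine (Finset.sum_le_card_nsmul _ _ _ hN).trans (le_of_eq ?_)
  rw [show (Finset.Icc (-2 : ℤ) 2).card = 5 from rfl, nsmul_eq_mul]
  push_cast
  ring
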